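/- Let k be a positive integer (so 2k ≥ 1 is a fixed integer) and let a_1, ..., a_{2k}, A be fixed positive real numbers. Let q be an integer greater than 1 and assume that every Dirichlet L-function L(s,χ) attached to a Dirichlet character χ mod q satisfies the Riemann Hypothesis. Let t = (t_1, ..., t_{2k}) be a tuple of real numbers with |t_j| ≤ q^A for each j. Then there is a constant C depending only on k, A and the a_j (but not on q or the t_j) such that ∑_{χ ∈ X_q^*} |L(1/2+it_1,χ)|^{a_1} ⋯ |L(1/2+it_{2k},χ)|^{a_{2k}} ≤ C · φ(q) · (log q)^{(a_1²+⋯+a_{2k}²)/4} · ∏_{1≤i<j≤2k} g(|t_i − t_j|)^{a_i a_j/2}. -/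

import Mathlib

open Complex Real Finset


def dirichletRH {q : ℕ} [NeZero q] (χ : DirichletCharacter ℂ q) : Prop :=
  ∀ s : ℂ, 0 < s.re → s.re < 1 → DirichletCharacter.LFunction χ s = 0 → s.re = 1 / 2

noncomputable def gfun (q : ℕ) (x : ℝ) : ℝ :=
  if x ≤ 1 / Real.log q ∨ Real.exp q ≤ x then Real.log q
  else if x ≤ 10 then 1 / x
  else Real.log (Real.log x)


/-- bounded summatory function gives analytic Mellin-type integral on Re s > 0 -/
lemma mel_diff (S : ℝ → ℂ) (hS : Measurable S) (B : ℝ) (hB : ∀ t, ‖S t‖ ≤ B) (s : ℂ) (hs : 0 < s.re) :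
    DifferentiableAt ℂ (fun s : ℂ => ∫ t in Set.Ioi (1:ℝ), S t * (t:ℂ) ^ (-(s+1))) s := by
  set f : ℝ → ℂ := Set.indicator (Set.Ioi 1) S with hf
  have hfm : Measurable f := hS.indicator measurableSet_Ioi
  have hfb : ∀ t, ‖f t‖ ≤ B := by
    intro t
    by_cases h : t ∈ Set.Ioi (1:ℝ)
    · simp only [hf, Set.indicator_of_mem h]; exact hB t
    · simp only [hf, Set.indicator_of_notMem h, norm_zero]; exact (norm_nonneg _).trans (hB 0)
  have hli : MeasureTheory.LocallyIntegrableOn f (Set.Ioi 0) := by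
    apply MeasureTheory.LocallyIntegrable.locallyIntegrableOn
    intro x
    refine ⟨Set.Icc (x-1) (x+1), Icc_mem_nhds (by linarith) (by linarith), ?_⟩
    apply MeasureTheory.Measure.integrableOn_of_bounded (M := B)
    · simp
    · exact hfm.aestronglyMeasurable
    · exact Filter.Eventually.of_forall hfb
  have hm : ∀ z : ℂ, ∫ t in Set.Ioi (1:ℝ), S t * (t:ℂ) ^ (-(z+1)) = mellin f (-z) := by
    intro z
    unfold mellin
    have : ∀ t ∈ Set.Ioi (0:ℝ), (t:ℂ) ^ (-z - 1) • f t =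
        Set.indicator (Set.Ioi 1) (fun t : ℝ => S t * (t:ℂ) ^ (-(z+1))) t := by
      intro t ht
      by_cases h : t ∈ Set.Ioi (1:ℝ)
      · simp only [hf, Set.indicator_of_mem h]
        rw [smul_eq_mul, mul_comm]; ring_nf
      · simp only [hf, Set.indicator_of_notMem h]; simp
    rw [MeasureTheory.setIntegral_congr_fun measurableSet_Ioi this,
      MeasureTheory.setIntegral_indicator measurableSet_Ioi]
    congr 2
    ext x; simp
  have : DifferentiableAt ℂ (mellin f) (-s) := by
    refine mellin_differentiableAt_of_isBigO_rpow (a := 0) (b := -s.re - 1) hli ?_ ?_ ?_ ?_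
    · apply Asymptotics.IsBigO.of_bound B
      filter_upwards with t
      simpa using hfb t
    · simp [hs]
    · apply Asymptotics.IsBigO.of_bound 1
      have : Set.Ioo (0:ℝ) 1 ∈ nhdsWithin (0:ℝ) (Set.Ioi 0) := Ioo_mem_nhdsGT one_pos
      filter_upwards [this] with t ht
      have h : t ∉ Set.Ioi (1:ℝ) := by simp; linarith [ht.2]
      simp only [hf, Set.indicator_of_notMem h, norm_zero]; positivity
    · simp
  have h2 : DifferentiableAt ℂ (fun z : ℂ => mellin f (-z)) s := by
    have := DifferentiableAt.comp (x := s) (f := fun z : ℂ => -z) (g := mellin f) this (by fun_prop)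
    exact this
  exact h2.congr_of_eventuallyEq (Filter.Eventually.of_forall hm)

lemma mel_bound (S : ℝ → ℂ) (B : ℝ) (hB : ∀ t, ‖S t‖ ≤ B) (s : ℂ) (hs : 0 < s.re) :
    ‖∫ t in Set.Ioi (1:ℝ), S t * (t:ℂ) ^ (-(s+1))‖ ≤ B / s.re := by
  have hlt : -(s.re+1) < -1 := by linarith
  have h1 : ∫ t in Set.Ioi (1:ℝ), B * t ^ (-(s.re+1)) = B / s.re := by
    rw [MeasureTheory.integral_const_mul, integral_Ioi_rpow_of_lt hlt one_pos]
    simp; field_simp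
  rw [← h1]
  apply MeasureTheory.norm_integral_le_of_norm_le
  · exact (integrableOn_Ioi_rpow_of_lt hlt one_pos).const_mul B
  · refine (MeasureTheory.ae_restrict_iff' measurableSet_Ioi).2 (Filter.Eventually.of_forall ?_)
    intro t ht
    have ht0 : (0:ℝ) < t := lt_trans one_pos ht
    rw [norm_mul, Complex.norm_cpow_eq_rpow_re_of_pos ht0]
    simp only [neg_re, add_re, one_re]
    gcongr
    exact hB t

lemma half_preconn (c : ℝ) : IsPreconnected {s : ℂ | c < s.re} :=
  (convex_halfSpace_re_gt c).isPreconnected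

lemma half_open (c : ℝ) : IsOpen {s : ℂ | c < s.re} := isOpen_lt continuous_const continuous_re

/-- two functions analytic on Re>0 agreeing on Re>1 agree -/
lemma half_ident (f g : ℂ → ℂ) (hf : DifferentiableOn ℂ f {s | 0 < s.re})
    (hg : DifferentiableOn ℂ g {s | 0 < s.re}) (h : ∀ s : ℂ, 1 < s.re → f s = g s) (s : ℂ) (hs : 0 < s.re) :
    f s = g s := by
  have := (hf.analyticOnNhd (half_open 0)).eqOn_of_preconnected_of_eventuallyEq
    (hg.analyticOnNhd (half_open 0)) (half_preconn 0) (z₀ := 2) (by simp) ?_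
  · exact this hs
  · filter_upwards [(half_open 1).mem_nhds (show (2:ℂ) ∈ {s : ℂ | 1 < s.re} by simp)] with z hz
    exact h z hz

lemma char_sum_bound {q : ℕ} [NeZero q] (χ : DirichletCharacter ℂ q) (hχ : χ ≠ 1) (n : ℕ) :
    ‖∑ k ∈ Finset.Icc 1 n, χ k‖ ≤ q := by
  have hper : ∀ m : ℕ, ∑ k ∈ Finset.range q, χ ((m + k : ℕ) : ZMod q) = 0 := by
    intro m
    have h0 : ∑ a : ZMod q, χ a = 0 := MulChar.sum_eq_zero_of_ne_one hχ
    have h1 : ∑ a : ZMod q, χ ((m : ZMod q) + a) = 0 := by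
      rw [← h0]; exact Equiv.sum_comp (Equiv.addLeft (m : ZMod q)) (fun a => χ a)
    rw [← h1]
    refine Finset.sum_bij (fun k _ => (k : ZMod q)) (by simp) ?_ ?_ ?_
    · intro a ha b hb hab
      rw [Finset.mem_range] at ha hb
      have := (ZMod.natCast_eq_natCast_iff' a b q).1 hab
      rwa [Nat.mod_eq_of_lt ha, Nat.mod_eq_of_lt hb] at this
    · intro b _
      exact ⟨b.val, Finset.mem_range.2 (ZMod.val_lt b), ZMod.natCast_zmod_val b⟩
    · intro a ha; push_cast; rfl
  have hgen : ∀ n m : ℕ, ‖∑ k ∈ Finset.range n, χ ((m + k : ℕ) : ZMod q)‖ ≤ q := by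
    intro n
    induction n using Nat.strong_induction_on with
    | _ n ih =>
      intro m
      by_cases hn : n < q
      · refine (norm_sum_le _ _).trans ?_
        calc _ ≤ ∑ k ∈ Finset.range n, (1:ℝ) := Finset.sum_le_sum fun k _ => χ.norm_le_one _
          _ = n := by simp
          _ ≤ q := by exact_mod_cast hn.le
      · push Not at hn
        have hq : 0 < q := Nat.pos_of_ne_zero (NeZero.ne q)
        obtain ⟨r, rfl⟩ := Nat.exists_eq_add_of_le hn
        rw [Finset.sum_range_add, hper, zero_add]
        have := ih r (by omega) (m + q)
        simpa [add_assoc] using this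
  have := hgen n 1
  have e : Finset.Icc 1 n = Finset.Ico 1 (n+1) := rfl
  rw [e, Finset.sum_Ico_eq_sum_range]
  simpa using this

lemma LFun_bound {q : ℕ} [NeZero q] (χ : DirichletCharacter ℂ q) (hχ : χ ≠ 1) (s : ℂ) (hs : 0 < s.re) :
    ‖DirichletCharacter.LFunction χ s‖ ≤ q * ‖s‖ / s.re := by
  set S : ℝ → ℂ := fun t => ∑ k ∈ Finset.Icc 1 ⌊t⌋₊, χ k with hS
  have hSm : Measurable S := by
    have : S = (fun n : ℕ => ∑ k ∈ Finset.Icc 1 n, χ k) ∘ (fun t : ℝ => ⌊t⌋₊) := rfl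
    rw [this]
    exact (measurable_from_nat).comp Nat.measurable_floor
  have hSb : ∀ t, ‖S t‖ ≤ q := fun t => char_sum_bound χ hχ _
  have hid := half_ident (DirichletCharacter.LFunction χ)
    (fun s => s * ∫ t in Set.Ioi (1:ℝ), S t * (t:ℂ) ^ (-(s+1)))
    ((DirichletCharacter.differentiable_LFunction hχ).differentiableOn)
    (fun s hs => (differentiableAt_id.mul (mel_diff S hSm q hSb s hs)).differentiableWithinAt)
    (by
      intro s hs
      rw [DirichletCharacter.LFunction_eq_LSeries χ hs]
      refine LSeries_eq_mul_integral (fun n : ℕ => χ n) (r := 0) le_rfl (by linarith)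
        (DirichletCharacter.LSeriesSummable_of_one_lt_re χ hs) ?_
      apply Asymptotics.IsBigO.of_bound q
      filter_upwards with n
      simpa using char_sum_bound χ hχ n) s hs
  rw [hid, norm_mul]
  calc _ ≤ ‖s‖ * (q / s.re) := by gcongr; exact mel_bound S q hSb s hs
    _ = _ := by ring

/-- the entire function `(s-1) ζ(s)` -/
noncomputable def zt (s : ℂ) : ℂ := if s = 1 then 1 else (s - 1) * riemannZeta s

lemma zt_of_ne {s : ℂ} (h : s ≠ 1) : zt s = (s - 1) * riemannZeta s := by simp [zt, h]

lemma zt_diff : Differentiable ℂ zt := by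
  have h : zt = Function.update (fun s => (s - 1) * riemannZeta s) 1 1 := by
    ext s; by_cases h : s = 1 <;> simp [zt, h, Function.update]
  have hc : ContinuousAt zt 1 := by
    rw [h, continuousAt_update_same]
    exact riemannZeta_residue_one
  intro s
  have hon : DifferentiableOn ℂ zt (Set.univ) := by
    rw [← Complex.differentiableOn_compl_singleton_and_continuousAt_iff (c := 1) Filter.univ_mem]
    refine ⟨fun z hz => ?_, hc⟩
    have hz1 : z ≠ 1 := by simpa using hz
    have : DifferentiableAt ℂ (fun s => (s - 1) * riemannZeta s) z :=
      (by fun_prop : DifferentiableAt ℂ (fun s : ℂ => s - 1) z).mul (differentiableAt_riemannZeta hz1)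
    refine (this.congr_of_eventuallyEq ?_).differentiableWithinAt
    filter_upwards [isOpen_ne.mem_nhds hz1] with w hw
    exact zt_of_ne hw
  exact hon.differentiableAt Filter.univ_mem

lemma zt_bound (s : ℂ) (hs : 0 < s.re) : ‖zt s‖ ≤ ‖s‖ + ‖s‖ * ‖s - 1‖ / s.re := by
  set S : ℝ → ℂ := fun t => ((Int.fract t : ℝ) : ℂ) with hS
  have hSm : Measurable S := Complex.measurable_ofReal.comp measurable_fract
  have hSb : ∀ t, ‖S t‖ ≤ 1 := by
    intro t; simp only [hS, Complex.norm_real, Real.norm_eq_abs, abs_of_nonneg (Int.fract_nonneg t)]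
    exact (Int.fract_lt_one t).le
  have hid := half_ident zt
    (fun s => s - s * (s - 1) * ∫ t in Set.Ioi (1:ℝ), S t * (t:ℂ) ^ (-(s+1)))
    zt_diff.differentiableOn
    (fun s hs => (differentiableAt_id.sub (((by fun_prop : DifferentiableAt ℂ (fun s : ℂ => s * (s-1)) s)).mul
      (mel_diff S hSm 1 hSb s hs))).differentiableWithinAt)
    (by
      intro s hs
      have hs1 : s ≠ 1 := by rintro rfl; simp at hs
      have hs1' : s - 1 ≠ 0 := sub_ne_zero.2 hs1
      have hs0 : s ≠ 0 := by rintro rfl; simp at hs; linarith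
      rw [zt_of_ne hs1, ← LSeries_one_eq_riemannZeta hs,
        LSeries_eq_mul_integral (1 : ℕ → ℂ) (r := 1) zero_le_one (by simpa using hs)
          (LSeriesSummable_one_iff.2 hs) ?_]
      · have e : ∀ t ∈ Set.Ioi (1:ℝ), (∑ k ∈ Finset.Icc 1 ⌊t⌋₊, (1 : ℕ → ℂ) k) * (t:ℂ) ^ (-(s+1))
            = (t:ℂ) ^ (-s) - S t * (t:ℂ) ^ (-(s+1)) := by
          intro t ht
          have ht0 : (0:ℝ) < t := lt_trans one_pos ht
          have htc : (t:ℂ) ≠ 0 := by exact_mod_cast ht0.ne'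
          have : (t:ℂ) ^ (-s) = t * (t:ℂ) ^ (-(s+1)) := by
            rw [show -s = 1 + (-(s+1)) by ring, Complex.cpow_add _ _ htc, Complex.cpow_one]
          rw [this, ← sub_mul]
          congr 1
          simp only [Pi.one_apply, sum_const, Nat.card_Icc, add_tsub_cancel_right, nsmul_eq_mul, mul_one, hS]
          rw [← ofReal_sub, Int.self_sub_fract]
          have := natCast_floor_eq_intCast_floor (R := ℝ) ht0.le
          rw [← this]; simp
        have i1 : MeasureTheory.IntegrableOn (fun t : ℝ => (t:ℂ) ^ (-s)) (Set.Ioi 1) :=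
          integrableOn_Ioi_cpow_of_lt (by simpa using hs) one_pos
        have i2 : MeasureTheory.IntegrableOn (fun t : ℝ => S t * (t:ℂ) ^ (-(s+1))) (Set.Ioi 1) := by
          have : MeasureTheory.IntegrableOn (fun t : ℝ => (t:ℂ) ^ (-(s+1))) (Set.Ioi 1) :=
            integrableOn_Ioi_cpow_of_lt (by simp; linarith) one_pos
          exact this.bdd_mul hSm.aestronglyMeasurable (Filter.Eventually.of_forall hSb)
        rw [MeasureTheory.setIntegral_congr_fun measurableSet_Ioi e, MeasureTheory.integral_sub i1 i2,
          integral_Ioi_cpow_of_lt (by simpa using hs) one_pos]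
        have h1s : -s + 1 ≠ 0 := by intro h; apply hs1'; linear_combination -h
        simp only [ofReal_one, one_cpow]
        field_simp
        ring
      · apply Asymptotics.IsBigO.of_bound 1
        filter_upwards with n
        simp) s hs
  rw [hid]
  refine (norm_sub_le _ _).trans ?_
  rw [norm_mul, norm_mul]
  have := mel_bound S 1 hSb s hs
  calc _ ≤ ‖s‖ + ‖s‖ * ‖s-1‖ * (1 / s.re) := by gcongr
    _ = _ := by ring


lemma exists_analytic_log (U : Set ℂ) (hU : IsOpen U) (hc : Convex ℝ U) (hne : U.Nonempty) (f : ℂ → ℂ)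
    (hf : DifferentiableOn ℂ f U) (h0 : ∀ z ∈ U, f z ≠ 0) :
    ∃ g : ℂ → ℂ, DifferentiableOn ℂ g U ∧ ∀ z ∈ U, Complex.exp (g z) = f z := by
  have hsc : IsSimplyConnected U := by
    have := hc.contractibleSpace hne
    unfold IsSimplyConnected
    infer_instance
  obtain ⟨g, hgc, hge⟩ := Complex.exists_continuousOn_eqOn_exp_comp hsc hU hf.continuousOn
    (by rintro ⟨z, hz, h⟩; exact h0 z hz h)
  have hexp : ∀ z ∈ U, Complex.exp (g z) = f z := fun z hz => hge hz
  refine ⟨g, ?_, hexp⟩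
  intro z₀ hz₀
  have hUn : U ∈ nhds z₀ := hU.mem_nhds hz₀
  have hgz : ContinuousAt g z₀ := hgc.continuousAt hUn
  have hfd : DifferentiableAt ℂ f z₀ := hf.differentiableAt hUn
  have hd : DifferentiableAt ℂ (fun z => g z₀ + Complex.log (f z / f z₀)) z₀ := by
    apply DifferentiableAt.const_add
    apply DifferentiableAt.clog
    · exact hfd.div_const _
    · rw [div_self (h0 z₀ hz₀)]; exact one_mem_slitPlane
  refine (hd.congr_of_eventuallyEq ?_).differentiableWithinAt
  have : ∀ᶠ z in nhds z₀, dist (g z) (g z₀) < 1 := Metric.tendsto_nhds.1 hgz 1 one_pos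
  filter_upwards [this, hUn] with z hz hzU
  rw [← hexp z hzU, ← hexp z₀ hz₀, ← Complex.exp_sub, Complex.log_exp]
  · ring
  · have h1 := Complex.abs_im_le_norm (g z - g z₀)
    rw [dist_eq_norm] at hz
    have := abs_le.1 h1
    linarith [Real.pi_gt_three]
  · have h1 := Complex.abs_im_le_norm (g z - g z₀)
    rw [dist_eq_norm] at hz
    have := abs_le.1 h1
    linarith [Real.pi_gt_three]

lemma bc_centered (z₀ : ℂ) (R M : ℝ) (hR : 0 < R) (hM : 0 < M) (g : ℂ → ℂ)
    (hg : DifferentiableOn ℂ g (Metric.ball z₀ R)) (hb : ∀ z ∈ Metric.ball z₀ R, (g z - g z₀).re ≤ M)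
    (z : ℂ) (hz : z ∈ Metric.ball z₀ R) : ‖g z - g z₀‖ ≤ 2 * M * ‖z - z₀‖ / (R - ‖z - z₀‖) := by
  have hmaps : ∀ w ∈ Metric.ball (0:ℂ) R, w + z₀ ∈ Metric.ball z₀ R := by
    intro w hw; simpa using hw
  have := Complex.borelCaratheodory_zero (f := fun w => g (w + z₀) - g z₀) (M := M) (R := R) (z := z - z₀) hM
    ?_ ?_ hR ?_ ?_
  · simpa using this
  · apply DifferentiableOn.sub_const
    exact hg.comp (by fun_prop) hmaps
  · intro w hw; exact hb _ (hmaps w hw)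
  · simpa [dist_eq_norm] using hz
  · simp

lemma bc_log (z₀ : ℂ) (R M : ℝ) (hR : 0 < R) (hM : 1 < M) (f : ℂ → ℂ)
    (hf : DifferentiableOn ℂ f (Metric.ball z₀ R)) (h0 : ∀ z ∈ Metric.ball z₀ R, f z ≠ 0)
    (hb : ∀ z ∈ Metric.ball z₀ R, ‖f z‖ ≤ M * ‖f z₀‖) :
    ∃ g : ℂ → ℂ, DifferentiableOn ℂ g (Metric.ball z₀ R) ∧ g z₀ = 0 ∧
      (∀ z ∈ Metric.ball z₀ R, f z = f z₀ * Complex.exp (g z)) ∧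
      ∀ z ∈ Metric.ball z₀ R, ‖g z‖ ≤ 2 * Real.log M * ‖z - z₀‖ / (R - ‖z - z₀‖) := by
  obtain ⟨g, hg, he⟩ := exists_analytic_log _ Metric.isOpen_ball (convex_ball z₀ R) ⟨z₀, by simpa⟩ f hf h0
  have hz₀ : z₀ ∈ Metric.ball z₀ R := by simpa
  refine ⟨fun z => g z - g z₀, hg.sub_const _, by simp, ?_, ?_⟩
  · intro z hz
    rw [Complex.exp_sub, he z hz, he z₀ hz₀]
    field_simp [h0 z₀ hz₀]
  · intro z hz
    refine bc_centered z₀ R _ hR (Real.log_pos hM) g hg ?_ z hz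
    intro w hw
    have h1 := hb w hw
    rw [← he w hw, ← he z₀ hz₀, Complex.norm_exp, Complex.norm_exp, ← Real.exp_log (by linarith : 0 < M),
      ← Real.exp_add, Real.exp_le_exp] at h1
    simp; linarith

/-- coefficients of `log L` -/
noncomputable def lcf {q : ℕ} (χ : DirichletCharacter ℂ q) (n : ℕ) : ℂ :=
  χ n * ArithmeticFunction.vonMangoldt n / Real.log n

lemma lcf_norm {q : ℕ} (χ : DirichletCharacter ℂ q) (n : ℕ) : ‖lcf χ n‖ ≤ 1 := by
  unfold lcf
  rw [norm_div, norm_mul, Complex.norm_real, Complex.norm_real, Real.norm_eq_abs, Real.norm_eq_abs,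
    abs_of_nonneg ArithmeticFunction.vonMangoldt_nonneg, abs_of_nonneg (Real.log_natCast_nonneg n)]
  apply div_le_one_of_le₀ _ (Real.log_natCast_nonneg n)
  calc _ ≤ 1 * Real.log n := by
        gcongr
        · exact χ.norm_le_one _
        · exact ArithmeticFunction.vonMangoldt_le_log
    _ = _ := one_mul _

lemma lcf_summable {q : ℕ} (χ : DirichletCharacter ℂ q) {s : ℂ} (hs : 1 < s.re) :
    LSeriesSummable (lcf χ) s :=
  LSeriesSummable_of_bounded_of_one_lt_re (m := 1) (fun n _ => lcf_norm χ n) hs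

lemma lcf_diff {q : ℕ} (χ : DirichletCharacter ℂ q) :
    DifferentiableOn ℂ (LSeries (lcf χ)) {s | 1 < s.re} := by
  refine (LSeries_differentiableOn (lcf χ)).mono ?_
  intro s hs
  have : LSeries.abscissaOfAbsConv (lcf χ) ≤ (1:ℝ) :=
    LSeries.abscissaOfAbsConv_le_of_forall_lt_LSeriesSummable (fun y hy => lcf_summable χ (by simpa using hy))
  exact this.trans_lt (by exact_mod_cast hs)

lemma bdd_LSeries_two (c : ℕ → ℂ) (hc : ∀ n, ‖c n‖ ≤ 1) {s : ℂ} (hs : 2 ≤ s.re) :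
    ‖LSeries c s‖ ≤ 2 := by
  have h2 := hasSum_zeta_two
  have hb : ∀ n, ‖LSeries.term c s n‖ ≤ 1 / (n:ℝ)^2 := by
    intro n
    rw [LSeries.norm_term_eq]
    split_ifs with h
    · simp
    · have h1 : (1:ℝ) ≤ n := by exact_mod_cast Nat.one_le_iff_ne_zero.2 h
      gcongr
      · exact hc n
      · rw [← Real.rpow_natCast]
        exact Real.rpow_le_rpow_of_exponent_le h1 (by simpa using hs)
  calc _ ≤ π^2/6 := tsum_of_norm_bounded h2 hb
    _ ≤ 2 := by nlinarith [Real.pi_lt_d2, Real.pi_pos]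

lemma LFun_ne_zero {q : ℕ} [NeZero q] (χ : DirichletCharacter ℂ q) (hχ : χ ≠ 1)
    (h : ∀ s : ℂ, 0 < s.re → s.re < 1 → DirichletCharacter.LFunction χ s = 0 → s.re = 1 / 2)
    {s : ℂ} (hs : 0 < s.re) (h0 : DirichletCharacter.LFunction χ s = 0) : s.re = 1 / 2 := by
  by_cases h1 : s.re < 1
  · exact h s hs h1 h0
  · exact absurd h0 (DirichletCharacter.LFunction_ne_zero_of_one_le_re χ (Or.inl hχ) (by linarith))

lemma exists_logL {q : ℕ} [NeZero q] (χ : DirichletCharacter ℂ q) (hχ : χ ≠ 1)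
    (h : ∀ s : ℂ, 0 < s.re → s.re < 1 → DirichletCharacter.LFunction χ s = 0 → s.re = 1 / 2) :
    ∃ F : ℂ → ℂ, DifferentiableOn ℂ F {s | 1/2 < s.re} ∧
      (∀ s : ℂ, 1/2 < s.re → Complex.exp (F s) = DirichletCharacter.LFunction χ s) ∧
      (∀ s : ℂ, 1 < s.re → F s = LSeries (lcf χ) s) := by
  obtain ⟨G, hG, hGe⟩ := exists_analytic_log {s | 1/2 < s.re} (half_open _) (convex_halfSpace_re_gt _)
    ⟨1, by norm_num⟩ (DirichletCharacter.LFunction χ)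
    (DirichletCharacter.differentiable_LFunction hχ).differentiableOn
    (fun z hz h0 => by
      have hz' : 1/2 < z.re := hz
      have := LFun_ne_zero χ hχ h (by linarith) h0
      linarith)
  have hexp : ∀ s : ℂ, 1 < s.re → Complex.exp (G s - LSeries (lcf χ) s) = 1 := by
    intro s hs
    have h1 : Complex.exp (LSeries (lcf χ) s) = _ := DirichletCharacter.LSeries_eq_exp_LSeries χ hs
    rw [Complex.exp_sub, hGe s (show 1/2 < s.re by linarith), h1, ← DirichletCharacter.LFunction_eq_LSeries χ hs]
    exact div_self (DirichletCharacter.LFunction_ne_zero_of_one_le_re χ (Or.inl hχ) (by linarith))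
  have hdiff : DifferentiableOn ℂ (fun s => G s - LSeries (lcf χ) s) {s | 1 < s.re} :=
    (hG.mono (fun s (hs : 1 < s.re) => (show 1/2 < s.re by linarith))).sub (lcf_diff χ)
  have hconst := (half_open 1).exists_is_const_of_deriv_eq_zero (half_preconn 1) hdiff (by
    intro s hs
    have hd := (hdiff.differentiableAt ((half_open 1).mem_nhds hs)).hasDerivAt.cexp
    have : HasDerivAt (fun s => Complex.exp (G s - LSeries (lcf χ) s)) 0 s := by
      refine (hasDerivAt_const s (1:ℂ)).congr_of_eventuallyEq ?_
      filter_upwards [(half_open 1).mem_nhds hs] with z hz using hexp z hz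
    have := hd.unique this
    rw [hexp s hs, one_mul] at this
    exact this)
  obtain ⟨a, ha⟩ := hconst
  have hea : Complex.exp a = 1 := by
    rw [← ha 2 (by simp)]; exact hexp 2 (by simp)
  refine ⟨fun s => G s - a, hG.sub_const _, ?_, ?_⟩
  · intro s hs
    rw [Complex.exp_sub, hea, div_one]; exact hGe s hs
  · intro s hs
    have := ha s hs
    linear_combination this

/-- growth of `log L` -/
lemma logL_bound {q : ℕ} [NeZero q] (hq : 1 < q) (χ : DirichletCharacter ℂ q) (hχ : χ ≠ 1) (F : ℂ → ℂ)
    (hF : DifferentiableOn ℂ F {s | 1/2 < s.re})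
    (hFe : ∀ s : ℂ, 1/2 < s.re → Complex.exp (F s) = DirichletCharacter.LFunction χ s)
    (hFL : ∀ s : ℂ, 1 < s.re → F s = LSeries (lcf χ) s) (δ : ℝ) (hδ : 0 < δ) (hδ1 : δ ≤ 1) (s : ℂ)
    (hs : 1/2 + δ ≤ s.re) : ‖F s‖ ≤ 50 * Real.log (q * (2 + |s.im|)) / δ := by
  have hq' : (2:ℝ) ≤ q := by exact_mod_cast hq
  have hl : 1 ≤ Real.log (q * (2 + |s.im|)) := by
    have h4 : (4:ℝ) ≤ q * (2 + |s.im|) := by nlinarith [abs_nonneg s.im]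
    rw [Real.le_log_iff_exp_le (by linarith)]
    linarith [Real.exp_one_lt_d9]
  by_cases h2 : 2 ≤ s.re
  · rw [hFL s (by linarith)]
    refine (bdd_LSeries_two _ (lcf_norm χ) h2).trans ?_
    rw [le_div_iff₀ hδ]; nlinarith
  push Not at h2
  set z₀ : ℂ := ⟨2, s.im⟩ with hz₀
  have hz₀r : z₀.re = 2 := rfl
  have hF0 : ‖F z₀‖ ≤ 2 := by
    rw [hFL z₀ (by simp [hz₀])]
    exact bdd_LSeries_two _ (lcf_norm χ) (by simp [hz₀])
  have hball : ∀ z ∈ Metric.ball z₀ (3/2), 1/2 < z.re := by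
    intro z hz
    rw [Metric.mem_ball, dist_eq_norm] at hz
    have := (abs_le.1 ((Complex.abs_re_le_norm (z - z₀)).trans hz.le)).1
    have h3 := Complex.abs_re_le_norm (z - z₀)
    have h4 : -‖z - z₀‖ ≤ (z-z₀).re := (abs_le.1 h3).1
    rw [Complex.sub_re, hz₀r] at h4; linarith
  have hnz : ‖z₀‖ ≤ 2 + |s.im| := by
    have := Complex.norm_le_abs_re_add_abs_im z₀
    simpa [hz₀] using this
  set ll := Real.log (q * (2 + |s.im|)) with hll
  have hP : (0:ℝ) < q * (2 + |s.im|) := by positivity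
  have hbc := bc_centered z₀ (3/2) (7 * ll) (by norm_num) (by linarith) F
    (hF.mono (fun z hz => hball z hz)) ?_ s ?_
  · have hd : ‖s - z₀‖ = 2 - s.re := by
      have : s - z₀ = ((s.re - 2 : ℝ) : ℂ) := by
        apply Complex.ext <;> simp [hz₀]
      rw [this, Complex.norm_real, Real.norm_eq_abs, abs_of_neg (by linarith)]; ring
    rw [hd] at hbc
    have h5 : 2 * (7 * ll) * (2 - s.re) / (3 / 2 - (2 - s.re)) ≤ 21 * ll / δ := by
      have : 0 < 3/2 - (2 - s.re) := by linarith
      rw [div_le_div_iff₀ this hδ]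
      nlinarith [mul_pos (by linarith : (0:ℝ) < ll) hδ]
    have h6 : ‖F s‖ ≤ ‖F s - F z₀‖ + ‖F z₀‖ := by
      simpa using norm_add_le (F s - F z₀) (F z₀)
    have h7 : 2 ≤ 2 * ll / δ := by rw [le_div_iff₀ hδ]; nlinarith
    have h8 : 50 * ll / δ = 21 * ll / δ + 2 * ll / δ + 27 * ll / δ := by ring
    have h9 : 0 ≤ 27 * ll / δ := by positivity
    linarith
  · intro z hz
    have hzr := hball z hz
    have h1 : ‖Complex.exp (F z)‖ ≤ 4 * (q * (2 + |s.im|)) := by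
      rw [hFe z hzr]
      refine (LFun_bound χ hχ z (by linarith)).trans ?_
      rw [Metric.mem_ball, dist_eq_norm] at hz
      have : ‖z‖ ≤ 2 * (2 + |s.im|) := by
        have := norm_add_le (z - z₀) z₀
        simp only [sub_add_cancel] at this
        linarith [abs_nonneg s.im]
      rw [div_le_iff₀ (by linarith)]
      calc (q:ℝ) * ‖z‖ ≤ q * (2 * (2 + |s.im|)) := by gcongr
        _ = 4 * (q * (2 + |s.im|)) * (1/2) := by ring
        _ ≤ _ := by gcongr
    rw [Complex.norm_exp, ← Real.exp_log (by positivity : 0 < 4 * (q * (2 + |s.im|))), Real.exp_le_exp,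
      Real.log_mul (by norm_num) hP.ne'] at h1
    have h4 : Real.log 4 ≤ 2 := by
      rw [show (4:ℝ) = 2^2 by norm_num, Real.log_pow]; push_cast; linarith [Real.log_two_lt_d9]
    have h5 := abs_le.1 ((Complex.abs_re_le_norm (F z₀)).trans hF0)
    rw [Complex.sub_re]; linarith
  · rw [Metric.mem_ball, dist_eq_norm]
    have : s - z₀ = ((s.re - 2 : ℝ) : ℂ) := by
      apply Complex.ext <;> simp [hz₀]
    rw [this, Complex.norm_real, Real.norm_eq_abs, abs_of_neg (by linarith)]; linarith


/-- un-normalised kernel -/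
noncomputable def kap0 (y : ℝ) : ℝ := Real.sinc (y / 6) ^ 6

lemma kap0_nonneg (y : ℝ) : 0 ≤ kap0 y := by unfold kap0; positivity
lemma kap0_neg (y : ℝ) : kap0 (-y) = kap0 y := by unfold kap0; rw [neg_div, Real.sinc_neg]
lemma kap0_cont : Continuous kap0 := by
  unfold kap0; exact (Real.continuous_sinc.comp (by fun_prop)).pow 6

lemma kap0_bound (y : ℝ) : kap0 y * ((1 + y^4) * (1 + y^2)) ≤ 4 * 6^6 := by
  have h1 : kap0 y ≤ 1 := by
    unfold kap0
    have := Real.abs_sinc_le_one (y/6)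
    calc _ = |Real.sinc (y/6)|^6 := by rw [Even.pow_abs (by decide)]
      _ ≤ 1^6 := by gcongr
      _ = 1 := by norm_num
  have h2 : kap0 y * y^6 ≤ 6^6 := by
    unfold kap0
    by_cases h : y = 0
    · simp [h]
    · rw [Real.sinc_of_ne_zero (by positivity), div_pow]
      have hs : Real.sin (y/6)^6 ≤ 1 := by
        calc _ = |Real.sin (y/6)|^6 := by rw [Even.pow_abs (by decide)]
          _ ≤ 1^6 := by gcongr; exact Real.abs_sin_le_one _
          _ = 1 := by norm_num
      have : Real.sin (y/6)^6 / (y/6)^6 * y^6 = Real.sin (y/6)^6 * 6^6 := by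
        field_simp
      rw [this]; nlinarith
  have h0 := kap0_nonneg y
  have h3 : (1 + y^4) * (1 + y^2) ≤ 3 + 3 * y^6 := by
    have : 0 ≤ (y^2-1)^2 * (y^2+1) := by positivity
    nlinarith [sq_nonneg (y^2-1), sq_nonneg y]
  calc _ ≤ kap0 y * (3 + 3 * y^6) := by gcongr
    _ = 3 * kap0 y + 3 * (kap0 y * y^6) := by ring
    _ ≤ _ := by nlinarith

lemma kap0_integrable {E : Type*} [NormedAddCommGroup E] [NormedSpace ℝ E] (p : ℝ → E) (C : ℝ)
    (hp : MeasureTheory.AEStronglyMeasurable p MeasureTheory.volume)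
    (hb : ∀ y, ‖p y‖ ≤ C * (1 + y^4)) : MeasureTheory.Integrable (fun y => kap0 y • p y) := by
  refine MeasureTheory.Integrable.mono' (integrable_inv_one_add_sq.const_mul (C * (4 * 6^6))) ?_ ?_
  · exact kap0_cont.aestronglyMeasurable.smul hp
  · refine Filter.Eventually.of_forall fun y => ?_
    rw [norm_smul, Real.norm_eq_abs, abs_of_nonneg (kap0_nonneg y)]
    have hC : 0 ≤ C := by
      have := (norm_nonneg _).trans (hb 0); simpa using this
    rw [← div_eq_mul_inv, le_div_iff₀ (by positivity)]
    calc kap0 y * ‖p y‖ * (1+y^2) ≤ kap0 y * (C * (1+y^4)) * (1+y^2) := by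
          gcongr
          · exact kap0_nonneg y
          · exact hb y
      _ = C * (kap0 y * ((1 + y^4) * (1 + y^2))) := by ring
      _ ≤ _ := mul_le_mul_of_nonneg_left (kap0_bound y) hC

noncomputable def kapc : ℝ := ∫ y, kap0 y

lemma kapc_pos : 0 < kapc := by
  unfold kapc
  rw [MeasureTheory.integral_pos_iff_support_of_nonneg kap0_nonneg]
  · exact kap0_cont.isOpen_support.measure_pos MeasureTheory.volume ⟨0, by simp [kap0]⟩
  · have := kap0_integrable (fun _ => (1:ℝ)) 1 (by fun_prop) (by intro y; simp; positivity)
    simpa using this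

/-- the normalised kernel -/
noncomputable def kap (y : ℝ) : ℝ := kap0 y / kapc

lemma kap_nonneg (y : ℝ) : 0 ≤ kap y := div_nonneg (kap0_nonneg y) kapc_pos.le
lemma kap_neg (y : ℝ) : kap (-y) = kap y := by unfold kap; rw [kap0_neg]
lemma kap_cont : Continuous kap := kap0_cont.div_const _

lemma kap_integral : ∫ y, kap y = 1 := by
  unfold kap
  rw [MeasureTheory.integral_div]
  exact div_self kapc_pos.ne'

lemma kap_integrable {E : Type*} [NormedAddCommGroup E] [NormedSpace ℝ E] (p : ℝ → E) (C : ℝ)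
    (hp : MeasureTheory.AEStronglyMeasurable p MeasureTheory.volume)
    (hb : ∀ y, ‖p y‖ ≤ C * (1 + y^4)) : MeasureTheory.Integrable (fun y => kap y • p y) := by
  have := (kap0_integrable p C hp hb).smul (kapc⁻¹)
  refine this.congr (Filter.Eventually.of_forall fun y => ?_)
  simp [kap, smul_smul, div_eq_inv_mul]

lemma kap_integrable' (p : ℝ → ℝ) (C : ℝ) (hp : Continuous p)
    (hb : ∀ y, |p y| ≤ C * (1 + y^4)) : MeasureTheory.Integrable (fun y => kap y * p y) :=
  kap_integrable p C hp.aestronglyMeasurable hb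

/-- fourth moment bound -/
noncomputable def kapm : ℝ := ∫ y, kap y * (1 + y^4)

lemma kapm_int : MeasureTheory.Integrable (fun y => kap y * (1 + y^4)) :=
  kap_integrable' _ 1 (by fun_prop) (by intro y; rw [abs_of_nonneg (by positivity)]; simp)

lemma kap_int : MeasureTheory.Integrable kap := by
  have := kap_integrable' (fun _ => 1) 1 (by fun_prop) (by intro y; simp; positivity)
  simpa using this

lemma kapm_ge : 1 ≤ kapm := by
  rw [← kap_integral]
  apply MeasureTheory.integral_mono kap_int kapm_int
  intro y
  have := kap_nonneg y
  have h4 : 0 ≤ y^4 := by positivity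
  simp only; nlinarith

/-- complex extension -/
noncomputable def Dc (w : ℂ) : ℂ := dslope Complex.sinh 0 w

lemma Dc_diff : Differentiable ℂ Dc := by
  have := (Complex.differentiableOn_dslope (f := Complex.sinh) (s := Set.univ) (c := 0) Filter.univ_mem).2
    Complex.differentiable_sinh.differentiableOn
  exact differentiableOn_univ.1 this

lemma Dc_ne {w : ℂ} (h : w ≠ 0) : Dc w = Complex.sinh w / w := by
  unfold Dc; rw [dslope_of_ne _ h, slope_def_field]; simp

lemma Dc_imag (y : ℝ) : Dc (y * I) = (Real.sinc y : ℂ) := by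
  by_cases h : y = 0
  · subst h; simp [Dc]
  · have h' : (y:ℂ) ≠ 0 := by exact_mod_cast h
    rw [Dc_ne (by simp [h]), Complex.sinh_mul_I, Real.sinc_of_ne_zero h]
    push_cast
    field_simp

lemma Dc_bound (w : ℂ) (h : w ≠ 0) (hr : 0 ≤ w.re) : ‖Dc w‖ ≤ Real.exp w.re / ‖w‖ := by
  rw [Dc_ne h, norm_div]
  gcongr
  rw [Complex.sinh]
  rw [norm_div]
  have h1 := norm_sub_le (Complex.exp w) (Complex.exp (-w))
  rw [Complex.norm_exp, Complex.norm_exp] at h1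
  have h2 : Real.exp ((-w).re) ≤ Real.exp w.re := by
    rw [Real.exp_le_exp]; simp; linarith
  simp only [Complex.norm_ofNat]
  linarith

lemma contour_zero (R : ℂ → ℂ) (C : ℝ) (hR : ∀ w : ℂ, 0 ≤ w.re → DifferentiableAt ℂ R w)
    (hb : ∀ w : ℂ, 0 ≤ w.re → ‖R w‖ ≤ C * (1 + ‖w‖) * Real.exp (-w.re)) :
    ∫ y : ℝ, kap y • R (y * I) = 0 := by
  have hC : 0 ≤ C := by
    have := (norm_nonneg _).trans (hb 0 (by simp)); simpa using this
  set f : ℂ → ℂ := fun w => Dc (w/6) ^ 6 * R w with hf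
  have hfd : ∀ w : ℂ, 0 ≤ w.re → DifferentiableAt ℂ f w := by
    intro w hw
    have h1 : DifferentiableAt ℂ (fun w : ℂ => Dc (w/6)) w :=
      Dc_diff.differentiableAt.comp w (by fun_prop)
    exact (h1.pow 6).mul (hR w hw)
  have hfb : ∀ w : ℂ, 0 ≤ w.re → ∀ T : ℝ, 1 ≤ T → T ≤ ‖w‖ → ‖f w‖ ≤ 2 * 6^6 * C / T^5 := by
    intro w hw T hT hTw
    have hw0 : w ≠ 0 := by rw [← norm_pos_iff]; linarith
    have h6 : (w/6).re = w.re/6 := by simp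
    have h1 := Dc_bound (w/6) (by simpa using hw0) (by rw [h6]; linarith)
    have hn : ‖w/6‖ = ‖w‖/6 := by simp
    rw [h6, hn] at h1
    have hp : 0 < ‖w‖ := by linarith
    have e6 : Real.exp (w.re/6)^6 = Real.exp w.re := by
      rw [← Real.exp_nat_mul]; congr 1; push_cast; ring
    rw [hf]; simp only [norm_mul, norm_pow]
    calc _ ≤ (Real.exp (w.re/6) / (‖w‖/6))^6 * (C * (1 + ‖w‖) * Real.exp (-w.re)) := by
          gcongr; exact hb w hw
      _ = 6^6 * C * (1 + ‖w‖) / ‖w‖^6 * (Real.exp w.re * Real.exp (-w.re)) := by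
          rw [div_pow, e6]; field_simp
      _ = 6^6 * C * (1 + ‖w‖) / ‖w‖^6 := by rw [← Real.exp_add]; simp
      _ ≤ 6^6 * C * (2 * ‖w‖) / ‖w‖^6 := by gcongr; linarith
      _ = 2 * 6^6 * C / ‖w‖^5 := by field_simp
      _ ≤ _ := by gcongr
  have hrect : ∀ T : ℝ, 1 ≤ T → ‖∫ y in (-T)..T, f (y * I)‖ ≤ 16 * 6^6 * C / T^4 := by
    intro T hT
    have hT0 : 0 ≤ T := by linarith
    have h := Complex.integral_boundary_rect_eq_zero_of_differentiableOn f ⟨0, -T⟩ ⟨T, T⟩ (by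
      intro w hw
      have : w.re ∈ Set.uIcc 0 T := hw.1
      rw [Set.uIcc_of_le hT0] at this
      exact (hfd w this.1).differentiableWithinAt)
    simp only [Complex.ofReal_zero, zero_add] at h
    set B := 2 * 6^6 * C / T^5 with hB
    have b1 : ‖∫ x in (0:ℝ)..T, f (x + (-T : ℝ) * I)‖ ≤ B * |T - 0| := by
      apply intervalIntegral.norm_integral_le_of_norm_le_const
      intro x hx
      rw [Set.uIoc_of_le hT0] at hx
      refine hfb _ (by simpa using hx.1.le) T hT ?_
      have := Complex.abs_im_le_norm (x + (-T : ℝ) * I)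
      simpa [abs_of_nonneg hT0] using this
    have b2 : ‖∫ x in (0:ℝ)..T, f (x + (T : ℝ) * I)‖ ≤ B * |T - 0| := by
      apply intervalIntegral.norm_integral_le_of_norm_le_const
      intro x hx
      rw [Set.uIoc_of_le hT0] at hx
      refine hfb _ (by simpa using hx.1.le) T hT ?_
      have := Complex.abs_im_le_norm (x + (T : ℝ) * I)
      simpa [abs_of_nonneg hT0] using this
    have b3 : ‖∫ y in (-T)..T, f (T + (y : ℝ) * I)‖ ≤ B * |T - -T| := by
      apply intervalIntegral.norm_integral_le_of_norm_le_const
      intro x hx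
      refine hfb _ (by simpa using hT0) T hT ?_
      have := Complex.abs_re_le_norm (T + (x : ℝ) * I)
      simpa [abs_of_nonneg hT0] using this
    have e : I • ∫ y in (-T)..T, f (y * I) = (∫ x in (0:ℝ)..T, f (x + (-T : ℝ) * I)) -
        (∫ x in (0:ℝ)..T, f (x + (T : ℝ) * I)) + I • ∫ y in (-T)..T, f (T + (y : ℝ) * I) := by
      linear_combination -h
    have hn : ‖∫ y in (-T)..T, f (y * I)‖ = ‖I • ∫ y in (-T)..T, f (y * I)‖ := by
      rw [norm_smul]; simp
    rw [hn, e]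
    refine (norm_add_le _ _).trans ?_
    rw [norm_smul, Complex.norm_I, one_mul]
    have := norm_sub_le (∫ x in (0:ℝ)..T, f (x + (-T : ℝ) * I)) (∫ x in (0:ℝ)..T, f (x + (T : ℝ) * I))
    rw [sub_zero, abs_of_nonneg hT0] at b1 b2
    rw [show T - -T = 2 * T by ring, abs_of_nonneg (by linarith)] at b3
    have hBT : B * T = 2 * 6^6 * C / T^4 := by
      rw [hB]; field_simp
    have : 16 * 6^6 * C / T^4 = 8 * (B * T) := by rw [hBT]; ring
    have hp : 0 ≤ B * T := by rw [hBT]; positivity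
    linarith
  have hfi : ∀ y : ℝ, f (y * I) = kap0 y • R (y * I) := by
    intro y
    have : (y:ℂ) * I / 6 = ((y/6 : ℝ) : ℂ) * I := by push_cast; ring
    simp only [hf, this, Dc_imag, kap0, Complex.real_smul]
    push_cast; rfl
  have hInt : MeasureTheory.Integrable (fun y : ℝ => f (y * I)) := by
    simp_rw [hfi]
    refine kap0_integrable _ (2 * C) ?_ ?_
    · apply Continuous.aestronglyMeasurable
      rw [continuous_iff_continuousAt]
      intro y
      exact ((hR (y * I) (by simp)).continuousAt).comp (f := fun y : ℝ => (y:ℂ) * I) (by fun_prop)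
    · intro y
      have := hb (y * I) (by simp)
      simp at this
      refine this.trans ?_
      have : |y| ≤ 1 + y^4 := by
        have h4 : y^4 = |y|^4 := by rw [Even.pow_abs (by decide)]
        rw [h4]
        have := abs_nonneg y
        nlinarith [sq_nonneg (|y|^2-1), sq_nonneg (|y|-1)]
      have h4 : 0 ≤ y^4 := by positivity
      nlinarith
  have hlim := MeasureTheory.intervalIntegral_tendsto_integral hInt
    (Filter.tendsto_neg_atTop_atBot) (Filter.tendsto_id (α := ℝ))
  have hz : Filter.Tendsto (fun T : ℝ => ∫ y in (-T)..T, f (y * I)) Filter.atTop (nhds 0) := by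
    rw [tendsto_zero_iff_norm_tendsto_zero]
    refine squeeze_zero' (Filter.Eventually.of_forall fun _ => norm_nonneg _)
      ((Filter.eventually_ge_atTop 1).mono hrect) ?_
    exact Filter.Tendsto.const_div_atTop (Filter.tendsto_pow_atTop (by norm_num)) _
  have h0 := tendsto_nhds_unique hlim hz
  have : ∀ y : ℝ, kap y • R (y * I) = kapc⁻¹ • f (y * I) := by
    intro y; rw [hfi, smul_smul, kap]; congr 1; ring
  simp_rw [this]
  rw [MeasureTheory.integral_smul, h0, smul_zero]


/-- the weights -/
noncomputable def wx (L : ℝ) (n : ℕ) : ℂ := ∫ y : ℝ, kap y • (n:ℂ) ^ (-(((y / L : ℝ) : ℂ) * I))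

lemma wx_norm (L : ℝ) (n : ℕ) (hn : n ≠ 0) : ‖wx L n‖ ≤ 1 := by
  unfold wx
  rw [← kap_integral]
  apply MeasureTheory.norm_integral_le_of_norm_le kap_int
  refine Filter.Eventually.of_forall fun y => ?_
  rw [norm_smul, Real.norm_eq_abs, abs_of_nonneg (kap_nonneg y), Complex.norm_natCast_cpow_of_pos (Nat.pos_of_ne_zero hn)]
  simp

lemma tail_bound (c : ℕ → ℂ) (hc : ∀ n, ‖c n‖ ≤ 1) (x : ℝ) (hx : 1 < x) (s : ℂ) (hs : 2 ≤ s.re) :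
    ‖LSeries c s - ∑ n ∈ Finset.range (⌊x⌋₊ + 1), LSeries.term c s n‖ ≤ 2 * x ^ (2 - s.re) := by
  have hsum : Summable (LSeries.term c s) :=
    LSeriesSummable_of_bounded_of_one_lt_re (m := 1) (fun n _ => hc n) (by linarith)
  have h1 := hsum.sum_add_tsum_compl (s := Finset.range (⌊x⌋₊ + 1))
  unfold LSeries
  rw [← h1, add_sub_cancel_left, _root_.tsum_subtype]
  have hx0 : 0 < x := by linarith
  have h2 := hasSum_zeta_two.mul_left (x ^ (2 - s.re))
  refine (tsum_of_norm_bounded h2 ?_).trans ?_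
  · intro n
    by_cases hn : n ∈ (↑(Finset.range (⌊x⌋₊ + 1)) : Set ℕ)ᶜ
    · rw [Set.indicator_of_mem hn]
      have hn' : ⌊x⌋₊ < n := by simpa [Nat.lt_succ_iff] using hn
      have hxn : x < n := (Nat.floor_lt hx0.le).1 hn'
      have hn0 : n ≠ 0 := by omega
      have hnp : (0:ℝ) < n := by linarith
      rw [LSeries.norm_term_eq, if_neg hn0]
      have e : (n:ℝ)^s.re = n^2 * (n:ℝ)^(s.re-2) := by
        rw [← Real.rpow_natCast, ← Real.rpow_add hnp]; congr 1; push_cast; ring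
      rw [e]
      have h3 : x ^ (s.re - 2) ≤ (n:ℝ)^(s.re-2) := Real.rpow_le_rpow hx0.le hxn.le (by linarith)
      have h4 : x ^ (2 - s.re) = 1 / x ^ (s.re - 2) := by
        rw [show 2 - s.re = -(s.re - 2) by ring, Real.rpow_neg hx0.le, one_div]
      have h5 : 0 < x ^ (s.re - 2) := by positivity
      rw [h4]
      calc ‖c n‖ / (n^2 * (n:ℝ)^(s.re-2)) ≤ 1 / (n^2 * x ^(s.re-2)) := by
            gcongr; exact hc n
        _ = _ := by field_simp
    · rw [Set.indicator_of_notMem hn, norm_zero]; positivity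
  · rw [mul_comm]
    have : π^2/6 ≤ 2 := by nlinarith [Real.pi_lt_d2, Real.pi_pos]
    gcongr

lemma kernel_formula (c : ℕ → ℂ) (hc : ∀ n, ‖c n‖ ≤ 1) (F : ℂ → ℂ) (s₀ : ℂ) (hs₀ : 1/2 < s₀.re)
    (hF : ∀ s : ℂ, s₀.re ≤ s.re → DifferentiableAt ℂ F s) (hFL : ∀ s : ℂ, 1 < s.re → F s = LSeries c s)
    (B : ℝ) (hFB : ∀ s : ℂ, s₀.re ≤ s.re → ‖F s‖ ≤ B * (1 + ‖s‖)) (x : ℝ) (hx : 1 < x) :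
    ∫ y : ℝ, kap y • F (s₀ + ((y / Real.log x : ℝ) : ℂ) * I) =
      ∑ n ∈ Finset.range (⌊x⌋₊ + 1), LSeries.term c s₀ n * wx (Real.log x) n := by
  set L := Real.log x with hL
  have hLp : 0 < L := Real.log_pos hx
  have hx0 : 0 < x := by linarith
  have hB : 0 ≤ B := by
    have := (norm_nonneg _).trans (hFB s₀ le_rfl)
    by_contra h
    push Not at h
    nlinarith [norm_nonneg s₀]
  set P : ℂ → ℂ := fun s => ∑ n ∈ Finset.range (⌊x⌋₊ + 1), LSeries.term c s n with hP
  set R : ℂ → ℂ := fun w => F (s₀ + w / L) - P (s₀ + w / L) with hR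
  have hre : ∀ w : ℂ, (s₀ + w / L).re = s₀.re + w.re / L := by
    intro w; simp [Complex.div_ofReal_re]
  have hPb : ∀ s : ℂ, 0 ≤ s.re → ‖P s‖ ≤ ⌊x⌋₊ + 1 := by
    intro s hs
    refine (norm_sum_le _ _).trans ?_
    calc _ ≤ ∑ n ∈ Finset.range (⌊x⌋₊ + 1), (1:ℝ) := by
          apply Finset.sum_le_sum
          intro n _
          rw [LSeries.norm_term_eq]
          split_ifs with h
          · simp
          · have h1 : (1:ℝ) ≤ n := by exact_mod_cast Nat.one_le_iff_ne_zero.2 h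
            have := Real.one_le_rpow h1 hs
            exact (div_le_one₀ (by linarith)).2 ((hc n).trans this)
      _ = _ := by simp
  have hPd : Differentiable ℂ P := by
    apply Differentiable.fun_sum
    intro n _
    by_cases h : n = 0
    · subst h
      have : (fun s => LSeries.term c s 0) = fun _ => 0 := by ext s; simp
      rw [this]; fun_prop
    · have : (fun s => LSeries.term c s n) = fun s => c n / (n:ℂ)^s := by
        ext s; rw [LSeries.term_of_ne_zero h]
      rw [this]
      have hn : (n:ℂ) ≠ 0 := by exact_mod_cast h
      intro s
      exact DifferentiableAt.fun_div (by fun_prop) (DifferentiableAt.const_cpow (by fun_prop) (Or.inl hn))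
        (by simp [Complex.cpow_eq_zero_iff, hn])
  have hcz := contour_zero R ((B * (1 + ‖s₀‖ + 1/L) + (⌊x⌋₊ + 1) + 2) * x ^ (2:ℝ)) ?_ ?_
  · have e : ∀ y : ℝ, kap y • R (y * I) = kap y • F (s₀ + ((y / L : ℝ) : ℂ) * I) -
        kap y • P (s₀ + ((y / L : ℝ) : ℂ) * I) := by
      intro y
      rw [← smul_sub, hR]
      have : s₀ + (y:ℂ) * I / L = s₀ + ((y / L : ℝ) : ℂ) * I := by push_cast; ring
      simp only [this]
    simp_rw [e] at hcz
    have hcontF : Continuous (fun y : ℝ => F (s₀ + ((y / L : ℝ) : ℂ) * I)) := by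
      rw [continuous_iff_continuousAt]
      intro y
      exact ((hF (s₀ + ((y / L : ℝ) : ℂ) * I) (by simp)).continuousAt).comp
        (f := fun y : ℝ => s₀ + ((y / L : ℝ) : ℂ) * I) (by fun_prop)
    have habs : ∀ y : ℝ, |y| ≤ 1 + y^4 := by
      intro y
      have h4 : y^4 = |y|^4 := by rw [Even.pow_abs (by decide)]
      rw [h4]
      have := abs_nonneg y
      nlinarith [sq_nonneg (|y|^2-1), sq_nonneg (|y|-1)]
    have iF : MeasureTheory.Integrable (fun y : ℝ => kap y • F (s₀ + ((y / L : ℝ) : ℂ) * I)) := by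
      refine kap_integrable _ (B * (1 + ‖s₀‖ + 1/L)) hcontF.aestronglyMeasurable ?_
      intro y
      refine (hFB _ (by simp)).trans ?_
      rw [mul_assoc]
      apply mul_le_mul_of_nonneg_left _ hB
      have h1 := norm_add_le s₀ (((y / L : ℝ) : ℂ) * I)
      rw [norm_mul, Complex.norm_I, mul_one, Complex.norm_real, Real.norm_eq_abs, abs_div, abs_of_pos hLp] at h1
      have h2 : |y| / L ≤ (1 + y^4) / L := by gcongr; exact habs y
      have h4 : 0 ≤ y^4 := by positivity
      have : (1 + ‖s₀‖ + 1/L) * (1 + y^4) = (1 + ‖s₀‖) * (1 + y^4) + (1 + y^4)/L := by ring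
      nlinarith [norm_nonneg s₀]
    have it : ∀ n, MeasureTheory.Integrable (fun y : ℝ => kap y • LSeries.term c (s₀ + ((y / L : ℝ) : ℂ) * I) n) ∧
        ∫ y : ℝ, kap y • LSeries.term c (s₀ + ((y / L : ℝ) : ℂ) * I) n = LSeries.term c s₀ n * wx L n := by
      intro n
      by_cases h : n = 0
      · subst h; simp
      · have hn : (n:ℂ) ≠ 0 := by exact_mod_cast h
        have e2 : ∀ y : ℝ, kap y • LSeries.term c (s₀ + ((y / L : ℝ) : ℂ) * I) n =
            LSeries.term c s₀ n * (kap y • (n:ℂ) ^ (-(((y / L : ℝ) : ℂ) * I))) := by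
          intro y
          rw [LSeries.term_of_ne_zero h, LSeries.term_of_ne_zero h, Complex.cpow_add _ _ hn, Complex.cpow_neg,
            Complex.real_smul, Complex.real_smul]
          field_simp
        simp_rw [e2]
        constructor
        · apply MeasureTheory.Integrable.const_mul
          refine kap_integrable _ 1 ?_ ?_
          · apply Continuous.aestronglyMeasurable
            exact Continuous.const_cpow (by fun_prop) (Or.inl hn)
          · intro y
            rw [Complex.norm_natCast_cpow_of_pos (Nat.pos_of_ne_zero h)]
            simp; positivity
        · rw [MeasureTheory.integral_const_mul]; rfl
    have eP : ∀ y : ℝ, kap y • P (s₀ + ((y / L : ℝ) : ℂ) * I) =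
        ∑ n ∈ Finset.range (⌊x⌋₊ + 1), kap y • LSeries.term c (s₀ + ((y / L : ℝ) : ℂ) * I) n := by
      intro y; rw [hP]; simp only [Finset.smul_sum]
    simp_rw [eP] at hcz
    rw [MeasureTheory.integral_sub iF (MeasureTheory.integrable_finsetSum _ (fun n _ => (it n).1)), sub_eq_zero,
      MeasureTheory.integral_finsetSum _ (fun n _ => (it n).1)] at hcz
    rw [hcz]
    exact Finset.sum_congr rfl fun n _ => (it n).2
  · intro w hw
    have h1 : s₀.re ≤ (s₀ + w / L).re := by rw [hre]; have := div_nonneg hw hLp.le; linarith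
    have h2 : DifferentiableAt ℂ (fun w : ℂ => s₀ + w / L) w := by fun_prop
    exact ((hF _ h1).comp w h2).sub ((hPd _).comp w h2)
  · intro w hw
    have hu : 0 ≤ w.re / L := div_nonneg hw hLp.le
    have h1 : s₀.re ≤ (s₀ + w / L).re := by rw [hre]; linarith
    have hexp : Real.exp (-w.re) = x ^ (-(w.re / L)) := by
      rw [Real.rpow_def_of_pos hx0, ← hL]; congr 1; field_simp
    rw [hexp]
    set u := w.re / L with hu'
    set D := B * (1 + ‖s₀‖ + 1/L) with hD
    have hD0 : 0 ≤ D := by positivity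
    have hw1 : 1 ≤ 1 + ‖w‖ := by linarith [norm_nonneg w]
    by_cases hc2 : u ≤ 3/2
    · have hx2 : 1 ≤ x ^ (2:ℝ) * x ^ (-u) := by
        rw [← Real.rpow_add hx0]; exact Real.one_le_rpow hx.le (by linarith)
      have hn : ‖s₀ + w / L‖ ≤ ‖s₀‖ + ‖w‖/L := by
        refine (norm_add_le _ _).trans ?_
        rw [norm_div, Complex.norm_real, Real.norm_eq_abs, abs_of_pos hLp]
      have hb1 : ‖R w‖ ≤ (D + (⌊x⌋₊ + 1)) * (1 + ‖w‖) := by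
        rw [hR]
        refine (norm_sub_le _ _).trans ?_
        have a1 := hFB _ h1
        have a2 := hPb (s₀ + w/L) (by linarith)
        have a3 : B * (1 + ‖s₀ + w / L‖) ≤ D * (1 + ‖w‖) := by
          rw [hD, mul_assoc]
          apply mul_le_mul_of_nonneg_left _ hB
          have : ‖w‖/L = (1/L)*‖w‖ := by ring
          have h6 : 0 ≤ 1/L := by positivity
          nlinarith [norm_nonneg s₀, norm_nonneg w, mul_nonneg (norm_nonneg s₀) (norm_nonneg w)]
        have a4 : ((⌊x⌋₊:ℝ) + 1) * 1 ≤ (⌊x⌋₊ + 1) * (1 + ‖w‖) := by gcongr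
        rw [add_mul]; linarith
      have hE : 0 ≤ (D + (⌊x⌋₊ + 1)) * (1 + ‖w‖) := by positivity
      calc _ ≤ (D + (⌊x⌋₊ + 1)) * (1 + ‖w‖) * 1 := by rw [mul_one]; exact hb1
        _ ≤ (D + (⌊x⌋₊ + 1) + 2) * (1 + ‖w‖) * (x ^ (2:ℝ) * x ^ (-u)) := by
          have : D + ((⌊x⌋₊:ℝ) + 1) ≤ D + (⌊x⌋₊ + 1) + 2 := by linarith
          gcongr
        _ = _ := by ring
    · push Not at hc2
      have h3 : 2 ≤ (s₀ + w / L).re := by rw [hre, ← hu']; linarith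
      have h4 := tail_bound c hc x hx _ h3
      rw [← hFL _ (by linarith)] at h4
      refine h4.trans ?_
      have h5 : x ^ (2 - (s₀ + w / L).re) ≤ x ^ (2:ℝ) * x ^ (-u) := by
        rw [← Real.rpow_add hx0]
        apply Real.rpow_le_rpow_of_exponent_le hx.le
        rw [hre]; linarith
      calc _ ≤ 2 * (x ^ (2:ℝ) * x ^ (-u)) * 1 := by rw [mul_one]; gcongr
        _ ≤ (D + (⌊x⌋₊ + 1) + 2) * (x ^ (2:ℝ) * x ^ (-u)) * (1 + ‖w‖) := by
          gcongr
          have : (0:ℝ) ≤ ⌊x⌋₊ := by positivity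
          linarith
        _ = _ := by ring


lemma pair_ineq (l v y : ℝ) (hl : 1 ≤ l) :
    2 * Real.log (l^2 + v^2) - 16 * (1 + y^4) / (l^2 + v^2) ≤
      Real.log (l^2 + (y - v)^2) + Real.log (l^2 + (y + v)^2) := by
  set D := l^2 + v^2 with hD
  have hl2 : 1 ≤ l^2 := by nlinarith
  have hDp : 0 < D := by positivity
  have p1 : 0 < l^2 + (y-v)^2 := by positivity
  have p2 : 0 < l^2 + (y+v)^2 := by positivity
  rw [← Real.log_mul p1.ne' p2.ne']
  set P := (l^2 + (y-v)^2) * (l^2 + (y+v)^2) with hP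
  have hPp : 0 < P := by positivity
  have e1 : P = (D - y^2)^2 + 4 * y^2 * l^2 := by rw [hP, hD]; ring
  have hcl : D^2 ≤ 4 * (1 + y^2) * P := by
    by_cases h : y^2 ≤ D/2
    · have : D^2/4 ≤ P := by rw [e1]; nlinarith [sq_nonneg y]
      nlinarith [sq_nonneg y]
    · push Not at h
      have : 4 * y^2 ≤ P := by rw [e1]; nlinarith [sq_nonneg (D - y^2), sq_nonneg y]
      nlinarith [sq_nonneg y]
  have hlog : 1 - (P / D^2)⁻¹ ≤ Real.log (P / D^2) := Real.one_sub_inv_le_log_of_pos (by positivity)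
  rw [Real.log_div hPp.ne' (by positivity), Real.log_pow, inv_div] at hlog
  have h2 : D^2 / P ≤ 1 + 16 * (1 + y^4) / D := by
    have hPD : D^2 ≤ P + 2 * D * y^2 := by rw [e1]; nlinarith [sq_nonneg y, sq_nonneg (y^2), mul_nonneg (sq_nonneg y) (sq_nonneg l)]
    have h3 : D^2/P ≤ 1 + 2 * D * y^2 / P := by
      rw [div_le_iff₀ hPp, add_mul, div_mul_cancel₀ _ hPp.ne', one_mul]; exact hPD
    have h4 : 2 * D * y^2 / P ≤ 16 * (1 + y^4) / D := by
      rw [div_le_div_iff₀ hPp hDp]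
      calc 2 * D * y^2 * D = 2 * y^2 * D^2 := by ring
        _ ≤ 2 * y^2 * (4 * (1 + y^2) * P) := by gcongr
        _ ≤ 16 * (1 + y^4) * P := by
          rw [show 2 * y^2 * (4 * (1 + y^2) * P) = (8 * y^2 * (1 + y^2)) * P by ring]
          apply mul_le_mul_of_nonneg_right _ hPp.le
          nlinarith [sq_nonneg (y^2-1)]
    linarith
  push_cast at hlog
  linarith

lemma kernel_ineq (l v : ℝ) (hl : 1 ≤ l) (hl2 : 8 * kapm ≤ l^2) (hv : v ≠ 0) :
    Real.log (v^2) ≤ ∫ y, kap y * Real.log (l^2 + (y - v)^2) := by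
  have hl2' : 1 ≤ l^2 := by nlinarith
  have hInt : ∀ v : ℝ, MeasureTheory.Integrable (fun y => kap y * Real.log (l^2 + (y - v)^2)) := by
    intro v
    refine kap_integrable' _ (l^2 + 4 + 2 * v^2) ?_ ?_
    · apply Continuous.log (by fun_prop)
      intro y; positivity
    · intro y
      rw [abs_of_nonneg (Real.log_nonneg (by nlinarith [sq_nonneg (y-v)]))]
      refine (Real.log_le_self (by positivity)).trans ?_
      have h4 : 0 ≤ y^4 := by positivity
      nlinarith [sq_nonneg (y+v), sq_nonneg (y^2-1), sq_nonneg v, mul_nonneg (sq_nonneg v) h4, mul_nonneg (sq_nonneg l) h4]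
  have hsymm : ∫ y, kap y * Real.log (l^2 + (y - v)^2) = ∫ y, kap y * Real.log (l^2 + (y + v)^2) := by
    rw [← MeasureTheory.integral_neg_eq_self]
    congr 1; ext y
    rw [kap_neg]; congr 3; ring
  have hint2 : MeasureTheory.Integrable (fun y => kap y * Real.log (l^2 + (y + v)^2)) := by
    simpa using hInt (-v)
  set D := l^2 + v^2 with hD
  have hDp : 0 < D := by positivity
  have h1 : ∫ y, (kap y * (2 * Real.log D) - (16 / D) * (kap y * (1 + y^4))) ≤
      ∫ y, (kap y * Real.log (l^2 + (y - v)^2) + kap y * Real.log (l^2 + (y + v)^2)) := by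
    apply MeasureTheory.integral_mono
    · exact (kap_int.mul_const _).sub (kapm_int.const_mul _)
    · exact (hInt v).add hint2
    · intro y
      have := mul_le_mul_of_nonneg_left (pair_ineq l v y hl) (kap_nonneg y)
      simp only
      calc _ = kap y * (2 * Real.log (l^2 + v^2) - 16 * (1 + y^4) / (l^2 + v^2)) := by rw [← hD]; ring
        _ ≤ _ := this
        _ = _ := by ring
  rw [MeasureTheory.integral_sub (kap_int.mul_const _) (kapm_int.const_mul _),
    MeasureTheory.integral_add (hInt v) hint2, ← hsymm, MeasureTheory.integral_mul_const,
    MeasureTheory.integral_const_mul, kap_integral] at h1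
  have hk : ∫ y, kap y * (1 + y^4) = kapm := rfl
  rw [hk] at h1
  have hv2 : 0 < v^2 := by positivity
  have h2 : Real.log (v^2) ≤ Real.log D - 8 * kapm / D := by
    have : Real.log (v^2/D) ≤ v^2/D - 1 := Real.log_le_sub_one_of_pos (by positivity)
    rw [Real.log_div hv2.ne' hDp.ne'] at this
    have h3 : v^2/D - 1 = -(l^2/D) := by rw [hD]; field_simp; ring
    have h4 : 8 * kapm / D ≤ l^2/D := by gcongr
    linarith
  have h5 : 16 / D * kapm = 2 * (8 * kapm / D) := by ring
  linarith

/-- the list of zeros is bounded -/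
lemma zero_count (f h : ℂ → ℂ) (z₁ : ℂ) (Λ : ℝ) (hf0 : f z₁ ≠ 0)
    (hb : ∀ z ∈ Metric.closedBall z₁ (9/20), ‖f z‖ ≤ Real.exp Λ * ‖f z₁‖) (l : Multiset ℂ)
    (hh : Differentiable ℂ h) (hfac : ∀ z, f z = (l.map (fun ρ => z - ρ)).prod * h z)
    (hl : ∀ ρ ∈ l, ‖ρ - z₁‖ ≤ 1/5) :
    (∀ z ∈ Metric.closedBall z₁ (9/20), ‖h z‖ ≤ Real.exp Λ * ‖f z₁‖ * 4 ^ (Multiset.card l)) ∧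
    ‖f z₁‖ ≤ (1/5) ^ (Multiset.card l) * ‖h z₁‖ ∧ (Multiset.card l : ℝ) ≤ 5 * Λ := by
  have hprod_low : ∀ l : Multiset ℂ, (∀ ρ ∈ l, ‖ρ - z₁‖ ≤ 1/5) → ∀ z ∈ Metric.sphere z₁ (9/20),
      (1/4:ℝ) ^ (Multiset.card l) ≤ ‖(l.map (fun ρ => z - ρ)).prod‖ := by
    intro l
    induction l using Multiset.induction_on with
    | empty => intro _ z _; simp
    | cons ρ l ih =>
      intro hl z hz
      simp only [Multiset.card_cons, Multiset.map_cons, Multiset.prod_cons, norm_mul, pow_succ']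
      have h1 := ih (fun ρ h => hl ρ (Multiset.mem_cons_of_mem h)) z hz
      have h2 : 1/4 ≤ ‖z - ρ‖ := by
        have h3 := hl ρ (Multiset.mem_cons_self _ _)
        rw [mem_sphere_iff_norm] at hz
        have := norm_sub_norm_le (z - z₁) (ρ - z₁)
        rw [show z - z₁ - (ρ - z₁) = z - ρ by ring] at this
        linarith
      gcongr
  have hprod_up : ∀ l : Multiset ℂ, (∀ ρ ∈ l, ‖ρ - z₁‖ ≤ 1/5) →
      ‖(l.map (fun ρ => z₁ - ρ)).prod‖ ≤ (1/5:ℝ) ^ (Multiset.card l) := by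
    intro l
    induction l using Multiset.induction_on with
    | empty => intro _; simp
    | cons ρ l ih =>
      intro hl
      simp only [Multiset.card_cons, Multiset.map_cons, Multiset.prod_cons, norm_mul, pow_succ']
      have h1 := ih (fun ρ h => hl ρ (Multiset.mem_cons_of_mem h))
      have h2 := hl ρ (Multiset.mem_cons_self _ _)
      rw [norm_sub_rev] at h2
      gcongr
  set n := Multiset.card l
  have hfp : 0 < ‖f z₁‖ := norm_pos_iff.2 hf0
  have A : ∀ z ∈ Metric.closedBall z₁ (9/20), ‖h z‖ ≤ Real.exp Λ * ‖f z₁‖ * 4 ^ n := by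
    intro z hz
    have hcl : closure (Metric.ball z₁ (9/20)) = Metric.closedBall z₁ (9/20) := closure_ball _ (by norm_num)
    refine Complex.norm_le_of_forall_mem_frontier_norm_le (U := Metric.ball z₁ (9/20)) Metric.isBounded_ball
      hh.diffContOnCl ?_ (by rw [hcl]; exact hz)
    intro w hw
    rw [frontier_ball _ (by norm_num)] at hw
    have h1 := hprod_low l hl w hw
    have h2 := hb w (Metric.sphere_subset_closedBall hw)
    rw [hfac w, norm_mul] at h2
    have h3 : (1/4:ℝ)^n * ‖h w‖ ≤ Real.exp Λ * ‖f z₁‖ := le_trans (by gcongr) h2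
    calc ‖h w‖ = (1/4:ℝ)^n * ‖h w‖ * 4^n := by
          rw [mul_right_comm, ← mul_pow]; norm_num
      _ ≤ _ := by gcongr
  have B : ‖f z₁‖ ≤ (1/5) ^ n * ‖h z₁‖ := by
    conv_lhs => rw [hfac z₁, norm_mul]
    gcongr
    exact hprod_up l hl
  refine ⟨A, B, ?_⟩
  have h1 := A z₁ (by simp; norm_num)
  have h2 : ‖f z₁‖ ≤ (4/5:ℝ)^n * Real.exp Λ * ‖f z₁‖ := by
    calc _ ≤ (1/5) ^ n * ‖h z₁‖ := B
      _ ≤ (1/5) ^ n * (Real.exp Λ * ‖f z₁‖ * 4 ^ n) := by gcongr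
      _ = ((1/5)^n * 4^n) * Real.exp Λ * ‖f z₁‖ := by ring
      _ = _ := by rw [← mul_pow]; norm_num
  have h3 : 1 ≤ (4/5:ℝ)^n * Real.exp Λ := by
    by_contra hcon
    push Not at hcon
    nlinarith
  have h4 : (4/5:ℝ)^n ≤ Real.exp (-(n/5)) := by
    have : (4/5:ℝ) ≤ Real.exp (-(1/5)) := by
      have := Real.add_one_le_exp (-(1/5):ℝ); linarith
    calc _ ≤ (Real.exp (-(1/5)))^n := by gcongr
      _ = _ := by rw [← Real.exp_nat_mul]; congr 1; ring
  have h5 : 1 ≤ Real.exp (-(n/5) + Λ) := by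
    rw [Real.exp_add]; exact h3.trans (by gcongr)
  have := Real.one_le_exp_iff.1 h5
  linarith

/-- local factorisation -/
lemma local_factor (f : ℂ → ℂ) (z₁ : ℂ) (Λ : ℝ) (hf : Differentiable ℂ f) (hf0 : f z₁ ≠ 0)
    (hb : ∀ z ∈ Metric.closedBall z₁ (9/20), ‖f z‖ ≤ Real.exp Λ * ‖f z₁‖) :
    ∃ (l : Multiset ℂ) (h : ℂ → ℂ), Differentiable ℂ h ∧ (∀ z, f z = (l.map (fun ρ => z - ρ)).prod * h z) ∧
      (∀ ρ ∈ l, ‖ρ - z₁‖ ≤ 1/5 ∧ f ρ = 0) ∧ (∀ z ∈ Metric.closedBall z₁ (1/5), h z ≠ 0) := by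
  by_contra hcon
  have key : ∀ n : ℕ, ∃ (l : Multiset ℂ) (h : ℂ → ℂ), Multiset.card l = n ∧ Differentiable ℂ h ∧
      (∀ z, f z = (l.map (fun ρ => z - ρ)).prod * h z) ∧ (∀ ρ ∈ l, ‖ρ - z₁‖ ≤ 1/5 ∧ f ρ = 0) := by
    intro n
    induction n with
    | zero => exact ⟨0, f, by simp, hf, by simp, by simp⟩
    | succ n ih =>
      obtain ⟨l, h, hn, hh, hfac, hl⟩ := ih
      by_cases hz : ∀ z ∈ Metric.closedBall z₁ (1/5), h z ≠ 0
      · exact absurd ⟨l, h, hh, hfac, hl, hz⟩ hcon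
      · push Not at hz
        obtain ⟨ρ, hρ, h0⟩ := hz
        refine ⟨ρ ::ₘ l, dslope h ρ, by simp [hn], ?_, ?_, ?_⟩
        · exact differentiableOn_univ.1 ((Complex.differentiableOn_dslope Filter.univ_mem).2 hh.differentiableOn)
        · intro z
          have e : (z - ρ) * dslope h ρ z = h z := by
            have := sub_smul_dslope h ρ z
            rw [h0, sub_zero] at this
            simpa using this
          rw [hfac z, Multiset.map_cons, Multiset.prod_cons, ← e]; ring
        · intro r hr
          rcases Multiset.mem_cons.1 hr with rfl | hr
          · exact ⟨by simpa [dist_eq_norm] using hρ, by rw [hfac r, h0, mul_zero]⟩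
          · exact hl r hr
  obtain ⟨n, hn⟩ := exists_nat_gt (5 * Λ)
  obtain ⟨l, h, hln, hh, hfac, hl⟩ := key n
  have := (zero_count f h z₁ Λ hf0 hb l hh hfac (fun ρ hρ => (hl ρ hρ).1)).2.2
  rw [hln] at this
  linarith


lemma multiset_fin (l : Multiset ℂ) : ∃ (n : ℕ) (r : Fin n → ℂ), l = Multiset.map r Finset.univ.val := by
  obtain ⟨L, rfl⟩ := Quot.exists_rep l
  refine ⟨L.length, L.get, ?_⟩
  rw [Fin.univ_val_map, List.ofFn_get]; rfl

/-- local lower bound near a point on the critical line -/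
lemma local_lower (f : ℂ → ℂ) (s₀ z₁ : ℂ) (hz₁ : z₁ = s₀ + ((1/20 : ℝ) : ℂ)) (Λ : ℝ) (hΛ : 0 < Λ)
    (hf : Differentiable ℂ f) (hf0 : f z₁ ≠ 0) (hs0 : f s₀ ≠ 0)
    (hb : ∀ z ∈ Metric.closedBall z₁ (9/20), ‖f z‖ ≤ Real.exp Λ * ‖f z₁‖)
    (hzero : ∀ z ∈ Metric.closedBall z₁ (1/5), f z = 0 → z.re = s₀.re) :
    ∃ (n : ℕ) (u : Fin n → ℝ) (H : ℝ), (n:ℝ) ≤ 5 * Λ ∧ (∀ i, u i ≠ 0 ∧ |u i| ≤ 1/5) ∧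
      Real.log ‖f s₀‖ = ∑ i, Real.log ((u i)^2) / 2 + H ∧ H ≤ Real.log ‖f z₁‖ + 11 * Λ ∧
      ∀ δ y : ℝ, 0 < δ → δ ≤ 1/40 → |y| ≤ 1/40 →
        ∑ i, Real.log (δ^2 + (y - u i)^2) / 2 + H - 120 * Λ * (δ + |y|) ≤
          Real.log ‖f (s₀ + δ + y * I)‖ := by
  obtain ⟨l, h, hh, hfac, hl, hne⟩ := local_factor f z₁ Λ hf hf0 hb
  obtain ⟨n, r, rfl⟩ := multiset_fin l
  have hfac' : ∀ z, f z = (∏ i, (z - r i)) * h z := by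
    intro z; rw [hfac z, Multiset.map_map]; rfl
  obtain ⟨c1, c2, c3⟩ := zero_count f h z₁ Λ hf0 hb _ hh hfac (fun ρ hρ => (hl ρ hρ).1)
  simp only [Multiset.card_map, Finset.card_val, Finset.card_univ, Fintype.card_fin] at c1 c2 c3
  have hr : ∀ i, ‖r i - z₁‖ ≤ 1/5 ∧ f (r i) = 0 := fun i => hl _ (Multiset.mem_map_of_mem _ (by simp))
  have hre : ∀ i, (r i).re = s₀.re := by
    intro i
    exact hzero _ (by rw [Metric.mem_closedBall, dist_eq_norm]; exact (hr i).1) (hr i).2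
  have hz₁im : z₁.im = s₀.im := by rw [hz₁]; simp
  have hdist : s₀ ∈ Metric.closedBall z₁ (1/5) := by
    rw [Metric.mem_closedBall, dist_eq_norm, hz₁, sub_add_cancel_left, norm_neg, Complex.norm_real]; norm_num
  have hhs : h s₀ ≠ 0 := hne _ hdist
  set u : Fin n → ℝ := fun i => (r i).im - s₀.im with hu
  have hri : ∀ i, r i = s₀ + u i * I := by
    intro i; apply Complex.ext <;> simp [hu, hre]
  -- norm identity
  have hnorm : ∀ (δ y : ℝ) (i : Fin n), Real.log ‖s₀ + δ + y * I - r i‖ = Real.log (δ^2 + (y - u i)^2) / 2 := by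
    intro δ y i
    have e : s₀ + δ + y * I - r i = (δ : ℂ) + ((y - u i : ℝ) : ℂ) * I := by rw [hri]; push_cast; ring
    rw [e, Complex.norm_add_mul_I, Real.log_sqrt (by positivity)]
  have hui : ∀ i, u i ≠ 0 := by
    intro i h0
    apply hs0
    rw [← (hr i).2, hri i, h0]; simp
  -- the nonvanishing part
  have hhz1 : ‖h z₁‖ ≠ 0 := norm_ne_zero_iff.2 (hne z₁ (by simp))
  have hhb : ∀ z ∈ Metric.ball z₁ (1/5), ‖h z‖ ≤ Real.exp Λ * ‖h z₁‖ := by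
    intro z hz
    refine (c1 z (Metric.closedBall_subset_closedBall (by norm_num) (Metric.ball_subset_closedBall hz))).trans ?_
    calc Real.exp Λ * ‖f z₁‖ * 4^n ≤ Real.exp Λ * ((1/5)^n * ‖h z₁‖) * 4^n := by gcongr
      _ = Real.exp Λ * ‖h z₁‖ * ((1/5)^n * 4^n) := by ring
      _ ≤ Real.exp Λ * ‖h z₁‖ * 1 := by
        gcongr; rw [← mul_pow]; exact pow_le_one₀ (by norm_num) (by norm_num)
      _ = _ := mul_one _
  obtain ⟨g, hg, hg0, hge, hgb⟩ := bc_log z₁ (1/5) (Real.exp Λ) (by norm_num) (Real.one_lt_exp_iff.2 hΛ) h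
    hh.differentiableOn (fun z hz => hne z (Metric.ball_subset_closedBall hz)) hhb
  rw [Real.log_exp] at hgb
  have hder : ∀ z ∈ Metric.closedBall z₁ (1/10), ‖deriv g z‖ ≤ 120 * Λ := by
    intro z hz
    rw [Metric.mem_closedBall, dist_eq_norm] at hz
    have hsub : Metric.closedBall z (1/20) ⊆ Metric.ball z₁ (1/5) := by
      intro w hw
      rw [Metric.mem_closedBall, dist_eq_norm] at hw
      rw [Metric.mem_ball, dist_eq_norm]
      have := norm_add_le (w - z) (z - z₁)
      rw [sub_add_sub_cancel] at this; linarith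
    have := Complex.norm_deriv_le_of_forall_mem_sphere_norm_le (f := g) (c := z) (R := 1/20) (C := 6 * Λ)
      (by norm_num) ?_ ?_
    · linarith
    · apply DifferentiableOn.diffContOnCl
      rw [closure_ball _ (by norm_num)]
      exact hg.mono hsub
    · intro w hw
      have hw' := hsub (Metric.sphere_subset_closedBall hw)
      refine (hgb w hw').trans ?_
      rw [mem_sphere_iff_norm] at hw
      have h1 : ‖w - z₁‖ ≤ 3/20 := by
        have := norm_add_le (w - z) (z - z₁)
        rw [sub_add_sub_cancel] at this; linarith
      rw [div_le_iff₀ (by linarith)]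
      nlinarith
  have hs1 : s₀ ∈ Metric.closedBall z₁ (1/10) := by
    rw [Metric.mem_closedBall, dist_eq_norm, hz₁, sub_add_cancel_left, norm_neg, Complex.norm_real]; norm_num
  have hlip : ∀ p ∈ Metric.closedBall z₁ (1/10), ‖g p - g s₀‖ ≤ 120 * Λ * ‖p - s₀‖ := by
    intro p hp
    exact Convex.norm_image_sub_le_of_norm_deriv_le (s := Metric.closedBall z₁ (1/10))
      (fun x hx => hg.differentiableAt (Metric.isOpen_ball.mem_nhds
        (Metric.closedBall_subset_ball (by norm_num) hx))) hder (convex_closedBall _ _) hs1 hp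
  refine ⟨n, u, Real.log ‖h s₀‖, c3, ?_, ?_, ?_, ?_⟩
  · intro i
    refine ⟨hui i, ?_⟩
    have := (Complex.abs_im_le_norm (r i - z₁)).trans (hr i).1
    simpa [hz₁im, hu] using this
  · rw [hfac' s₀, norm_mul, norm_prod, Real.log_mul _ (norm_ne_zero_iff.2 hhs), Real.log_prod]
    · congr 1
      apply Finset.sum_congr rfl
      intro i _
      have := hnorm 0 0 i
      simpa using this
    · intro i _
      rw [norm_ne_zero_iff, hri]; simpa using hui i
    · rw [Finset.prod_ne_zero_iff]
      intro i _
      rw [norm_ne_zero_iff, hri]; simpa using hui i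
  · have h1 := c1 s₀ (Metric.closedBall_subset_closedBall (by norm_num) hdist)
    have h2 := Real.log_le_log (norm_pos_iff.2 hhs) h1
    have hfp := norm_pos_iff.2 hf0
    rw [Real.log_mul (by positivity) (by positivity), Real.log_mul (by positivity) hfp.ne', Real.log_exp,
      Real.log_pow] at h2
    have h4 : Real.log 4 ≤ 2 := by
      rw [show (4:ℝ) = 2^2 by norm_num, Real.log_pow]; push_cast; linarith [Real.log_two_lt_d9]
    have : (n:ℝ) * Real.log 4 ≤ n * 2 := by gcongr
    linarith
  · intro δ y hδ hδ1 hy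
    set p := s₀ + δ + y * I with hp
    have hps : ‖p - s₀‖ ≤ δ + |y| := by
      have e : p - s₀ = (δ : ℂ) + y * I := by rw [hp]; ring
      rw [e]
      refine (norm_add_le _ _).trans ?_
      simp [abs_of_pos hδ]
    have hpb : p ∈ Metric.closedBall z₁ (1/10) := by
      rw [Metric.mem_closedBall, dist_eq_norm]
      have h1 : ‖s₀ - z₁‖ ≤ 1/20 := by
        rw [hz₁, sub_add_cancel_left, norm_neg, Complex.norm_real]; norm_num
      have := norm_add_le (p - s₀) (s₀ - z₁)
      rw [sub_add_sub_cancel] at this; linarith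
    have hpball : p ∈ Metric.ball z₁ (1/5) := Metric.closedBall_subset_ball (by norm_num) hpb
    have hsball : s₀ ∈ Metric.ball z₁ (1/5) := Metric.closedBall_subset_ball (by norm_num) hs1
    have hhp : h p ≠ 0 := hne _ (Metric.ball_subset_closedBall hpball)
    have hlog : ∀ z ∈ Metric.ball z₁ (1/5), Real.log ‖h z‖ = Real.log ‖h z₁‖ + (g z).re := by
      intro z hz
      rw [hge z hz, norm_mul, Real.log_mul hhz1 (by simp), Complex.norm_exp, Real.log_exp]
    have h3 : Real.log ‖h s₀‖ - 120 * Λ * (δ + |y|) ≤ Real.log ‖h p‖ := by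
      rw [hlog _ hsball, hlog _ hpball]
      have h4 := (Complex.abs_re_le_norm _).trans (hlip p hpb)
      have h5 := (abs_le.1 h4).1
      rw [Complex.sub_re] at h5
      have : 120 * Λ * ‖p - s₀‖ ≤ 120 * Λ * (δ + |y|) := by gcongr
      linarith
    have hpn : ∀ i, ‖p - r i‖ ≠ 0 := by
      intro i
      rw [norm_ne_zero_iff]
      intro h0
      have := congrArg Complex.re h0
      rw [Complex.sub_re, hre] at this
      simp [hp] at this
      linarith
    rw [hfac' p, norm_mul, norm_prod, Real.log_mul (Finset.prod_ne_zero_iff.2 fun i _ => hpn i)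
      (norm_ne_zero_iff.2 hhp), Real.log_prod (fun i _ => hpn i)]
    have : ∑ i, Real.log ‖p - r i‖ = ∑ i, Real.log (δ^2 + (y - u i)^2) / 2 :=
      Finset.sum_congr rfl fun i _ => hnorm δ y i
    rw [this]; linarith


lemma log_shift (Q y : ℝ) (hQ : 1 ≤ Real.log Q) (hQ0 : 0 < Q) : Real.log (Q * (1 + |y|)) ≤ Real.log Q * (1 + |y|) := by
  rw [Real.log_mul hQ0.ne' (by positivity)]
  have : Real.log (1 + |y|) ≤ |y| := by
    have := Real.log_le_sub_one_of_pos (show 0 < 1 + |y| by positivity)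
    linarith
  nlinarith [abs_nonneg y]

lemma log_conv {q : ℕ} (hq : 1 < q) (t : ℝ) : 1 ≤ Real.log (q * (2 + |t|)) := by
  rw [Real.le_log_iff_exp_le (by positivity)]
  have : (2:ℝ) ≤ q := by exact_mod_cast hq
  have := Real.exp_one_lt_d9
  nlinarith [abs_nonneg t]

lemma near_far {n : ℕ} (u : Fin n → ℝ) (H Λ l δ : ℝ) (G : ℝ → ℝ) (hl : 1 ≤ l) (hΛ : Λ = 1004 * l)
    (hn : (n:ℝ) ≤ 5 * Λ) (hu : ∀ i, u i ≠ 0 ∧ |u i| ≤ 1/5) (hH : H ≤ 12 * Λ) (hδ : 0 < δ) (hδ' : δ ≤ 1/40)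
    (hnear : ∀ y : ℝ, |y| ≤ 1/40 →
        ∑ i, Real.log (δ^2 + (y - u i)^2) / 2 + H - 120 * Λ * (δ + |y|) ≤ G y)
    (hfar : ∀ y : ℝ, - (50 * (l * (1 + |y|)) / δ) ≤ G y) (y : ℝ) :
    ∑ i, Real.log (δ^2 + (y - u i)^2) / 2 + H - 10^11 * l * (δ + |y| + y^4/δ) ≤ G y := by
  rcases le_or_gt |y| (1/40) with h | h
  · refine le_trans ?_ (hnear y h)
    have h1 : 0 ≤ y^4/δ := by positivity
    have h2 : 0 ≤ l * (y^4/δ) := by positivity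
    have h3 : 0 ≤ l * (δ + |y|) := by positivity
    rw [hΛ]; nlinarith
  · refine le_trans ?_ (hfar y)
    have h1 : ∑ i, Real.log (δ^2 + (y - u i)^2) / 2 ≤ ∑ i : Fin n, |y| := by
      apply Finset.sum_le_sum
      intro i _
      have hb : δ^2 + (y - u i)^2 ≤ (1 + |y|)^2 := by
        have h1 := (hu i).2
        have h2 : |y - u i| ≤ |y| + 1/5 := by
          have := abs_sub y (u i); linarith
        have h3 : (y - u i)^2 ≤ (|y| + 1/5)^2 := by
          rw [← sq_abs]; exact pow_le_pow_left₀ (abs_nonneg _) h2 2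
        nlinarith [abs_nonneg y]
      have h4 := Real.log_le_log (by positivity) hb
      rw [Real.log_pow] at h4
      have := Real.log_le_sub_one_of_pos (show 0 < 1 + |y| by positivity)
      push_cast at h4
      linarith
    rw [Finset.sum_const, Finset.card_univ, Fintype.card_fin, nsmul_eq_mul] at h1
    have h2 : (n:ℝ) * |y| ≤ 5 * Λ * |y| := mul_le_mul_of_nonneg_right hn (abs_nonneg y)
    set Y := |y| with hY
    have hy4 : y^4 = Y^4 := by rw [hY]; exact (Even.pow_abs (by decide) y).symm
    rw [hy4]
    have e1 : 1 ≤ 40^4 * Y^4 := by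
      have := pow_le_pow_left₀ (by norm_num) h.le 4
      norm_num at this ⊢; linarith
    have e2 : Y ≤ 40^3 * Y^4 := by
      have := pow_le_pow_left₀ (by norm_num) h.le 3
      have h0 : 0 ≤ Y := by positivity
      have := mul_le_mul_of_nonneg_left this h0
      norm_num at this ⊢; nlinarith
    have e3 : (40:ℝ) ≤ 1/δ := by rw [le_div_iff₀ hδ]; linarith
    have e4 : 50 * (l * (1 + Y)) / δ = l * (50 * (1 + Y) * (1/δ)) := by ring
    have e5 : Y^4/δ = Y^4 * (1/δ) := by ring
    rw [e4, e5]
    set d := 1/δ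
    have e6 : 5 * 1004 * Y + 12 * 1004 + 50 * (1 + Y) * d ≤ 10^11 * (Y^4 * d) := by
      have hd : 0 < d := by linarith
      have e7 : (1 + Y) * d ≤ (40^4 + 40^3) * Y^4 * d := by
        apply mul_le_mul_of_nonneg_right _ hd.le; linarith
      have e8 : 40 * Y^4 ≤ Y^4 * d := by
        have := mul_le_mul_of_nonneg_left e3 (show 0 ≤ Y^4 by positivity); linarith
      nlinarith
    have e9 := mul_le_mul_of_nonneg_left e6 (show 0 ≤ l by linarith)
    have e10 : 0 ≤ l * δ := by positivity
    have e11 : 0 ≤ l * Y := by positivity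
    rw [hΛ] at h2 hH
    nlinarith

lemma kernel_int {n : ℕ} (u : Fin n → ℝ) (H D L lam : ℝ) (G : ℝ → ℝ) (hu : ∀ i, u i ≠ 0) (hD : 0 ≤ D)
    (hlam : lam = 8 * kapm) (hL : 1 ≤ L)
    (hG : ∀ y : ℝ, ∑ i, Real.log ((lam/L)^2 + (y - u i)^2) / 2 + H - D * (lam/L + |y| + y^4/(lam/L)) ≤ G y)
    (hGi : MeasureTheory.Integrable (fun y => kap y * G (y/L))) :
    ∑ i, Real.log ((u i)^2) / 2 + H - D * ((lam + 2) * kapm) / L ≤ ∫ y, kap y * G (y/L) := by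
  have hk := kapm_ge
  have hlam1 : 1 ≤ lam := by linarith
  have hL0 : 0 < L := by linarith
  have hInt : ∀ v : ℝ, MeasureTheory.Integrable (fun y => kap y * Real.log (lam^2 + (y - v)^2)) := by
    intro v
    have hpos : ∀ y : ℝ, 1 ≤ lam^2 + (y-v)^2 := by intro y; nlinarith [sq_nonneg (y-v)]
    apply kap_integrable' _ (lam^2 + 2*v^2 + 2)
    · apply Continuous.log (by fun_prop)
      intro y; linarith [hpos y]
    · intro y
      rw [abs_of_nonneg (Real.log_nonneg (hpos y))]
      have h1 := Real.log_le_sub_one_of_pos (show 0 < lam^2 + (y-v)^2 by linarith [hpos y])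
      have h2 : y^2 ≤ 1 + y^4 := by nlinarith [sq_nonneg (y^2-1)]
      have h3 : 0 ≤ y^4 := by positivity
      nlinarith [sq_nonneg (y+v), mul_nonneg (show 0 ≤ lam^2 + 2*v^2 by positivity) h3]
  have hkey : ∀ y : ℝ, ∑ i, (kap y * Real.log (lam^2 + (y - L * u i)^2) / 2 - kap y * Real.log L) + kap y * H
      - D/L * (lam+2) * (kap y * (1 + y^4)) ≤ kap y * G (y/L) := by
    intro y
    have h1 := mul_le_mul_of_nonneg_left (hG (y/L)) (kap_nonneg y)
    refine le_trans ?_ h1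
    have h2 : ∀ i, Real.log ((lam/L)^2 + (y/L - u i)^2) / 2 = Real.log (lam^2 + (y - L * u i)^2) / 2 - Real.log L := by
      intro i
      have : (lam/L)^2 + (y/L - u i)^2 = (lam^2 + (y - L * u i)^2) / L^2 := by
        field_simp
      rw [this, Real.log_div (by positivity) (by positivity), Real.log_pow]
      push_cast; ring
    simp_rw [h2]
    rw [mul_sub (kap y), mul_add (kap y) (∑ i, _) H, Finset.mul_sum]
    have h3 : ∑ i, (kap y * Real.log (lam^2 + (y - L * u i)^2) / 2 - kap y * Real.log L)
        = ∑ i, kap y * (Real.log (lam^2 + (y - L * u i)^2) / 2 - Real.log L) := by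
      apply Finset.sum_congr rfl; intro i _; ring
    rw [h3]
    have h4 : lam / L + |y/L| + (y/L)^4/(lam/L) ≤ (lam+2) * (1+y^4) / L := by
      have e1 : |y/L| = |y|/L := by rw [abs_div, abs_of_pos hL0]
      have e2 : (y/L)^4/(lam/L) ≤ y^4/L := by
        have : (y/L)^4/(lam/L) = y^4 / (L * (L^2 * lam)) := by field_simp
        rw [this]
        apply div_le_div_of_nonneg_left (by positivity) hL0
        have : 1 ≤ L^2 * lam := by nlinarith [sq_nonneg (L-1), mul_le_mul hL hL (by norm_num) (by linarith)]
        nlinarith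
      have e3 : |y| ≤ 1 + y^4 := by
        have : y^4 = |y|^4 := (Even.pow_abs (by decide) y).symm
        rw [this]
        nlinarith [sq_nonneg (|y|^2-1), sq_nonneg (|y|-1), abs_nonneg y]
      rw [e1]
      calc lam / L + |y|/L + (y/L)^4/(lam/L) ≤ lam/L + |y|/L + y^4/L := by linarith
        _ = (lam + |y| + y^4)/L := by ring
        _ ≤ _ := by
          apply div_le_div_of_nonneg_right _ hL0.le
          have : 0 ≤ y^4 := by positivity
          nlinarith
    have h5 := mul_le_mul_of_nonneg_left (mul_le_mul_of_nonneg_left h4 hD) (kap_nonneg y)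
    have h6 : kap y * (D * ((lam+2) * (1+y^4)/L)) = D/L * (lam+2) * (kap y * (1 + y^4)) := by ring
    linarith
  have hs : ∀ i ∈ (Finset.univ : Finset (Fin n)), MeasureTheory.Integrable (fun y => kap y * Real.log (lam^2 + (y - L * u i)^2) / 2 - kap y * Real.log L) := by
    intro i _
    exact ((hInt _).div_const 2).sub (kap_int.mul_const _)
  have hs' := MeasureTheory.integrable_finsetSum _ hs
  have hadd : MeasureTheory.Integrable (fun y => ∑ i, (kap y * Real.log (lam^2 + (y - L * u i)^2) / 2 - kap y * Real.log L) + kap y * H) :=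
    hs'.add (kap_int.mul_const H)
  have hall : MeasureTheory.Integrable (fun y => ∑ i, (kap y * Real.log (lam^2 + (y - L * u i)^2) / 2 - kap y * Real.log L) + kap y * H
      - D/L * (lam+2) * (kap y * (1 + y^4))) := hadd.sub (kapm_int.const_mul (D/L * (lam+2)))
  have hfin := MeasureTheory.integral_mono hall hGi hkey
  refine le_trans ?_ hfin
  rw [MeasureTheory.integral_sub hadd (kapm_int.const_mul (D/L * (lam+2))),
    MeasureTheory.integral_add hs' (kap_int.mul_const H),
    MeasureTheory.integral_finsetSum _ hs, MeasureTheory.integral_mul_const, MeasureTheory.integral_const_mul, kap_integral]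
  have h7 : ∑ i, Real.log ((u i)^2) / 2 ≤ ∑ i, ∫ y, (kap y * Real.log (lam^2 + (y - L * u i)^2) / 2 - kap y * Real.log L) := by
    apply Finset.sum_le_sum
    intro i _
    rw [MeasureTheory.integral_sub ((hInt _).div_const 2) (kap_int.mul_const _), MeasureTheory.integral_div,
      MeasureTheory.integral_mul_const, kap_integral]
    have h8 := kernel_ineq lam (L * u i) hlam1 (by nlinarith) (mul_ne_zero hL0.ne' (hu i))
    have h9 : Real.log ((L * u i)^2) = 2 * Real.log L + Real.log ((u i)^2) := by
      rw [mul_pow, Real.log_mul (by positivity) (pow_ne_zero _ (hu i)), Real.log_pow]; push_cast; ring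
    linarith
  have h10 : D/L * (lam+2) * ∫ y, kap y * (1 + y^4) = D * ((lam + 2) * kapm) / L := by
    rw [kapm]; ring
  simp only [h10]
  linarith

theorem pointwise_bound : ∃ C : ℝ, 0 < C ∧ ∀ (q : ℕ) [NeZero q], 1 < q → ∀ χ : DirichletCharacter ℂ q, χ ≠ 1 →
    (∀ s : ℂ, 0 < s.re → s.re < 1 → DirichletCharacter.LFunction χ s = 0 → s.re = 1 / 2) →
    ∀ t x : ℝ, 1 < x → 40 * (8 * kapm) ≤ Real.log x →
    ‖DirichletCharacter.LFunction χ (1/2 + t * I)‖ ≤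
      Real.exp ((∑ n ∈ Finset.range (⌊x⌋₊ + 1), LSeries.term (lcf χ) (1/2 + ((8 * kapm / Real.log x : ℝ) : ℂ) + t * I) n
        * wx (Real.log x) n).re + C * Real.log (q * (2 + |t|)) / Real.log x) := by
  refine ⟨10^11 * ((8 * kapm + 2) * kapm), by have := kapm_ge; positivity, ?_⟩
  intro q _ hq χ hχ hRH t x hx1 hx
  have hk := kapm_ge
  set L := Real.log x with hL
  set lam := 8 * kapm with hlam
  have hL1 : 1 ≤ L := by linarith
  have hL0 : 0 < L := by linarith
  set f := DirichletCharacter.LFunction χ with hf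
  set s₀ : ℂ := 1/2 + t * I with hs₀
  have hs₀re : s₀.re = 1/2 := by simp [hs₀]
  have hs₀im : s₀.im = t := by simp [hs₀]
  by_cases h0 : f s₀ = 0
  · rw [h0, norm_zero]; positivity
  obtain ⟨F, hFd, hFe, hFL⟩ := exists_logL χ hχ hRH
  have hlog : ∀ s : ℂ, 1/2 < s.re → Real.log ‖f s‖ = (F s).re := by
    intro s hs
    rw [hf, ← hFe s hs, Complex.norm_exp, Real.log_exp]
  have hFb := logL_bound hq χ hχ F hFd hFe hFL
  set l := Real.log (q * (2 + |t|)) with hl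
  have hl1 : 1 ≤ l := log_conv hq t
  have hq' : (2:ℝ) ≤ q := by exact_mod_cast hq
  have hQ0 : (0:ℝ) < q * (2 + |t|) := by positivity
  set z₁ : ℂ := s₀ + ((1/20 : ℝ) : ℂ) with hz₁
  have hz₁re : z₁.re = 1/2 + 1/20 := by rw [hz₁, Complex.add_re, hs₀re, Complex.ofReal_re]
  have hz₁im : z₁.im = t := by rw [hz₁, Complex.add_im, hs₀im, Complex.ofReal_im, add_zero]
  have hz1low : -(1000 * l) ≤ Real.log ‖f z₁‖ := by
    rw [hlog z₁ (by rw [hz₁re]; norm_num)]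
    have := hFb (1/20) (by norm_num) (by norm_num) z₁ (by rw [hz₁re])
    rw [hz₁im] at this
    have h2 := (abs_le.mp (Complex.abs_re_le_norm (F z₁))).1
    have h3 : 50 * Real.log (q * (2 + |t|)) / (1/20) = 1000 * l := by rw [hl]; ring
    linarith
  have hz1ne : f z₁ ≠ 0 := by
    rw [hf, ← hFe z₁ (by rw [hz₁re]; norm_num)]; exact Complex.exp_ne_zero _
  have hup : ∀ z ∈ Metric.closedBall z₁ (9/20), ‖f z‖ ≤ Real.exp (4 * l) := by
    intro z hz
    rw [Metric.mem_closedBall, dist_eq_norm] at hz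
    have hre : 1/10 ≤ z.re := by
      have := (abs_le.mp ((Complex.abs_re_le_norm (z - z₁)).trans hz)).1
      rw [Complex.sub_re, hz₁re] at this; linarith
    have hn : ‖z‖ ≤ 2 + |t| := by
      have h1 : ‖z‖ ≤ ‖z₁‖ + 9/20 := by
        have := norm_le_norm_add_norm_sub' z z₁; linarith
      have h2 : ‖z₁‖ ≤ |z₁.re| + |z₁.im| := Complex.norm_le_abs_re_add_abs_im z₁
      rw [hz₁re, hz₁im, abs_of_pos (by norm_num)] at h2
      linarith
    have h1 := LFun_bound χ hχ z (by linarith)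
    have h2 : (q:ℝ) * ‖z‖ / z.re ≤ 10 * (q * (2 + |t|)) := by
      rw [div_le_iff₀ (by linarith)]
      have : (q:ℝ) * ‖z‖ ≤ q * (2 + |t|) := by gcongr
      nlinarith
    have h3 : (10:ℝ) ≤ Real.exp (3 * l) := by
      have e1 : Real.exp 3 ≤ Real.exp (3 * l) := Real.exp_le_exp.mpr (by linarith)
      have e2 : Real.exp 3 = Real.exp 1 ^ 3 := by rw [← Real.exp_nat_mul]; norm_num
      have e3 := Real.exp_one_gt_d9
      have e4 : (2.7:ℝ)^3 ≤ Real.exp 1 ^ 3 := pow_le_pow_left₀ (by norm_num) (by linarith) 3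
      norm_num at e4; linarith
    have h4 : Real.exp (4 * l) = Real.exp (3 * l) * (q * (2 + |t|)) := by
      rw [← Real.exp_log hQ0, ← Real.exp_add, ← hl]; ring_nf
    rw [h4]
    refine (h1.trans h2).trans ?_
    exact mul_le_mul_of_nonneg_right h3 hQ0.le
  have hz1up : Real.log ‖f z₁‖ ≤ 4 * l := by
    rw [Real.log_le_iff_le_exp (norm_pos_iff.mpr hz1ne)]
    exact hup z₁ (Metric.mem_closedBall_self (by norm_num))
  set Λ := 1004 * l with hΛ
  obtain ⟨n, u, H, hn, hu, hfs, hH, hloc⟩ := local_lower f s₀ z₁ hz₁ Λ (by positivity)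
    (DirichletCharacter.differentiable_LFunction hχ) hz1ne h0 (by
      intro z hz
      refine (hup z hz).trans ?_
      rw [← Real.exp_log (norm_pos_iff.mpr hz1ne), ← Real.exp_add]
      exact Real.exp_le_exp.mpr (by linarith)) (by
      intro z hz hz0
      rw [hs₀re]
      apply LFun_ne_zero χ hχ hRH _ hz0
      rw [Metric.mem_closedBall, dist_eq_norm] at hz
      have := (abs_le.mp ((Complex.abs_re_le_norm (z - z₁)).trans hz)).1
      rw [Complex.sub_re, hz₁re] at this; linarith)
  have hδ0 : 0 < lam / L := by positivity
  have hδ1 : lam / L ≤ 1/40 := by rw [div_le_iff₀ hL0]; linarith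
  set s₁ : ℂ := 1/2 + ((lam / L : ℝ) : ℂ) + t * I with hs₁
  have hs₁re : s₁.re = 1/2 + lam / L := by simp [hs₁]
  have hs₁im : s₁.im = t := by simp [hs₁]
  have hpt : ∀ y : ℝ, s₀ + ((lam/L : ℝ):ℂ) + y * I = s₁ + (y:ℂ) * I := by
    intro y; rw [hs₀, hs₁]; ring
  have hptre : ∀ y : ℝ, (s₁ + (y:ℂ) * I).re = 1/2 + lam/L := by intro y; simp [hs₁re]
  have hptim : ∀ y : ℝ, (s₁ + (y:ℂ) * I).im = t + y := by intro y; simp [hs₁im]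
  have hFbb : ∀ y : ℝ, ‖F (s₁ + (y:ℂ) * I)‖ ≤ 50 * (l * (1 + |y|)) / (lam/L) := by
    intro y
    refine (hFb (lam/L) hδ0 (by linarith) _ (hptre y).ge).trans ?_
    rw [hptim]
    apply div_le_div_of_nonneg_right _ hδ0.le
    apply mul_le_mul_of_nonneg_left _ (by norm_num)
    refine le_trans (Real.log_le_log (by positivity) ?_) (log_shift (q * (2 + |t|)) y hl1 hQ0)
    have := abs_add_le t y
    have h2 : 2 + |t + y| ≤ (2 + |t|) * (1 + |y|) := by nlinarith [abs_nonneg t, abs_nonneg y]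
    calc (q:ℝ) * (2 + |t+y|) ≤ q * ((2 + |t|) * (1 + |y|)) := mul_le_mul_of_nonneg_left h2 (by positivity)
      _ = _ := by ring
  set G : ℝ → ℝ := fun y => (F (s₁ + (y:ℂ) * I)).re with hG
  have hGlow := near_far u H Λ l (lam/L) G hl1 hΛ hn hu (by linarith) hδ0 hδ1 (by
      intro y hy
      have := hloc (lam/L) y hδ0 hδ1 hy
      rw [hpt, hlog _ (by rw [hptre]; linarith)] at this
      exact this) (by
      intro y
      have h2 := (abs_le.mp (Complex.abs_re_le_norm (F (s₁ + (y:ℂ) * I)))).1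
      have := hFbb y
      simp only [hG]; linarith)
  have hFcont : Continuous (fun y : ℝ => F (s₁ + ((y/L : ℝ):ℂ) * I)) := by
    rw [continuous_iff_continuousAt]
    intro y
    have h1 : DifferentiableAt ℂ F (s₁ + ((y/L : ℝ):ℂ) * I) :=
      hFd.differentiableAt ((half_open _).mem_nhds (by simp only [Set.mem_setOf_eq]; rw [hptre]; linarith))
    have h2 : ContinuousAt (fun y : ℝ => s₁ + ((y/L : ℝ):ℂ) * I) y := by fun_prop
    exact ContinuousAt.comp (f := fun y : ℝ => s₁ + ((y/L : ℝ):ℂ) * I) h1.continuousAt h2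
  have hFint : MeasureTheory.Integrable (fun y => kap y • F (s₁ + ((y/L : ℝ):ℂ) * I)) := by
    apply kap_integrable _ (100 * l / (lam/L)) hFcont.aestronglyMeasurable
    intro y
    refine (hFbb (y/L)).trans ?_
    rw [div_mul_eq_mul_div]
    apply div_le_div_of_nonneg_right _ hδ0.le
    have e1 : |y/L| ≤ |y| := by
      rw [abs_div, abs_of_pos hL0]; exact div_le_self (abs_nonneg _) hL1
    have e3 : |y| ≤ 1 + y^4 := by
      have : y^4 = |y|^4 := (Even.pow_abs (by decide) y).symm
      rw [this]
      nlinarith [sq_nonneg (|y|^2-1), sq_nonneg (|y|-1), abs_nonneg y]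
    have e4 : 0 ≤ y^4 := by positivity
    nlinarith
  have hGint : ∫ y, kap y * G (y/L) = (∫ y, kap y • F (s₁ + ((y/L : ℝ):ℂ) * I)).re := by
    have := integral_re (𝕜 := ℂ) hFint
    simp only [RCLike.re_eq_complex_re] at this
    rw [← this]
    apply MeasureTheory.integral_congr_ae
    refine Filter.Eventually.of_forall fun y => ?_
    simp [hG]
  have hGI : MeasureTheory.Integrable (fun y => kap y * G (y/L)) := by
    have := hFint.re
    refine this.congr (Filter.Eventually.of_forall fun y => ?_)
    simp [hG]
  have hfin := kernel_int u H (10^11 * l) L lam G (fun i => (hu i).1) (by positivity) hlam hL1 hGlow hGI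
  rw [← hfs, hGint, hL, kernel_formula (lcf χ) (lcf_norm χ) F s₁ (by rw [hs₁re]; linarith)
    (fun s hs => hFd.differentiableAt ((half_open _).mem_nhds (by simp only [Set.mem_setOf_eq]; rw [hs₁re] at hs; linarith))) hFL
    (100 * q / (lam/L)) (by
      intro s hs
      refine (hFb (lam/L) hδ0 (by linarith) s (by rw [← hs₁re]; exact hs)).trans ?_
      rw [div_mul_eq_mul_div]
      apply div_le_div_of_nonneg_right _ hδ0.le
      have h1 : Real.log (q * (2 + |s.im|)) ≤ q * (2 + |s.im|) := by
        have := Real.log_le_sub_one_of_pos (show (0:ℝ) < q * (2 + |s.im|) by positivity)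
        linarith
      have h2 := Complex.abs_im_le_norm s
      have h3 : (q:ℝ) * (2 + |s.im|) ≤ q * (2 + 2 * ‖s‖) := by
        apply mul_le_mul_of_nonneg_left _ (by positivity)
        linarith [norm_nonneg s]
      linarith) x hx1, ← hL] at hfin
  rw [← Real.log_le_iff_le_exp (norm_pos_iff.mpr h0)]
  have : 10^11 * ((lam + 2) * kapm) * l / L = 10^11 * l * ((lam + 2) * kapm) / L := by ring
  rw [this]; linarith


lemma zt_ne_zero_one {s : ℂ} (hs : 1 ≤ s.re) : zt s ≠ 0 := by
  by_cases h : s = 1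
  · simp [zt, h]
  · rw [zt_of_ne h]
    exact mul_ne_zero (sub_ne_zero.mpr h) (riemannZeta_ne_zero_of_one_le_re hs)

lemma zt_RH {q : ℕ} [NeZero q]
    (hRH : ∀ s : ℂ, 0 < s.re → s.re < 1 → DirichletCharacter.LFunction (1 : DirichletCharacter ℂ q) s = 0 → s.re = 1 / 2)
    {s : ℂ} (hs : 1/2 < s.re) : zt s ≠ 0 := by
  rcases le_or_gt 1 s.re with h | h
  · exact zt_ne_zero_one h
  · have h1 : s ≠ 1 := by rintro rfl; simp at h
    rw [zt_of_ne h1]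
    refine mul_ne_zero (sub_ne_zero.mpr h1) ?_
    intro h0
    have := hRH s (by linarith) h (by
      have := DirichletCharacter.LFunctionTrivChar_eq_mul_riemannZeta (N := q) h1
      rw [DirichletCharacter.LFunctionTrivChar] at this
      rw [this, h0, mul_zero])
    linarith

lemma zeta_two_lower (y : ℝ) : Real.exp (-2) ≤ ‖riemannZeta ⟨2, y⟩‖ := by
  rw [← riemannZeta_eq_exp_LSeries (s := ⟨2, y⟩) (by simp), Complex.norm_exp]
  apply Real.exp_le_exp.mpr
  have := bdd_LSeries_two (fun n : ℕ => (ArithmeticFunction.vonMangoldt n : ℂ) / (Real.log n : ℂ)) (by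
    intro n
    have := lcf_norm (1 : DirichletCharacter ℂ 1) n
    rw [lcf, MulChar.one_apply (isUnit_of_subsingleton _), one_mul] at this
    exact this) (s := ⟨2, y⟩) (by simp)
  have h2 := (abs_le.mp ((Complex.abs_re_le_norm _).trans this)).1
  exact h2

lemma ztlog : ∃ C : ℝ, 0 < C ∧ ((∀ s : ℂ, 1/2 < s.re → zt s ≠ 0) → ∀ s : ℂ, 3/4 ≤ s.re → s.re ≤ 2 →
    ‖deriv zt s / zt s‖ ≤ C * Real.log (3 + |s.im|)) := by
  refine ⟨180 * 14, by norm_num, ?_⟩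
  intro h s hs1 hs2
  set y := s.im with hy
  set z₀ : ℂ := ⟨2, y⟩ with hz₀
  have hzn : z₀ ≠ 1 := by intro h; have := congrArg Complex.re h; simp [hz₀] at this
  have hlow : Real.exp (-2) ≤ ‖zt z₀‖ := by
    rw [zt_of_ne hzn, norm_mul]
    have h1 : 1 ≤ ‖z₀ - 1‖ := by
      have := Complex.abs_re_le_norm (z₀ - 1)
      simp [hz₀] at this
      norm_num at this
      exact this
    have h2 := zeta_two_lower y
    have h3 := Real.exp_pos (-2)
    nlinarith
  set T := 3 + |y| with hT
  have hT3 : 3 ≤ T := by rw [hT]; linarith [abs_nonneg y]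
  have hlT : 1 ≤ Real.log T := by
    rw [Real.le_log_iff_exp_le (by linarith)]
    linarith [Real.exp_one_lt_d9]
  set M := Real.exp 2 * (12 * T^2) with hM
  have hre : ∀ z ∈ Metric.ball z₀ (3/2), 1/2 < z.re := by
    intro z hz
    rw [Metric.mem_ball, dist_eq_norm] at hz
    have := (abs_lt.mp ((Complex.abs_re_le_norm (z - z₀)).trans_lt hz)).1
    simp [hz₀] at this; linarith
  have hMb : ∀ z ∈ Metric.ball z₀ (3/2), ‖zt z‖ ≤ M * ‖zt z₀‖ := by
    intro z hz
    have hr := hre z hz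
    have hn : ‖z‖ ≤ T + 1 := by
      rw [Metric.mem_ball, dist_eq_norm] at hz
      have h1 := norm_le_norm_add_norm_sub' z z₀
      have h2 := Complex.norm_le_abs_re_add_abs_im z₀
      simp [hz₀] at h2
      rw [hT]; linarith
    have hn1 : ‖z - 1‖ ≤ T + 2 := by
      have := norm_sub_le z 1
      rw [norm_one] at this; linarith
    have hb := zt_bound z (by linarith)
    have h3 : ‖z‖ * ‖z - 1‖ / z.re ≤ 2 * ((T+1) * (T+2)) := by
      rw [div_le_iff₀ (by linarith)]
      have : ‖z‖ * ‖z - 1‖ ≤ (T+1) * (T+2) := mul_le_mul hn hn1 (norm_nonneg _) (by linarith)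
      nlinarith [mul_pos (show 0 < T + 1 by linarith) (show 0 < T + 2 by linarith)]
    have h4 : ‖zt z‖ ≤ 12 * T^2 := by nlinarith
    have h5 : 1 ≤ Real.exp 2 * ‖zt z₀‖ := by
      have := mul_le_mul_of_nonneg_left hlow (Real.exp_pos 2).le
      rwa [← Real.exp_add, add_neg_cancel, Real.exp_zero] at this
    rw [hM]
    nlinarith [mul_le_mul_of_nonneg_left h5 (show 0 ≤ 12 * T^2 by positivity)]
  have hM1 : 1 < M := by
    have : 1 ≤ Real.exp 2 := Real.one_le_exp (by norm_num)
    rw [hM]; nlinarith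
  have hlM : Real.log M ≤ 7 * Real.log T := by
    rw [hM, Real.log_mul (Real.exp_pos _).ne' (by positivity), Real.log_exp, Real.log_mul (by norm_num) (by positivity),
      Real.log_pow]
    have : Real.log 12 ≤ 3 := by
      rw [Real.log_le_iff_le_exp (by norm_num)]
      have e2 : Real.exp 3 = Real.exp 1 ^ 3 := by rw [← Real.exp_nat_mul]; norm_num
      have e3 := Real.exp_one_gt_d9
      have e4 : (2.7:ℝ)^3 ≤ Real.exp 1 ^ 3 := pow_le_pow_left₀ (by norm_num) (by linarith) 3
      rw [e2]; norm_num at e4; linarith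
    push_cast; linarith
  obtain ⟨g, hgd, hg0, hge, hgb⟩ := bc_log z₀ (3/2) M (by norm_num) hM1 zt zt_diff.differentiableOn
    (fun z hz => h z (hre z hz)) hMb
  have hsz : ‖s - z₀‖ ≤ 5/4 := by
    have : s - z₀ = ((s.re - 2 : ℝ) : ℂ) := by apply Complex.ext <;> simp [hz₀, hy]
    rw [this, Complex.norm_real, Real.norm_eq_abs, abs_le]; constructor <;> linarith
  have hsball : s ∈ Metric.ball z₀ (3/2) := by rw [Metric.mem_ball, dist_eq_norm]; linarith
  have hder : deriv zt s / zt s = deriv g s := by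
    have h1 : zt =ᶠ[nhds s] fun z => zt z₀ * Complex.exp (g z) := by
      filter_upwards [Metric.isOpen_ball.mem_nhds hsball] with z hz using hge z hz
    have hgs := (hgd.differentiableAt (Metric.isOpen_ball.mem_nhds hsball)).hasDerivAt
    rw [h1.deriv_eq, (hgs.cexp.const_mul _).deriv, hge s hsball]
    have hz0ne : zt z₀ ≠ 0 := h z₀ (by simp [hz₀]; norm_num)
    field_simp
  rw [hder]
  have hdist : ∀ z ∈ Metric.closedBall s (1/10), ‖z - z₀‖ ≤ 27/20 := by
    intro z hz
    rw [Metric.mem_closedBall, dist_eq_norm] at hz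
    have : z - z₀ = (z - s) + (s - z₀) := by ring
    rw [this]
    refine (norm_add_le _ _).trans ?_
    linarith
  have hsub : Metric.closedBall s (1/10) ⊆ Metric.ball z₀ (3/2) := by
    intro z hz
    rw [Metric.mem_ball, dist_eq_norm]; linarith [hdist z hz]
  have := Complex.norm_deriv_le_of_forall_mem_sphere_norm_le (f := g) (c := s) (R := 1/10) (C := 18 * (14 * Real.log T)) (by norm_num)
    (by
      apply DifferentiableOn.diffContOnCl
      rw [closure_ball _ (by norm_num)]
      exact hgd.mono hsub) (by
      intro z hz
      have hz' := Metric.sphere_subset_closedBall hz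
      refine (hgb z (hsub hz')).trans ?_
      have hd := hdist z hz'
      rw [div_le_iff₀ (by linarith)]
      have h0 : 0 ≤ Real.log M := Real.log_nonneg hM1.le
      calc 2 * Real.log M * ‖z - z₀‖ ≤ 2 * (7 * Real.log T) * (27/20) := by
            apply mul_le_mul _ hd (norm_nonneg _) (by linarith)
            linarith
        _ = 18 * (14 * Real.log T) * (3/40) := by ring
        _ ≤ 18 * (14 * Real.log T) * (3/2 - ‖z - z₀‖) := by
            apply mul_le_mul_of_nonneg_left _ (by linarith)
            linarith)
  refine this.trans ?_
  linarith

lemma zt_near_one : ∃ C : ℝ, 0 < C ∧ ∀ s : ℂ, 1 < s.re → s.re ≤ 2 → ‖deriv zt s / zt s‖ ≤ 2 / (s.re - 1) + C := by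
  have hld : ∀ s : ℂ, 1 < s.re → deriv zt s / zt s = 1 / (s - 1) - LSeries (fun n => (ArithmeticFunction.vonMangoldt n : ℂ)) s := by
    intro s hs
    have h1 : s ≠ 1 := by rintro rfl; simp at hs
    have h0 := riemannZeta_ne_zero_of_one_le_re hs.le
    have hs1 : s - 1 ≠ 0 := sub_ne_zero.mpr h1
    rw [ArithmeticFunction.LSeries_vonMangoldt_eq_deriv_riemannZeta_div hs, zt_of_ne h1]
    have he : zt =ᶠ[nhds s] fun z => (z - 1) * riemannZeta z := by
      filter_upwards [isOpen_ne.mem_nhds h1] with z hz using zt_of_ne hz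
    have hd := ((hasDerivAt_id s).sub_const 1).mul (differentiableAt_riemannZeta h1).hasDerivAt
    rw [he.deriv_eq, show (fun z => (z - 1) * riemannZeta z) = ((fun x => id x - 1) * riemannZeta) from rfl, hd.deriv]
    simp only [id]
    field_simp
    ring
  have hcomp : IsCompact (Set.Icc (1:ℝ) 2) := isCompact_Icc
  have hcont : ContinuousOn (fun σ : ℝ => deriv zt (σ:ℂ) / zt (σ:ℂ)) (Set.Icc (1:ℝ) 2) := by
    apply ContinuousOn.div
    · exact ((zt_diff.contDiff (n := 1)).continuous_deriv le_rfl |>.comp Complex.continuous_ofReal).continuousOn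
    · exact (zt_diff.continuous.comp Complex.continuous_ofReal).continuousOn
    · intro σ hσ
      exact zt_ne_zero_one (by simpa using hσ.1)
  obtain ⟨C, hC⟩ := hcomp.exists_bound_of_continuousOn hcont
  refine ⟨|C| + 1, by positivity, ?_⟩
  intro s hs hs2
  set σ := s.re with hσ
  have hL : ‖LSeries (fun n => (ArithmeticFunction.vonMangoldt n : ℂ)) s‖ ≤ 1/(σ-1) + |C| := by
    have hsum := ArithmeticFunction.LSeriesSummable_vonMangoldt hs
    have hsum2 := ArithmeticFunction.LSeriesSummable_vonMangoldt (s := (σ:ℂ)) (by simpa using hs)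
    have h1 : ‖LSeries (fun n => (ArithmeticFunction.vonMangoldt n : ℂ)) s‖ ≤ ‖LSeries (fun n => (ArithmeticFunction.vonMangoldt n : ℂ)) (σ:ℂ)‖ := by
      have e : ∀ n, ‖LSeries.term (fun n => (ArithmeticFunction.vonMangoldt n : ℂ)) s n‖ = (LSeries.term (fun n => (ArithmeticFunction.vonMangoldt n : ℂ)) (σ:ℂ) n).re := by
        intro n
        rw [LSeries.norm_term_eq]
        rcases eq_or_ne n 0 with rfl | hn
        · simp
        · rw [if_neg hn, LSeries.term_of_ne_zero hn, Complex.norm_real, Real.norm_eq_abs,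
            abs_of_nonneg ArithmeticFunction.vonMangoldt_nonneg]
          have : (n:ℂ)^(σ:ℂ) = (((n:ℝ)^σ : ℝ) : ℂ) := by
            rw [Complex.ofReal_cpow (by positivity)]; simp
          rw [this, ← Complex.ofReal_div, Complex.ofReal_re]
      rw [LSeries]
      refine (norm_tsum_le_tsum_norm hsum.norm).trans ?_
      simp_rw [e]
      rw [← Complex.re_tsum hsum2]
      exact Complex.re_le_norm _
    refine h1.trans ?_
    have h2 := hld (σ:ℂ) (by simpa using hs)
    have h3 : LSeries (fun n => (ArithmeticFunction.vonMangoldt n : ℂ)) (σ:ℂ) = 1/((σ:ℂ) - 1) - deriv zt (σ:ℂ) / zt (σ:ℂ) := by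
      rw [h2]; ring
    rw [h3]
    refine (norm_sub_le _ _).trans ?_
    have h4 := (hC σ ⟨hs.le, hs2⟩).trans (le_abs_self C)
    have h5 : ‖1/((σ:ℂ) - 1)‖ = 1/(σ-1) := by
      rw [← Complex.ofReal_one, ← Complex.ofReal_sub, ← Complex.ofReal_div, Complex.norm_real, Real.norm_eq_abs,
        abs_of_pos (by apply div_pos one_pos; linarith)]
    rw [h5]
    linarith
  rw [hld s hs]
  refine (norm_sub_le _ _).trans ?_
  have h6 : ‖1/(s-1)‖ ≤ 1/(σ-1) := by
    rw [norm_div, norm_one]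
    apply one_div_le_one_div_of_le (by linarith)
    have := Complex.re_le_norm (s - 1)
    rwa [Complex.sub_re, Complex.one_re] at this
  have : 2/(σ-1) = 1/(σ-1) + 1/(σ-1) := by ring
  rw [this]; linarith


lemma zeta_Z1 (s : ℂ) (h1 : 1 < s.re) (hn : ‖s‖ ≤ 12) : ‖riemannZeta s‖ ≤ 12/‖s-1‖ + 12 := by
  have hs : s ≠ 1 := by rintro rfl; simp at h1
  have hs1 : 0 < ‖s - 1‖ := norm_pos_iff.mpr (sub_ne_zero.mpr hs)
  have h := zt_bound s (by linarith)
  rw [zt_of_ne hs, norm_mul] at h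
  have h2 : ‖s‖ * ‖s-1‖ / s.re ≤ 12 * ‖s-1‖ := by
    rw [div_le_iff₀ (by linarith)]
    have : ‖s‖ * ‖s-1‖ ≤ 12 * ‖s-1‖ := mul_le_mul_of_nonneg_right hn hs1.le
    nlinarith
  have h3 : ‖riemannZeta s‖ ≤ (12 + 12 * ‖s-1‖)/‖s-1‖ := by
    rw [le_div_iff₀ hs1]; linarith
  refine h3.trans (le_of_eq ?_)
  field_simp

lemma zeta_Z2 (s : ℂ) (h1 : 1 < s.re) (h2 : s.re ≤ 2) : ‖riemannZeta s‖ ≤ 24 / (s.re - 1) := by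
  set σ := s.re with hσ
  have hA : ‖riemannZeta s‖ ≤ ‖riemannZeta (σ:ℂ)‖ := by
    have hs1 : 1 < (σ:ℂ).re := by simpa using h1
    rw [← LSeries_one_eq_riemannZeta h1, ← LSeries_one_eq_riemannZeta hs1]
    have hsum := LSeriesSummable_one_iff.mpr h1
    have hsum2 := LSeriesSummable_one_iff.mpr hs1
    have e : ∀ n, ‖LSeries.term 1 s n‖ = (LSeries.term 1 (σ:ℂ) n).re := by
      intro n
      rw [LSeries.norm_term_eq]
      rcases eq_or_ne n 0 with rfl | hn
      · simp
      · rw [if_neg hn, LSeries.term_of_ne_zero hn]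
        have : (n:ℂ)^(σ:ℂ) = (((n:ℝ)^σ : ℝ) : ℂ) := by
          rw [Complex.ofReal_cpow (by positivity)]; simp
        rw [this, Pi.one_apply, norm_one, ← Complex.ofReal_one, ← Complex.ofReal_div, Complex.ofReal_re]
    rw [LSeries]
    refine (norm_tsum_le_tsum_norm hsum.norm).trans ?_
    simp_rw [e]
    rw [← Complex.re_tsum hsum2]
    exact Complex.re_le_norm _
  refine hA.trans ?_
  have hs1 : 1 < (σ:ℂ).re := by simpa using h1
  have := zeta_Z1 (σ:ℂ) hs1 (by rw [Complex.norm_real, Real.norm_eq_abs, abs_of_pos (by linarith)]; linarith)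
  refine this.trans ?_
  have h5 : ‖(σ:ℂ) - 1‖ = σ - 1 := by
    rw [← Complex.ofReal_one, ← Complex.ofReal_sub, Complex.norm_real, Real.norm_eq_abs, abs_of_pos (by linarith)]
  rw [h5]
  have : 12 ≤ 12 / (σ - 1) := by rw [le_div_iff₀ (by linarith)]; nlinarith
  have e : 24/(σ-1) = 12/(σ-1) + 12/(σ-1) := by ring
  rw [e]; linarith

lemma gauss_lin (d : ℝ) : (1 + |d|) * Real.exp (-d^2) ≤ 2 := by
  have h : 1 + d^2 ≤ Real.exp (d^2) := by have := Real.add_one_le_exp (d^2); linarith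
  have h2 : 1 + |d| ≤ 2 * (1 + d^2) := by rw [← sq_abs]; nlinarith [sq_nonneg (|d|-1), abs_nonneg d]
  calc (1 + |d|) * Real.exp (-d^2) ≤ (2 * Real.exp (d^2)) * Real.exp (-d^2) :=
        mul_le_mul_of_nonneg_right (by linarith) (Real.exp_pos _).le
    _ = 2 := by rw [mul_assoc, ← Real.exp_add]; simp

lemma zt_three : ∃ C : ℝ, 0 < C ∧ ((∀ s : ℂ, 1/2 < s.re → zt s ≠ 0) → ∀ x w : ℝ, 1 ≤ w → Real.log (Real.log (3+|x|)) ≤ w →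
    ∀ σ : ℝ, 1 ≤ σ → σ ≤ 1 + 1/w → ‖deriv zt (σ + x * I) / zt (σ + x * I)‖ ≤ C * w) := by
  obtain ⟨C1, hC1, h1⟩ := ztlog
  obtain ⟨C2, hC2, h2⟩ := zt_near_one
  refine ⟨Real.exp (4 * (Real.log (30 * C1 + 1) + 1)) * (30 * (C2 + 3)), by positivity, ?_⟩
  intro hz x w hw hxw σ hσ1 hσ2
  have hw0 : 0 < w := by linarith
  have hw1 : 1/w ≤ 1 := by rw [div_le_one hw0]; exact hw
  set s₀ : ℂ := σ + x * I with hs₀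
  have hs₀re : s₀.re = σ := by simp [hs₀]
  have hs₀im : s₀.im = x := by simp [hs₀]
  set f : ℂ → ℂ := fun s => deriv zt s / zt s * Complex.exp ((s - s₀)^2) with hf
  set u := 1 + 1/w with hu
  have hwpos : 0 < 1/w := by positivity
  have hexp : ∀ s : ℂ, 3/4 ≤ s.re → s.re ≤ 2 → ‖Complex.exp ((s-s₀)^2)‖ ≤ 15 * Real.exp (-(s.im - x)^2) := by
    intro s ha hb
    rw [Complex.norm_exp]
    have : ((s - s₀)^2).re = (s.re - σ)^2 + (-(s.im - x)^2) := by
      rw [sq, Complex.mul_re, Complex.sub_re, Complex.sub_im, hs₀re, hs₀im]; ring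
    rw [this, Real.exp_add]
    apply mul_le_mul_of_nonneg_right _ (Real.exp_pos _).le
    have e1 : (s.re - σ)^2 ≤ 2 := by nlinarith
    have e2 : Real.exp 2 = Real.exp 1 ^ 2 := by rw [← Real.exp_nat_mul]; norm_num
    have e3 := Real.exp_one_lt_d9
    have e4 : Real.exp 1 ^ 2 ≤ (2.8:ℝ)^2 := pow_le_pow_left₀ (Real.exp_pos 1).le (by linarith) 2
    refine (Real.exp_le_exp.mpr e1).trans ?_
    rw [e2]; norm_num at e4; linarith
  have hT : (3:ℝ) ≤ 3 + |x| := by linarith [abs_nonneg x]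
  have hl : 1 ≤ Real.log (3 + |x|) := by
    rw [Real.le_log_iff_exp_le (by linarith)]; linarith [Real.exp_one_lt_d9]
  have hbd : ∀ s : ℂ, 3/4 ≤ s.re → s.re ≤ 2 → ‖f s‖ ≤ 30 * C1 * Real.log (3 + |x|) := by
    intro s ha hb
    rw [hf, norm_mul]
    have e1 := h1 hz s ha hb
    have e2 := hexp s ha hb
    have e3 : Real.log (3 + |s.im|) ≤ Real.log (3 + |x|) * (1 + |s.im - x|) := by
      refine le_trans (Real.log_le_log (by positivity) ?_) (log_shift (3 + |x|) (s.im - x) hl (by linarith))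
      have := abs_add_le x (s.im - x)
      rw [add_sub_cancel] at this
      nlinarith [abs_nonneg x, abs_nonneg (s.im - x)]
    calc ‖deriv zt s / zt s‖ * ‖Complex.exp ((s-s₀)^2)‖
        ≤ (C1 * (Real.log (3 + |x|) * (1 + |s.im - x|))) * (15 * Real.exp (-(s.im - x)^2)) := by
          apply mul_le_mul _ e2 (norm_nonneg _) (by positivity)
          exact e1.trans (mul_le_mul_of_nonneg_left e3 hC1.le)
      _ = 15 * C1 * Real.log (3 + |x|) * ((1 + |s.im - x|) * Real.exp (-(s.im - x)^2)) := by ring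
      _ ≤ 15 * C1 * Real.log (3 + |x|) * 2 := mul_le_mul_of_nonneg_left (gauss_lin _) (by positivity)
      _ = _ := by ring
  have hbu : ∀ s ∈ re ⁻¹' {u}, ‖f s‖ ≤ 30 * (C2 + 3) * w := by
    intro s hs
    simp only [Set.mem_preimage, Set.mem_singleton_iff] at hs
    rw [hf, norm_mul]
    have e1 := h2 s (by rw [hs]; linarith) (by rw [hs]; linarith)
    have e2 := hexp s (by rw [hs]; linarith) (by rw [hs]; linarith)
    have e3 : 15 * Real.exp (-(s.im - x)^2) ≤ 15 := by
      have : Real.exp (-(s.im - x)^2) ≤ 1 := Real.exp_le_one_iff.mpr (by nlinarith [sq_nonneg (s.im - x)])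
      linarith
    rw [hs, hu] at e1
    have e4 : 2 / (1 + 1/w - 1) + C2 ≤ (C2 + 3) * w := by
      have : 2 / (1 + 1/w - 1) = 2 * w := by field_simp; ring
      rw [this]; nlinarith
    calc ‖deriv zt s / zt s‖ * ‖Complex.exp ((s-s₀)^2)‖ ≤ ((C2+3)*w) * 15 :=
          mul_le_mul (e1.trans e4) (e2.trans e3) (norm_nonneg _) (by positivity)
      _ ≤ _ := by nlinarith [mul_pos (show 0 < C2 + 3 by linarith) hw0]
  have hmain := Complex.HadamardThreeLines.norm_le_interp_of_mem_verticalClosedStrip' (f := f) (z := s₀) (l := 3/4) (u := u)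
    (a := (30 * C1 + 1) * Real.log (3 + |x|)) (b := 30 * (C2 + 3) * w) (by linarith)
    (by simp only [Complex.HadamardThreeLines.verticalClosedStrip, Set.mem_preimage, Set.mem_Icc, hs₀re]
        constructor <;> linarith)
    (by
      have hfd : DifferentiableOn ℂ f {s | 1/2 < s.re} := by
        intro s hs
        apply DifferentiableAt.differentiableWithinAt
        apply DifferentiableAt.mul
        · exact ((zt_diff.contDiff (n := 2)).differentiable_deriv_two s).div (zt_diff s) (hz s hs)
        · fun_prop
      constructor
      · apply hfd.mono
        intro s hs
        simp only [Complex.HadamardThreeLines.verticalStrip, Set.mem_preimage, Set.mem_Ioo] at hs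
        show 1/2 < s.re
        linarith [hs.1]
      · apply hfd.continuousOn.mono
        intro s hs
        have hcl : closure (Complex.HadamardThreeLines.verticalStrip (3/4) u) ⊆ re ⁻¹' (Set.Icc (3/4) u) := by
          apply closure_minimal _ (isClosed_Icc.preimage Complex.continuous_re)
          intro s hs
          exact Set.Ioo_subset_Icc_self hs
        have := hcl hs
        simp only [Set.mem_preimage, Set.mem_Icc] at this
        show 1/2 < s.re
        linarith [this.1])
    (by
      refine ⟨30 * C1 * Real.log (3 + |x|), ?_⟩
      rintro _ ⟨s, hs, rfl⟩
      simp only [Complex.HadamardThreeLines.verticalClosedStrip, Set.mem_preimage, Set.mem_Icc] at hs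
      exact hbd s hs.1 (by linarith [hs.2]))
    (by
      intro s hs
      simp only [Set.mem_preimage, Set.mem_singleton_iff] at hs
      refine (hbd s hs.ge (by rw [hs]; norm_num)).trans ?_
      nlinarith)
    hbu
  have hfs : f s₀ = deriv zt s₀ / zt s₀ := by simp [hf]
  rw [hfs, hs₀re] at hmain
  refine hmain.trans ?_
  set τ := (σ - 3/4)/(u - 3/4) with hτ
  have hu34 : 0 < u - 3/4 := by linarith
  have hτ1 : τ ≤ 1 := by rw [hτ, div_le_one hu34]; linarith
  have hτ2 : 1 - τ ≤ 4/w := by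
    have : 1 - τ = (u - σ)/(u - 3/4) := by rw [hτ, eq_div_iff hu34.ne', sub_mul, div_mul_cancel₀ _ hu34.ne']; ring
    rw [this, div_le_iff₀ hu34]
    have e1 : u - σ ≤ 1/w := by linarith
    have e2 : 4/w = 4*(1/w) := by ring
    rw [e2]; nlinarith
  set a := (30 * C1 + 1) * Real.log (3 + |x|) with ha
  have ha1 : 1 ≤ a := by rw [ha]; nlinarith
  have hb1 : 1 ≤ 30 * (C2 + 3) * w := by nlinarith
  have hA : a ^ (1 - τ) ≤ Real.exp (4 * (Real.log (30 * C1 + 1) + 1)) := by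
    refine (Real.rpow_le_rpow_of_exponent_le ha1 hτ2).trans ?_
    rw [Real.rpow_def_of_pos (by linarith)]
    apply Real.exp_le_exp.mpr
    have e1 : Real.log a ≤ Real.log (30 * C1 + 1) + w := by
      rw [ha, Real.log_mul (by linarith) (by linarith)]; linarith
    have e2 : 0 ≤ Real.log (30 * C1 + 1) := Real.log_nonneg (by linarith)
    have e3 : Real.log a * (4/w) = 4 * (Real.log a) / w := by ring
    rw [e3, div_le_iff₀ hw0]
    nlinarith
  have hB : (30 * (C2 + 3) * w) ^ τ ≤ 30 * (C2 + 3) * w := by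
    have := Real.rpow_le_rpow_of_exponent_le hb1 hτ1
    rwa [Real.rpow_one] at this
  calc a ^ (1 - τ) * (30 * (C2 + 3) * w) ^ τ ≤ Real.exp (4 * (Real.log (30 * C1 + 1) + 1)) * (30 * (C2 + 3) * w) :=
        mul_le_mul hA hB (by positivity) (Real.exp_pos _).le
    _ = _ := by ring

lemma zeta_Z3 : ∃ C : ℝ, 0 < C ∧ ((∀ s : ℂ, 1/2 < s.re → zt s ≠ 0) → ∀ x η : ℝ, 10 ≤ |x| → 0 < η → η ≤ 1 →
    ‖riemannZeta (((1 + η : ℝ) : ℂ) + x * I)‖ ≤ C * Real.log (Real.log |x|)) := by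
  obtain ⟨C, hC, h3⟩ := zt_three
  refine ⟨240 * Real.exp C, by positivity, ?_⟩
  intro hz x η hx hη hη1
  have hlx : 2 ≤ Real.log |x| := by
    rw [Real.le_log_iff_exp_le (by linarith)]
    have e2 : Real.exp 2 = Real.exp 1 ^ 2 := by rw [← Real.exp_nat_mul]; norm_num
    have e4 : Real.exp 1 ^ 2 ≤ (2.8:ℝ)^2 := pow_le_pow_left₀ (Real.exp_pos 1).le (by linarith [Real.exp_one_lt_d9]) 2
    rw [e2]; norm_num at e4; linarith
  have hll : 1/2 ≤ Real.log (Real.log |x|) := by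
    have := Real.log_le_log (by norm_num) hlx
    linarith [Real.log_two_gt_d9]
  set w := 1 + Real.log (Real.log (3 + |x|)) with hw
  have hl3 : Real.log |x| ≤ Real.log (3 + |x|) := Real.log_le_log (by linarith) (by linarith)
  have hw1 : 1 ≤ w := by
    have := Real.log_le_log (by linarith) hl3
    linarith
  have hw5 : w ≤ 5 * Real.log (Real.log |x|) := by
    have e1 : Real.log (3 + |x|) ≤ 2 * Real.log |x| := by
      have : Real.log (|x|^2) = 2 * Real.log |x| := by rw [Real.log_pow]; norm_num
      rw [← this]
      exact Real.log_le_log (by linarith) (by nlinarith)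
    have e2 := Real.log_le_log (by linarith) e1
    rw [Real.log_mul (by norm_num) (by linarith)] at e2
    linarith [Real.log_two_lt_d9]
  have hw0 : 0 < w := by linarith
  have hexpC : 1 ≤ Real.exp C := Real.one_le_exp hC.le
  suffices h : ‖riemannZeta (((1 + η : ℝ) : ℂ) + x * I)‖ ≤ 48 * Real.exp C * w by
    refine h.trans ?_
    nlinarith [mul_le_mul_of_nonneg_left hw5 (show 0 ≤ 48 * Real.exp C by positivity)]
  set s : ℂ := ((1 + η : ℝ) : ℂ) + x * I with hs
  have hsre : s.re = 1 + η := by simp [hs]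
  have hsim : s.im = x := by simp [hs]
  rcases le_or_gt (1/w) η with h | h
  · refine (zeta_Z2 s (by rw [hsre]; linarith) (by rw [hsre]; linarith)).trans ?_
    rw [hsre, add_sub_cancel_left, div_le_iff₀ hη]
    rw [div_le_iff₀ hw0] at h
    nlinarith [mul_pos hη hw0]
  · set s' : ℂ := ((1 + 1/w : ℝ) : ℂ) + x * I with hs'
    have hs're : s'.re = 1 + 1/w := by rw [hs', Complex.add_re, Complex.ofReal_re]; simp
    have hs'im : s'.im = x := by rw [hs', Complex.add_im, Complex.ofReal_im]; simp
    have hwp : 0 < 1/w := by positivity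
    have hwl : 1/w ≤ 1 := by rw [div_le_one hw0]; exact hw1
    obtain ⟨g, hgd, hge⟩ := exists_analytic_log {s | 1/2 < s.re} (half_open _) (convex_halfSpace_re_gt _)
      ⟨1, by show (1/2:ℝ) < (1:ℂ).re; norm_num⟩ zt zt_diff.differentiableOn (fun s hs => hz s hs)
    have hgdd : ∀ z : ℂ, 1/2 < z.re → DifferentiableAt ℂ g z := fun z hz => hgd.differentiableAt ((half_open _).mem_nhds hz)
    have hgder : ∀ z : ℂ, 1/2 < z.re → deriv g z = deriv zt z / zt z := by
      intro z hzz
      have h1 : zt =ᶠ[nhds z] fun z => Complex.exp (g z) := by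
        filter_upwards [(half_open _).mem_nhds hzz] with y hy using (hge y hy).symm
      rw [h1.deriv_eq, (hgdd z hzz).hasDerivAt.cexp.deriv, ← hge z hzz]
      field_simp
    have hseg := Convex.norm_image_sub_le_of_norm_deriv_le (𝕜 := ℂ) (f := g) (C := C * w) (s := segment ℝ s' s) (x := s') (y := s)
      (by
        intro z hzz
        apply hgdd
        obtain ⟨a, b, ha, hb, hab, rfl⟩ := hzz
        simp only [Complex.add_re, Complex.smul_re, smul_eq_mul, hsre, hs're]
        nlinarith [mul_nonneg ha hwp.le, mul_nonneg hb hη.le])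
      (by
        intro z hzz
        obtain ⟨a, b, ha, hb, hab, rfl⟩ := hzz
        have e1 : a • s' + b • s = (((a * (1 + 1/w) + b * (1 + η)) : ℝ) : ℂ) + x * I := by
          apply Complex.ext
          · simp only [Complex.add_re, Complex.smul_re, smul_eq_mul, hsre, hs're, Complex.ofReal_re]; simp
          · simp only [Complex.add_im, Complex.smul_im, smul_eq_mul, hsim, hs'im, Complex.ofReal_im]
            simp
            rw [← add_mul, hab, one_mul]
        have e2 : 1 ≤ a * (1 + 1/w) + b * (1 + η) := by nlinarith [mul_nonneg ha hwp.le, mul_nonneg hb hη.le]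
        have e3 : a * (1 + 1/w) + b * (1 + η) ≤ 1 + 1/w := by nlinarith [mul_nonneg hb (show 0 ≤ 1/w - η by linarith)]
        rw [e1, hgder _ (by rw [Complex.add_re, Complex.ofReal_re, Complex.mul_I_re, Complex.ofReal_im]; linarith)]
        exact h3 hz x w hw1 (by linarith) _ e2 e3)
      (convex_segment _ _) (left_mem_segment _ _ _) (right_mem_segment _ _ _)
    have hd : ‖s - s'‖ ≤ 1/w := by
      have : s - s' = ((η - 1/w : ℝ) : ℂ) := by
        apply Complex.ext
        · rw [Complex.sub_re, hsre, hs're, Complex.ofReal_re]; ring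
        · rw [Complex.sub_im, hsim, hs'im, Complex.ofReal_im]; ring
      rw [this, Complex.norm_real, Real.norm_eq_abs, abs_le]; constructor <;> linarith
    have hgC : ‖g s - g s'‖ ≤ C := by
      refine hseg.trans ?_
      calc C * w * ‖s - s'‖ ≤ C * w * (1/w) := mul_le_mul_of_nonneg_left hd (by positivity)
        _ = C := by field_simp
    have hzz : ‖zt s‖ ≤ Real.exp C * ‖zt s'‖ := by
      rw [← hge s (by show (1/2:ℝ) < s.re; rw [hsre]; linarith), ← hge s' (by show (1/2:ℝ) < s'.re; rw [hs're]; linarith), Complex.norm_exp, Complex.norm_exp, ← Real.exp_add]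
      apply Real.exp_le_exp.mpr
      have := (Complex.re_le_norm (g s - g s')).trans hgC
      rw [Complex.sub_re] at this; linarith
    have hs1 : s ≠ 1 := by intro h; have := congrArg Complex.re h; rw [hsre] at this; simp at this; linarith
    have hs'1 : s' ≠ 1 := by intro h; have := congrArg Complex.re h; rw [hs're] at this; simp at this; linarith
    rw [zt_of_ne hs1, zt_of_ne hs'1, norm_mul, norm_mul] at hzz
    have hn1 : |x| ≤ ‖s - 1‖ := by
      have := Complex.abs_im_le_norm (s - 1)
      rwa [Complex.sub_im, hsim, Complex.one_im, sub_zero] at this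
    have hn2 : ‖s' - 1‖ ≤ 2 * ‖s - 1‖ := by
      have := Complex.norm_le_abs_re_add_abs_im (s' - 1)
      rw [Complex.sub_im, hs'im, Complex.one_im, sub_zero, Complex.sub_re, hs're, Complex.one_re, add_sub_cancel_left, abs_of_pos hwp] at this
      linarith
    have hz2 := zeta_Z2 s' (by rw [hs're]; linarith) (by rw [hs're]; linarith)
    rw [hs're, add_sub_cancel_left] at hz2
    have e24 : 24/(1/w) = 24 * w := by field_simp
    rw [e24] at hz2
    have hpos : 0 < ‖s - 1‖ := by linarith
    have : ‖s - 1‖ * ‖riemannZeta s‖ ≤ ‖s - 1‖ * (48 * Real.exp C * w) := by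
      calc ‖s - 1‖ * ‖riemannZeta s‖ ≤ Real.exp C * (‖s' - 1‖ * ‖riemannZeta s'‖) := hzz
        _ ≤ Real.exp C * (2 * ‖s - 1‖ * (24 * w)) := by
          apply mul_le_mul_of_nonneg_left _ (Real.exp_pos _).le
          exact mul_le_mul hn2 hz2 (norm_nonneg _) (by positivity)
        _ = _ := by ring
    exact le_of_mul_le_mul_left this hpos

theorem zeta_g : ∃ C : ℝ, 0 < C ∧ ∀ (q : ℕ) [NeZero q], 1 < q → dirichletRH (1 : DirichletCharacter ℂ q) →
    ∀ x η : ℝ, 1 / Real.log q ≤ η → η ≤ 1 → ‖riemannZeta (((1 + η : ℝ) : ℂ) + x * I)‖ ≤ C * gfun q |x| := by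
  obtain ⟨C, hC, h3⟩ := zeta_Z3
  refine ⟨C + 132, by positivity, ?_⟩
  intro q _ hq hRH x η hη hη1
  have hlq : 0 < Real.log q := Real.log_pos (by exact_mod_cast hq)
  have hη0 : 0 < η := lt_of_lt_of_le (by positivity) hη
  set s : ℂ := ((1 + η : ℝ) : ℂ) + x * I with hs
  have hsre : s.re = 1 + η := by simp [hs]
  have hsim : s.im = x := by simp [hs]
  have hsn : ‖s - 1‖ ≥ |x| := by
    have := Complex.abs_im_le_norm (s - 1)
    rwa [Complex.sub_im, hsim, Complex.one_im, sub_zero] at this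
  rw [gfun]
  split_ifs with h1 h2
  · refine (zeta_Z2 s (by rw [hsre]; linarith) (by rw [hsre]; linarith)).trans ?_
    rw [hsre, add_sub_cancel_left, div_le_iff₀ hη0]
    rw [div_le_iff₀ hlq] at hη
    nlinarith [mul_pos hη0 hlq]
  · push Not at h1
    have hx : 0 < |x| := lt_of_le_of_lt (by positivity) h1.1
    refine (zeta_Z1 s (by rw [hsre]; linarith) (by
      have := Complex.norm_le_abs_re_add_abs_im s
      rw [hsre, hsim, abs_of_pos (by linarith)] at this
      linarith)).trans ?_
    have e1 : 12 / ‖s - 1‖ ≤ 12 / |x| := div_le_div_of_nonneg_left (by norm_num) hx hsn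
    have e2 : 12 ≤ 120 / |x| := by rw [le_div_iff₀ hx]; linarith
    have e3 : 0 ≤ C * (1/|x|) := by positivity
    have e4 : (C + 132) * (1/|x|) = C * (1/|x|) + 12/|x| + 120/|x| := by ring
    rw [e4]; linarith
  · push Not at h2
    refine (h3 (fun s hs => zt_RH hRH hs) x η h2.le hη0 hη1).trans ?_
    have hl : 2 ≤ Real.log |x| := by
      rw [Real.le_log_iff_exp_le (by linarith)]
      have e2 : Real.exp 2 = Real.exp 1 ^ 2 := by rw [← Real.exp_nat_mul]; norm_num
      have e4 : Real.exp 1 ^ 2 ≤ (2.8:ℝ)^2 := pow_le_pow_left₀ (Real.exp_pos 1).le (by linarith [Real.exp_one_lt_d9]) 2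
      rw [e2]; norm_num at e4; linarith
    have : 0 ≤ Real.log (Real.log |x|) := Real.log_nonneg (by linarith)
    nlinarith


lemma prime_term_bound (p : Nat.Primes) (s : ℂ) (hs : 1 < s.re) :
    ‖-Complex.log (1 - (p : ℂ) ^ (-s)) - (p : ℂ) ^ (-s)‖ ≤ ((p : ℕ) : ℝ) ^ (-2 : ℝ) := by
  have hp : 2 ≤ ((p : ℕ) : ℝ) := by exact_mod_cast p.2.two_le
  have hp0 : 0 < ((p : ℕ) : ℝ) := by linarith
  set z := (p : ℂ) ^ (-s) with hz
  have hn : ‖z‖ = ((p : ℕ) : ℝ) ^ (-s.re) := by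
    rw [hz, Complex.norm_natCast_cpow_of_pos p.2.pos]; simp
  have h1 : ‖z‖ ≤ ((p : ℕ) : ℝ) ^ (-1 : ℝ) := by
    rw [hn]; exact Real.rpow_le_rpow_of_exponent_le (by linarith) (by linarith)
  have h2 : ‖z‖ ≤ 1/2 := by
    refine h1.trans ?_
    rw [Real.rpow_neg_one, one_div]
    exact inv_anti₀ (by norm_num) hp
  have h3 : -Complex.log (1 - z) = Complex.log (1 - z)⁻¹ := by
    rw [Complex.log_inv]
    intro h
    have : 0 < (1 - z).re := by
      rw [Complex.sub_re, Complex.one_re]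
      have := Complex.re_le_norm z
      linarith
    rw [Complex.arg_eq_pi_iff] at h
    linarith [h.1]
  rw [h3]
  refine (Complex.norm_log_one_sub_inv_sub_self_le (by linarith)).trans ?_
  have h4 : (1 - ‖z‖)⁻¹ ≤ 2 := by
    rw [inv_le_comm₀ (by linarith) (by norm_num)]; linarith
  have h5 : ((p : ℕ) : ℝ) ^ (-2 : ℝ) = (((p : ℕ) : ℝ) ^ (-1 : ℝ))^2 := by
    rw [← Real.rpow_natCast, ← Real.rpow_mul hp0.le]; norm_num
  rw [h5]
  have h6 : ‖z‖^2 ≤ (((p : ℕ) : ℝ) ^ (-1 : ℝ))^2 := by gcongr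
  have h7 : ‖z‖^2 * (1 - ‖z‖)⁻¹ ≤ ‖z‖^2 * 2 := mul_le_mul_of_nonneg_left h4 (by positivity)
  linarith

lemma prime_summable (s : ℂ) (hs : 1 < s.re) : Summable fun p : Nat.Primes => (p : ℂ) ^ (-s) := by
  apply Summable.of_norm
  have : (fun p : Nat.Primes => ‖(p : ℂ) ^ (-s)‖) = fun p : Nat.Primes => ((p : ℕ) : ℝ) ^ (-s.re) := by
    funext p
    rw [Complex.norm_natCast_cpow_of_pos p.2.pos]; simp
  rw [this, Nat.Primes.summable_rpow]; linarith

lemma prime_re_sum : ∃ C : ℝ, 0 < C ∧ ∀ s : ℂ, 1 < s.re →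
    riemannZeta s ≠ 0 ∧ ∑' p : Nat.Primes, ((p : ℂ) ^ (-s)).re ≤ Real.log ‖riemannZeta s‖ + C := by
  have hS : Summable fun p : Nat.Primes => ((p : ℕ) : ℝ) ^ (-2 : ℝ) := by
    rw [Nat.Primes.summable_rpow]; norm_num
  refine ⟨1 + ∑' p : Nat.Primes, ((p : ℕ) : ℝ) ^ (-2 : ℝ), ?_, ?_⟩
  · have : 0 ≤ ∑' p : Nat.Primes, ((p : ℕ) : ℝ) ^ (-2 : ℝ) := tsum_nonneg fun p => by positivity
    linarith
  intro s hs
  have hA := prime_summable s hs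
  have hD : Summable fun p : Nat.Primes => (-Complex.log (1 - (p : ℂ) ^ (-s)) - (p : ℂ) ^ (-s)) :=
    Summable.of_norm_bounded hS (fun p => prime_term_bound p s hs)
  have hL : Summable fun p : Nat.Primes => -Complex.log (1 - (p : ℂ) ^ (-s)) := by
    have := hD.add hA
    simpa using this
  have hE := riemannZeta_eulerProduct_exp_log hs
  refine ⟨by rw [← hE]; exact Complex.exp_ne_zero _, ?_⟩
  rw [← hE, Complex.norm_exp, Real.log_exp]
  have e1 : ∑' p : Nat.Primes, ((p : ℂ) ^ (-s)).re = (∑' p : Nat.Primes, ((p : ℂ) ^ (-s))).re :=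
    (Complex.re_tsum hA).symm
  have e2 : ∑' p : Nat.Primes, (-Complex.log (1 - (p : ℂ) ^ (-s)) - (p : ℂ) ^ (-s))
      = ∑' p : Nat.Primes, -Complex.log (1 - (p : ℂ) ^ (-s)) - ∑' p : Nat.Primes, (p : ℂ) ^ (-s) :=
    hL.tsum_sub hA
  have e3 : ‖∑' p : Nat.Primes, (-Complex.log (1 - (p : ℂ) ^ (-s)) - (p : ℂ) ^ (-s))‖
      ≤ ∑' p : Nat.Primes, ((p : ℕ) : ℝ) ^ (-2 : ℝ) :=
    tsum_of_norm_bounded hS.hasSum (fun p => prime_term_bound p s hs)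
  rw [e2] at e3
  have e4 := (Complex.abs_re_le_norm _).trans e3
  rw [Complex.sub_re] at e4
  rw [e1]
  linarith [(abs_le.1 e4).1]

lemma gfun_pos (q : ℕ) (hq : 1 < q) (x : ℝ) (hx : 0 ≤ x) : 1/10 ≤ gfun q x := by
  have hl2 : (1/2:ℝ) < Real.log 2 := by have := Real.log_two_gt_d9; linarith
  have hlq : Real.log 2 ≤ Real.log q := Real.log_le_log (by norm_num) (by exact_mod_cast hq)
  unfold gfun
  split_ifs with h1 h2
  · linarith
  · push Not at h1
    have : 0 < 1 / Real.log q := by apply div_pos <;> linarith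
    rw [div_le_div_iff₀ (by norm_num) (by linarith)]; linarith
  · push Not at h2
    have h8 : Real.exp 2 ≤ 10 := by
      have : Real.exp 2 = (Real.exp 1)^2 := by rw [← Real.exp_nat_mul]; norm_num
      rw [this]; nlinarith [Real.exp_one_lt_d9, Real.exp_pos 1]
    have : 2 ≤ Real.log x := by
      rw [Real.le_log_iff_exp_le (by linarith)]; linarith
    have := Real.log_le_log (by norm_num) this
    linarith

lemma prime_sq_expand {ι : Type*} [Fintype ι] (a t : ι → ℝ) (σ : ℝ) (p : Nat.Primes) :
    ‖∑ j, (a j : ℂ) * (p : ℂ) ^ (-(t j : ℂ) * I)‖^2 * ((p : ℕ) : ℝ) ^ (-σ)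
      = ∑ i, ∑ j, a i * a j * ((p : ℂ) ^ (-((σ : ℂ) + ((t i - t j : ℝ) : ℂ) * I))).re := by
  have hp : ((p : ℕ) : ℂ) ≠ 0 := by exact_mod_cast p.2.ne_zero
  have h1 : (((‖∑ j, (a j : ℂ) * (p : ℂ) ^ (-(t j : ℂ) * I)‖^2 * ((p : ℕ) : ℝ) ^ (-σ) : ℝ)) : ℂ)
      = ∑ i, ∑ j, (a i : ℂ) * a j * ((p : ℂ) ^ (-((σ : ℂ) + ((t i - t j : ℝ) : ℂ) * I))) := by
    push_cast
    rw [← Complex.mul_conj', Complex.ofReal_cpow (by positivity), map_sum, Finset.sum_mul_sum, Finset.sum_mul]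
    refine Finset.sum_congr rfl fun i _ => ?_
    rw [Finset.sum_mul]
    refine Finset.sum_congr rfl fun j _ => ?_
    have hc : (starRingEnd ℂ) ((p : ℂ) ^ (-(t j : ℂ) * I)) = (p : ℂ) ^ ((t j : ℂ) * I) := by
      have h := Complex.cpow_conj ((p : ℕ) : ℂ) (-(t j : ℂ) * I) (by rw [Complex.natCast_arg]; exact Real.pi_ne_zero.symm)
      rw [Complex.conj_natCast] at h
      rw [← h]
      simp
    rw [map_mul, Complex.conj_ofReal, hc]
    have : (-((σ : ℂ) + ((t i : ℂ) - (t j : ℂ)) * I)) = (-(t i : ℂ) * I) + ((t j : ℂ) * I) + (-σ : ℂ) := by ring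
    rw [this, Complex.cpow_add _ _ hp, Complex.cpow_add _ _ hp]
    push_cast
    ring
  have h2 := congrArg Complex.re h1
  rw [Complex.ofReal_re] at h2
  rw [h2, Complex.re_sum]
  refine Finset.sum_congr rfl fun i _ => ?_
  rw [Complex.re_sum]
  refine Finset.sum_congr rfl fun j _ => ?_
  rw [← Complex.ofReal_mul, Complex.re_ofReal_mul]

/-- the target size -/
noncomputable def Wq {n : ℕ} (a t : Fin n → ℝ) (q : ℕ) : ℝ :=
  Real.log q ^ ((∑ j, (a j) ^ 2) / 4) *
        ∏ i, ∏ j, if i < j then gfun q |t i - t j| ^ (a i * a j / 2) else 1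

lemma sum_sym {n : ℕ} (F : Fin n → Fin n → ℝ) (h : ∀ i j, F i j = F j i) :
    ∑ i, ∑ j, F i j = ∑ i, F i i + 2 * ∑ i, ∑ j, if i < j then F i j else 0 := by
  have h1 : ∀ i j, F i j = (if i = j then F i j else 0) + (if i < j then F i j else 0) + (if j < i then F i j else 0) := by
    intro i j
    rcases lt_trichotomy i j with h | h | h
    · simp [h, h.ne, h.not_gt]
    · simp [h]
    · simp [h, h.ne', h.not_gt]
  have h2 : ∑ i, ∑ j, (if j < i then F i j else 0) = ∑ i, ∑ j, if i < j then F i j else 0 := by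
    rw [Finset.sum_comm]
    refine Finset.sum_congr rfl fun i _ => Finset.sum_congr rfl fun j _ => ?_
    rw [h]
  calc ∑ i, ∑ j, F i j = ∑ i, ∑ j, ((if i = j then F i j else 0) + (if i < j then F i j else 0) + (if j < i then F i j else 0)) :=
        Finset.sum_congr rfl fun i _ => Finset.sum_congr rfl fun j _ => h1 i j
    _ = _ := by
      simp only [Finset.sum_add_distrib]
      rw [h2]
      simp
      ring

lemma Wq_eq_exp {n : ℕ} (a t : Fin n → ℝ) (q : ℕ) (hq : 1 < q) :
    Wq a t q = Real.exp (1/4 * ∑ i, ∑ j, a i * a j * Real.log (gfun q |t i - t j|)) := by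
  have hg : ∀ x : ℝ, 0 < gfun q |x| := fun x => lt_of_lt_of_le (by norm_num) (gfun_pos q hq |x| (abs_nonneg x))
  have hlq : 0 < Real.log q := Real.log_pos (by exact_mod_cast hq)
  rw [sum_sym _ (fun i j => by rw [abs_sub_comm, mul_comm (a i)])]
  rw [mul_add, Real.exp_add]
  unfold Wq
  congr 1
  · rw [Real.rpow_def_of_pos hlq]
    congr 1
    have : gfun q 0 = Real.log q := by
      unfold gfun; rw [if_pos]; left; positivity
    simp only [sub_self, abs_zero, this]
    rw [← Finset.sum_mul, Finset.sum_congr rfl fun i _ => (pow_two (a i))]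
    ring
  · rw [← mul_assoc, Finset.mul_sum, Real.exp_sum]
    refine Finset.prod_congr rfl fun i _ => ?_
    rw [Finset.mul_sum, Real.exp_sum]
    refine Finset.prod_congr rfl fun j _ => ?_
    split_ifs with h
    · rw [Real.rpow_def_of_pos (hg _)]; congr 1; ring
    · simp

theorem var_bound {n : ℕ} (a : Fin n → ℝ) (ha : ∀ j, 0 < a j) : ∃ C : ℝ, 0 < C ∧ ∀ (q : ℕ) [NeZero q], 1 < q →
    dirichletRH (1 : DirichletCharacter ℂ q) → ∀ (t : Fin n → ℝ) (η : ℝ), 1 / Real.log q ≤ η → η ≤ 1 →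
    ∀ P : Finset ℕ, (∀ p ∈ P, p.Prime) →
    Real.exp (1/4 * ∑ p ∈ P, ‖∑ j, (a j : ℂ) * (p : ℂ) ^ (-(t j : ℂ) * I)‖^2 * (p : ℝ) ^ (-(1+η))) ≤ C * Wq a t q := by
  obtain ⟨C1, hC1, h1⟩ := prime_re_sum
  obtain ⟨C2, hC2, h2⟩ := zeta_g
  refine ⟨Real.exp (1/4 * ∑ i, ∑ j, a i * a j * (Real.log C2 + C1)), Real.exp_pos _, ?_⟩
  intro q _ hq hRH t η hη hη1 P hP
  have hlq : 0 < Real.log q := Real.log_pos (by exact_mod_cast hq)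
  have hη0 : 0 < η := lt_of_lt_of_le (by positivity) hη
  rw [Wq_eq_exp a t q hq, ← Real.exp_add, Real.exp_le_exp, ← mul_add, ← Finset.sum_add_distrib]
  refine mul_le_mul_of_nonneg_left ?_ (by norm_num)
  have hre : ∀ i j, ((((1 + η : ℝ) : ℂ) + ((t i - t j : ℝ) : ℂ) * I)).re = 1 + η := by
    intro i j
    rw [Complex.add_re, Complex.ofReal_re, Complex.mul_I_re, Complex.ofReal_im]; ring
  have hsum : ∀ i j, Summable fun p : Nat.Primes => ((p : ℂ) ^ (-(((1 + η : ℝ) : ℂ) + ((t i - t j : ℝ) : ℂ) * I))).re := by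
    intro i j
    have := prime_summable (((1 + η : ℝ) : ℂ) + ((t i - t j : ℝ) : ℂ) * I) (by rw [hre]; linarith)
    exact (Complex.hasSum_re this.hasSum).summable
  have hsum2 : Summable fun p : Nat.Primes => ‖∑ j, (a j : ℂ) * (p : ℂ) ^ (-(t j : ℂ) * I)‖^2 * ((p : ℕ) : ℝ) ^ (-(1+η)) := by
    simp_rw [prime_sq_expand]
    exact summable_sum fun i _ => summable_sum fun j _ => (hsum i j).mul_left _
  calc ∑ p ∈ P, ‖∑ j, (a j : ℂ) * (p : ℂ) ^ (-(t j : ℂ) * I)‖^2 * (p : ℝ) ^ (-(1+η))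
      = ∑ p ∈ P.subtype Nat.Prime, ‖∑ j, (a j : ℂ) * ((p : ℕ) : ℂ) ^ (-(t j : ℂ) * I)‖^2 * ((p : ℕ) : ℝ) ^ (-(1+η)) := by
        rw [Finset.sum_subtype_of_mem (f := fun p : ℕ => ‖∑ j, (a j : ℂ) * (p : ℂ) ^ (-(t j : ℂ) * I)‖^2 * (p : ℝ) ^ (-(1+η))) hP]
    _ ≤ ∑' p : Nat.Primes, ‖∑ j, (a j : ℂ) * (p : ℂ) ^ (-(t j : ℂ) * I)‖^2 * ((p : ℕ) : ℝ) ^ (-(1+η)) :=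
        hsum2.sum_le_tsum (ι := Nat.Primes) (P.subtype Nat.Prime) (fun p _ => by positivity)
    _ = ∑ i, ∑ j, a i * a j * ∑' p : Nat.Primes, ((p : ℂ) ^ (-(((1 + η : ℝ) : ℂ) + ((t i - t j : ℝ) : ℂ) * I))).re := by
        simp_rw [prime_sq_expand]
        rw [Summable.tsum_finsetSum fun i _ => summable_sum fun j _ => (hsum i j).mul_left _]
        refine Finset.sum_congr rfl fun i _ => ?_
        rw [Summable.tsum_finsetSum fun j _ => (hsum i j).mul_left _]
        exact Finset.sum_congr rfl fun j _ => tsum_mul_left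
    _ ≤ _ := by
        refine Finset.sum_le_sum fun i _ => ?_
        rw [← Finset.sum_add_distrib]
        refine Finset.sum_le_sum fun j _ => ?_
        rw [← mul_add]
        refine mul_le_mul_of_nonneg_left ?_ (mul_pos (ha i) (ha j)).le
        obtain ⟨hne, hle⟩ := h1 (((1 + η : ℝ) : ℂ) + ((t i - t j : ℝ) : ℂ) * I) (by rw [hre]; linarith)
        refine hle.trans ?_
        have hz := h2 q hq hRH (t i - t j) η hη hη1
        have hg : 0 < gfun q |t i - t j| := lt_of_lt_of_le (by norm_num) (gfun_pos q hq _ (abs_nonneg _))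
        have := Real.log_le_log (norm_pos_iff.2 hne) hz
        rw [Real.log_mul hC2.ne' hg.ne'] at this
        linarith


lemma pp_split : ∃ C : ℝ, 0 < C ∧ ∀ (F : ℕ → ℂ) (B x : ℝ), 0 ≤ B → 1 ≤ x → (∀ n, ¬ IsPrimePow n → F n = 0) →
    (∀ n, 1 ≤ n → ‖F n‖ ≤ B * (n : ℝ) ^ (-(1/2) : ℝ)) →
    ‖∑ n ∈ Finset.range (⌊x⌋₊ + 1), F n -
      ∑ p ∈ (Finset.range (⌊x⌋₊ + 1)).filter Nat.Prime, (F p + if (p : ℝ)^2 ≤ x then F (p^2) else 0)‖ ≤ C * B := by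
  have hZ : Summable fun n : ℕ => (n : ℝ) ^ (-(3/2) : ℝ) := by
    rw [Real.summable_nat_rpow]; norm_num
  set r : ℝ := (2 : ℝ) ^ (-(1/2) : ℝ) with hr
  have hr0 : 0 < r := by positivity
  have hr1 : r < 1 := Real.rpow_lt_one_of_one_lt_of_neg (by norm_num) (by norm_num)
  have hG : Summable fun k : ℕ => r ^ k := summable_geometric_of_lt_one hr0.le hr1
  set Z := ∑' n : ℕ, (n : ℝ) ^ (-(3/2) : ℝ) with hZd
  set G := ∑' k : ℕ, r ^ k with hGd
  have hZ0 : 0 ≤ Z := tsum_nonneg fun n => by positivity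
  have hG0 : 0 ≤ G := tsum_nonneg fun n => by positivity
  refine ⟨1 + (r⁻¹)^3 * G * Z, by positivity, ?_⟩
  intro F B x hB hx hF0 hFb
  have e1 : ∑ n ∈ Finset.range (⌊x⌋₊ + 1), F n = ∑ n ∈ Ioc 0 ⌊x⌋₊ with IsPrimePow n, F n := by
    symm
    apply Finset.sum_subset
    · intro n hn
      simp only [Finset.mem_filter, Finset.mem_Ioc] at hn
      simp only [Finset.mem_range]; omega
    · intro n hn hn2
      apply hF0
      intro h
      apply hn2
      simp only [Finset.mem_filter, Finset.mem_Ioc]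
      simp only [Finset.mem_range] at hn
      exact ⟨⟨h.pos, by omega⟩, h⟩
  set N := ⌊Real.log x / Real.log 2⌋₊ + 2 with hN
  rw [e1, Chebyshev.sum_PrimePow_eq_sum_sum' F (by linarith) (show _ ≤ N by omega)]
  have e2 : Finset.Icc 1 N = insert 1 (insert 2 (Finset.Icc 3 N)) := by
    ext k; simp only [Finset.mem_Icc, Finset.mem_insert]; omega
  rw [e2, Finset.sum_insert (by simp), Finset.sum_insert (by simp)]
  have hfilt : ∀ n : ℕ, (Ioc 0 n).filter Nat.Prime = (Finset.range (n+1)).filter Nat.Prime := by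
    intro n; ext p; simp only [Finset.mem_filter, Finset.mem_Ioc, Finset.mem_range]
    constructor
    · rintro ⟨h, h'⟩; exact ⟨by omega, h'⟩
    · rintro ⟨h, h'⟩; exact ⟨⟨h'.pos, by omega⟩, h'⟩
  have e3 : ∑ p ∈ Ioc 0 ⌊x ^ ((1 : ℝ) / (1 : ℕ))⌋₊ with p.Prime, F (p ^ 1)
      = ∑ p ∈ (Finset.range (⌊x⌋₊ + 1)).filter Nat.Prime, F p := by
    rw [hfilt]; simp
  have e4 : ∑ p ∈ Ioc 0 ⌊x ^ ((1 : ℝ) / (2 : ℕ))⌋₊ with p.Prime, F (p ^ 2)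
      = ∑ p ∈ (Finset.range (⌊x⌋₊ + 1)).filter Nat.Prime, if (p : ℝ)^2 ≤ x then F (p^2) else 0 := by
    rw [← Finset.sum_filter, Finset.filter_filter]
    apply Finset.sum_congr _ fun _ _ => rfl
    ext p
    simp only [Finset.mem_filter, Finset.mem_Ioc, Finset.mem_range]
    have hsq : p ≤ ⌊x ^ ((1 : ℝ) / (2 : ℕ))⌋₊ ↔ (p : ℝ)^2 ≤ x := by
      rw [Nat.le_floor_iff (by positivity)]
      have : x ^ ((1 : ℝ) / (2 : ℕ)) = √x := by rw [Real.sqrt_eq_rpow]; norm_num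
      rw [this, Real.le_sqrt (by positivity) (by linarith)]
    constructor
    · rintro ⟨⟨h1, h2⟩, h3⟩
      have h4 := hsq.1 h2
      refine ⟨?_, h3, h4⟩
      have : p ≤ ⌊x⌋₊ := by
        rw [Nat.le_floor_iff (by linarith)]
        have : (1:ℝ) ≤ p := by exact_mod_cast h1
        nlinarith
      omega
    · rintro ⟨h1, h2, h3⟩
      exact ⟨⟨h2.pos, hsq.2 h3⟩, h2⟩
  rw [e3, e4, Finset.sum_add_distrib]
  have e5 : ∀ u v w : ℂ, u + (v + w) - (u + v) = w := by intros; ring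
  rw [e5]
  calc ‖∑ k ∈ Finset.Icc 3 N, ∑ p ∈ Ioc 0 ⌊x ^ ((1 : ℝ) / k)⌋₊ with p.Prime, F (p ^ k)‖
      ≤ ∑ k ∈ Finset.Icc 3 N, ‖∑ p ∈ Ioc 0 ⌊x ^ ((1 : ℝ) / k)⌋₊ with p.Prime, F (p ^ k)‖ := norm_sum_le _ _
    _ ≤ ∑ k ∈ Finset.Icc 3 N, (B * (r⁻¹)^3 * Z) * r ^ k := by
        refine Finset.sum_le_sum fun k hk => ?_
        have hk3 : 3 ≤ k := (Finset.mem_Icc.1 hk).1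
        calc ‖∑ p ∈ Ioc 0 ⌊x ^ ((1 : ℝ) / k)⌋₊ with p.Prime, F (p ^ k)‖
            ≤ ∑ p ∈ Ioc 0 ⌊x ^ ((1 : ℝ) / k)⌋₊ with p.Prime, ‖F (p ^ k)‖ := norm_sum_le _ _
          _ ≤ ∑ p ∈ Ioc 0 ⌊x ^ ((1 : ℝ) / k)⌋₊ with p.Prime, (B * (r⁻¹)^3 * r^k) * (p : ℝ) ^ (-(3/2) : ℝ) := by
              refine Finset.sum_le_sum fun p hp => ?_
              have hpp := (Finset.mem_filter.1 hp).2
              refine (hFb _ (Nat.one_le_iff_ne_zero.2 (pow_ne_zero _ hpp.ne_zero))).trans ?_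
              have hp0 : (0:ℝ) < p := by exact_mod_cast hpp.pos
              have hp2 : (2:ℝ) ≤ p := by exact_mod_cast hpp.two_le
              have h1 : ((p ^ k : ℕ) : ℝ) ^ (-(1/2) : ℝ) = ((p : ℝ) ^ (-(1/2) : ℝ)) ^ (k-3) * ((p : ℝ) ^ (-(1/2) : ℝ)) ^ 3 := by
                rw [← pow_add, Nat.sub_add_cancel hk3]
                push_cast
                rw [← Real.rpow_natCast, ← Real.rpow_mul hp0.le, mul_comm, Real.rpow_mul hp0.le, Real.rpow_natCast]
              have h2 : ((p : ℝ) ^ (-(1/2) : ℝ)) ^ 3 = (p : ℝ) ^ (-(3/2) : ℝ) := by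
                rw [← Real.rpow_natCast, ← Real.rpow_mul hp0.le]; norm_num
              have h3 : (p : ℝ) ^ (-(1/2) : ℝ) ≤ r := Real.rpow_le_rpow_of_nonpos (by norm_num) hp2 (by norm_num)
              have h4 : ((p : ℝ) ^ (-(1/2) : ℝ)) ^ (k-3) ≤ r ^ (k-3) := pow_le_pow_left₀ (by positivity) h3 _
              have h5 : r ^ (k-3) = (r⁻¹)^3 * r^k := by
                have : r^k = r^(k-3) * r^3 := by rw [← pow_add, Nat.sub_add_cancel hk3]
                rw [this]; field_simp
              rw [h1, h2]
              calc B * (((p : ℝ) ^ (-(1/2) : ℝ)) ^ (k-3) * (p : ℝ) ^ (-(3/2) : ℝ))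
                  ≤ B * (r ^ (k-3) * (p : ℝ) ^ (-(3/2) : ℝ)) := by
                    apply mul_le_mul_of_nonneg_left _ hB
                    exact mul_le_mul_of_nonneg_right h4 (by positivity)
                _ = _ := by rw [h5]; ring
          _ = (B * (r⁻¹)^3 * r^k) * ∑ p ∈ Ioc 0 ⌊x ^ ((1 : ℝ) / k)⌋₊ with p.Prime, (p : ℝ) ^ (-(3/2) : ℝ) := by
              rw [Finset.mul_sum]
          _ ≤ (B * (r⁻¹)^3 * r^k) * Z := by
              apply mul_le_mul_of_nonneg_left _ (by positivity)
              exact hZ.sum_le_tsum _ (fun n _ => by positivity)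
          _ = _ := by ring
    _ = (B * (r⁻¹)^3 * Z) * ∑ k ∈ Finset.Icc 3 N, r ^ k := by rw [Finset.mul_sum]
    _ ≤ (B * (r⁻¹)^3 * Z) * G := by
        apply mul_le_mul_of_nonneg_left _ (by positivity)
        exact hG.sum_le_tsum _ (fun n _ => by positivity)
    _ ≤ _ := by nlinarith

/-- prime coefficients -/
noncomputable def cc {n : ℕ} (a t : Fin n → ℝ) (x : ℝ) (p : ℕ) : ℂ :=
  (∑ j, (a j : ℂ) * (p : ℂ) ^ (-(t j : ℂ) * I)) * (p : ℂ) ^ (-(1/2 + ((8 * kapm / Real.log x : ℝ) : ℂ))) * wx (Real.log x) p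

/-- prime square coefficients -/
noncomputable def dd {n : ℕ} (a t : Fin n → ℝ) (x : ℝ) (p : ℕ) : ℂ :=
  if (p : ℝ)^2 ≤ x then
  (1/2) * (∑ j, (a j : ℂ) * ((p^2 : ℕ) : ℂ) ^ (-(t j : ℂ) * I)) * ((p^2 : ℕ) : ℂ) ^ (-(1/2 + ((8 * kapm / Real.log x : ℝ) : ℂ))) * wx (Real.log x) (p^2)
  else 0

lemma asum_norm {n : ℕ} (a t : Fin n → ℝ) (ha : ∀ j, 0 < a j) (m : ℕ) (hm : 0 < m) :
    ‖∑ j, (a j : ℂ) * (m : ℂ) ^ (-(t j : ℂ) * I)‖ ≤ ∑ j, a j := by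
  refine (norm_sum_le _ _).trans (Finset.sum_le_sum fun j _ => ?_)
  rw [norm_mul, Complex.norm_natCast_cpow_of_pos hm, Complex.norm_real, Real.norm_eq_abs, abs_of_pos (ha j)]
  simp

lemma cc_norm {n : ℕ} (a t : Fin n → ℝ) (x : ℝ) (p : ℕ) (hp : 0 < p) :
    ‖cc a t x p‖ ≤ ‖∑ j, (a j : ℂ) * (p : ℂ) ^ (-(t j : ℂ) * I)‖ * (p : ℝ) ^ (-(1/2 + 8 * kapm / Real.log x)) := by
  unfold cc
  rw [norm_mul, norm_mul, Complex.norm_natCast_cpow_of_pos hp]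
  have : (-(1/2 + ((8 * kapm / Real.log x : ℝ) : ℂ))).re = -(1/2 + 8 * kapm / Real.log x) := by
    rw [Complex.neg_re, Complex.add_re, Complex.ofReal_re]; norm_num
  rw [this]
  calc _ ≤ ‖∑ j, (a j : ℂ) * (p : ℂ) ^ (-(t j : ℂ) * I)‖ * (p : ℝ) ^ (-(1/2 + 8 * kapm / Real.log x)) * 1 :=
        mul_le_mul_of_nonneg_left (wx_norm _ _ hp.ne') (by positivity)
    _ = _ := mul_one _

lemma dd_norm {n : ℕ} (a t : Fin n → ℝ) (ha : ∀ j, 0 < a j) (x : ℝ) (hx : 1 < x) (p : ℕ) (hp : 0 < p) :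
    ‖dd a t x p‖ ≤ (∑ j, a j) / p := by
  have hS : 0 ≤ ∑ j, a j := Finset.sum_nonneg fun j _ => (ha j).le
  have hp1 : (1:ℝ) ≤ p := by exact_mod_cast hp
  unfold dd
  split_ifs
  · have hp2 : 0 < p^2 := by positivity
    rw [norm_mul, norm_mul, norm_mul, Complex.norm_natCast_cpow_of_pos hp2]
    have : (-(1/2 + ((8 * kapm / Real.log x : ℝ) : ℂ))).re = -(1/2 + 8 * kapm / Real.log x) := by
      rw [Complex.neg_re, Complex.add_re, Complex.ofReal_re]; norm_num
    rw [this]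
    have hk := kapm_ge
    have hl := Real.log_pos hx
    have h0 : 0 < 8 * kapm / Real.log x := by positivity
    have h1 : ((p^2 : ℕ) : ℝ) ^ (-(1/2 + 8 * kapm / Real.log x)) ≤ 1 / p := by
      calc ((p^2 : ℕ) : ℝ) ^ (-(1/2 + 8 * kapm / Real.log x)) ≤ ((p^2 : ℕ) : ℝ) ^ (-(1/2) : ℝ) := by
            apply Real.rpow_le_rpow_of_exponent_le
            · push_cast; nlinarith
            · linarith
        _ = 1 / p := by
            push_cast
            rw [← Real.rpow_natCast, ← Real.rpow_mul (by linarith)]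
            norm_num
            rw [Real.rpow_neg_one]
    have h2 := asum_norm a t ha (p^2) hp2
    have h3 := wx_norm (Real.log x) (p^2) hp2.ne'
    have h4 : ‖(1/2 : ℂ)‖ ≤ 1 := by norm_num
    calc _ ≤ 1 * (∑ j, a j) * (1 / p) * 1 := by gcongr
      _ = _ := by ring
  · simp; positivity

theorem log_prod_bound {n : ℕ} (a : Fin n → ℝ) (ha : ∀ j, 0 < a j) (A : ℝ) (hA : 0 < A) : ∃ C0 C' : ℝ, 0 < C0 ∧ 0 < C' ∧
    ∀ (q : ℕ) [NeZero q], 1 < q → ∀ χ : DirichletCharacter ℂ q, χ ≠ 1 → dirichletRH χ →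
    ∀ t : Fin n → ℝ, (∀ j, |t j| ≤ (q : ℝ) ^ A) → ∀ x : ℝ, 1 < x → 40 * (8 * kapm) ≤ Real.log x →
    ∏ j, ‖DirichletCharacter.LFunction χ (1 / 2 + (t j) * Complex.I)‖ ^ (a j) ≤
      Real.exp (∑ p ∈ (Finset.range (⌊x⌋₊ + 1)).filter Nat.Prime, (cc a t x p * χ p + dd a t x p * (χ p)^2).re
        + C0 + C' * Real.log q / Real.log x) := by
  obtain ⟨C1, hC1, h1⟩ := pp_split
  obtain ⟨C2, hC2, h2⟩ := pointwise_bound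
  set S := ∑ j, a j with hSdef
  have hS : 0 ≤ S := Finset.sum_nonneg fun j _ => (ha j).le
  refine ⟨C1 * S + 1, S * C2 * (A + 3) + 1, by positivity, by positivity, ?_⟩
  intro q _ hq χ hχ hRH t ht x hx1 hx
  have hl := Real.log_pos hx1
  have hk := kapm_ge
  have hlq : 0 < Real.log q := Real.log_pos (by exact_mod_cast hq)
  have hq2 : (2:ℝ) ≤ q := by exact_mod_cast hq
  set η : ℝ := 8 * kapm / Real.log x with hη
  have hη0 : 0 < η := by positivity
  set F : ℕ → ℂ := fun m => ∑ j, (a j : ℂ) * (LSeries.term (lcf χ) (1/2 + (η : ℂ) + t j * I) m * wx (Real.log x) m) with hF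
  have hre : ∀ j, (1/2 + (η : ℂ) + t j * I).re = 1/2 + η := by intro j; simp
  have hlog : ∀ j, Real.log (q * (2 + |t j|)) ≤ (A + 3) * Real.log q := by
    intro j
    have hqA : 1 ≤ (q:ℝ)^A := Real.one_le_rpow (by linarith) hA.le
    have : (q:ℝ) * (2 + |t j|) ≤ (q:ℝ) ^ (A + 3) := by
      rw [Real.rpow_add (by linarith)]
      have h3 : (q:ℝ)^(3:ℝ) = q * (q*q) := by
        rw [show (3:ℝ) = ((3:ℕ):ℝ) by norm_num, Real.rpow_natCast]; ring
      rw [h3]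
      have h4 : 2 + |t j| ≤ 3 * (q:ℝ)^A := by linarith [ht j]
      have h5 : (3:ℝ) ≤ q * q := by nlinarith
      calc (q:ℝ) * (2 + |t j|) ≤ q * (3 * (q:ℝ)^A) := mul_le_mul_of_nonneg_left h4 (by linarith)
        _ = (q * (q:ℝ)^A) * 3 := by ring
        _ ≤ (q * (q:ℝ)^A) * (q * q) := mul_le_mul_of_nonneg_left h5 (by positivity)
        _ = _ := by ring
    calc _ ≤ Real.log ((q:ℝ) ^ (A + 3)) := Real.log_le_log (by have := abs_nonneg (t j); positivity) this
      _ = _ := Real.log_rpow (by linarith) _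
  have hstep : ∏ j, ‖DirichletCharacter.LFunction χ (1 / 2 + (t j) * Complex.I)‖ ^ (a j) ≤
      Real.exp ((∑ m ∈ Finset.range (⌊x⌋₊ + 1), F m).re + S * C2 * (A+3) * Real.log q / Real.log x) := by
    calc ∏ j, ‖DirichletCharacter.LFunction χ (1 / 2 + (t j) * Complex.I)‖ ^ (a j)
        ≤ ∏ j, Real.exp (a j * (∑ m ∈ Finset.range (⌊x⌋₊ + 1), LSeries.term (lcf χ) (1/2 + (η : ℂ) + t j * I) m
            * wx (Real.log x) m).re + a j * (C2 * (A+3) * Real.log q / Real.log x)) := by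
          refine Finset.prod_le_prod (fun j _ => by positivity) fun j _ => ?_
          have h3 := h2 q hq χ hχ hRH (t j) x hx1 hx
          have h4 := Real.rpow_le_rpow (norm_nonneg _) h3 (ha j).le
          refine h4.trans ?_
          rw [← Real.exp_mul, Real.exp_le_exp, mul_comm, ← mul_add]
          refine mul_le_mul_of_nonneg_left ?_ (ha j).le
          refine add_le_add le_rfl ?_
          apply div_le_div_of_nonneg_right _ hl.le
          have := mul_le_mul_of_nonneg_left (hlog j) hC2.le
          linarith
      _ = _ := by
          rw [← Real.exp_sum, Finset.sum_add_distrib, ← Finset.sum_mul]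
          congr 2
          · rw [hF, Finset.sum_comm, Complex.re_sum]
            refine Finset.sum_congr rfl fun j _ => ?_
            rw [← Finset.mul_sum, Complex.re_ofReal_mul]
          · ring
  refine hstep.trans (Real.exp_le_exp.2 ?_)
  have hF0 : ∀ m, ¬ IsPrimePow m → F m = 0 := by
    intro m hm
    rw [hF]
    refine Finset.sum_eq_zero fun j _ => ?_
    have : lcf χ m = 0 := by
      unfold lcf
      rw [ArithmeticFunction.vonMangoldt_eq_zero_iff.2 hm]; simp
    rw [LSeries.term_def]
    simp [this]
  have hFb : ∀ m, 1 ≤ m → ‖F m‖ ≤ S * (m : ℝ) ^ (-(1/2) : ℝ) := by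
    intro m hm
    rw [hF, hSdef, Finset.sum_mul]
    refine (norm_sum_le _ _).trans (Finset.sum_le_sum fun j _ => ?_)
    rw [norm_mul, Complex.norm_real, Real.norm_eq_abs, abs_of_pos (ha j)]
    refine mul_le_mul_of_nonneg_left ?_ (ha j).le
    have hm0 : m ≠ 0 := by omega
    rw [norm_mul, LSeries.norm_term_eq, if_neg hm0, hre]
    have hm1 : (1:ℝ) ≤ m := by exact_mod_cast hm
    calc ‖lcf χ m‖ / (m:ℝ) ^ (1/2 + η) * ‖wx (Real.log x) m‖ ≤ 1 / (m:ℝ) ^ (1/2 + η) * 1 := by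
          gcongr
          · exact lcf_norm χ m
          · exact wx_norm _ _ hm0
      _ = (m:ℝ) ^ (-(1/2 + η)) := by rw [Real.rpow_neg (by linarith)]; ring
      _ ≤ _ := Real.rpow_le_rpow_of_exponent_le hm1 (by linarith)
  have h3 := h1 F S x hS hx1.le hF0 hFb
  have h4 := (Complex.abs_re_le_norm _).trans h3
  rw [Complex.sub_re] at h4
  have h5 := (abs_le.1 h4).2
  have h6 : (∑ p ∈ (Finset.range (⌊x⌋₊ + 1)).filter Nat.Prime, (F p + if (p : ℝ)^2 ≤ x then F (p^2) else 0)).re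
      = ∑ p ∈ (Finset.range (⌊x⌋₊ + 1)).filter Nat.Prime, (cc a t x p * χ p + dd a t x p * (χ p)^2).re := by
    rw [Complex.re_sum]
    refine Finset.sum_congr rfl fun p hp => ?_
    have hpp := (Finset.mem_filter.1 hp).2
    have hlp : (Real.log p : ℂ) ≠ 0 := by
      exact_mod_cast (Real.log_pos (by exact_mod_cast hpp.one_lt)).ne'
    have key : ∀ (m : ℕ) (w : ℂ), m ≠ 0 → lcf χ m = w → F m = (∑ j, (a j : ℂ) * (m : ℂ) ^ (-(t j : ℂ) * I)) * (m : ℂ) ^ (-(1/2 + (η : ℂ))) * wx (Real.log x) m * w := by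
      intro m w hm hw
      rw [hF]
      simp only [Finset.sum_mul]
      refine Finset.sum_congr rfl fun j _ => ?_
      rw [LSeries.term_of_ne_zero hm, hw, div_eq_mul_inv, ← Complex.cpow_neg]
      have : -(1/2 + (η : ℂ) + t j * I) = (-(t j : ℂ) * I) + (-(1/2 + (η : ℂ))) := by ring
      rw [this, Complex.cpow_add _ _ (by exact_mod_cast hm)]
      ring
    congr 2
    · rw [key p (χ p) hpp.ne_zero]
      · rfl
      · unfold lcf
        rw [ArithmeticFunction.vonMangoldt_apply_prime hpp]
        field_simp
    · unfold dd
      split_ifs with hc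
      · rw [key (p^2) ((χ p)^2 * (1/2)) (pow_ne_zero _ hpp.ne_zero)]
        · ring
        · unfold lcf
          rw [ArithmeticFunction.vonMangoldt_apply_pow (by norm_num), ArithmeticFunction.vonMangoldt_apply_prime hpp]
          push_cast
          rw [map_pow, Real.log_pow]
          push_cast
          rw [Complex.natCast_log] at hlp
          field_simp
      · ring
  rw [h6] at h5
  have h7 : S * C2 * (A+3) * Real.log q / Real.log x ≤ (S * C2 * (A + 3) + 1) * Real.log q / Real.log x := by
    apply div_le_div_of_nonneg_right _ hl.le
    nlinarith
  linarith


/-- coefficientwise majorisation of polynomials in the values of a completely multiplicative function -/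
inductive Maj (N : ℝ) : ((ℕ →* ℂ) → ℂ) → ((ℕ →* ℂ) → ℂ) → Prop
  | base (b : ℂ) (c : ℝ) (m n : ℕ) (hm : 0 < m) (hn : 0 < n) (hb : ‖b‖ ≤ c)
      (h : b = 0 ∨ ((m : ℝ) ≤ N ∧ (n : ℝ) ≤ N)) :
      Maj N (fun f => b * (f m * (starRingEnd ℂ) (f n))) (fun f => (c : ℂ) * (f m * (starRingEnd ℂ) (f n)))
  | add (F G F' G' : (ℕ →* ℂ) → ℂ) : Maj N F G → Maj N F' G' → Maj N (fun f => F f + F' f) (fun f => G f + G' f)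

lemma Maj.congr {N : ℝ} {F G F' G' : (ℕ →* ℂ) → ℂ} (h : Maj N F G) (h1 : ∀ f, F' f = F f) (h2 : ∀ f, G' f = G f) :
    Maj N F' G' := by
  have e1 : F' = F := funext h1
  have e2 : G' = G := funext h2
  rw [e1, e2]; exact h

lemma Maj.const {N : ℝ} (hN : 1 ≤ N) (b : ℂ) (c : ℝ) (hb : ‖b‖ ≤ c) : Maj N (fun _ => b) (fun _ => (c : ℂ)) :=
  (Maj.base b c 1 1 one_pos one_pos hb (Or.inr ⟨by simpa using hN, by simpa using hN⟩)).congr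
    (fun f => by simp) (fun f => by simp)

lemma Maj.zero {N : ℝ} : Maj N (fun _ => 0) (fun _ => 0) :=
  (Maj.base (N := N) 0 0 1 1 one_pos one_pos (by simp) (Or.inl rfl)).congr (fun f => by simp) (fun f => by simp)

lemma Maj.mono {N N' : ℝ} {F G : (ℕ →* ℂ) → ℂ} (h : Maj N F G) (hN : N ≤ N') : Maj N' F G := by
  induction h with
  | base b c m n hm hn hb h =>
    exact Maj.base b c m n hm hn hb (h.imp id fun h => ⟨h.1.trans hN, h.2.trans hN⟩)
  | add F G F' G' _ _ h1 h2 => exact Maj.add _ _ _ _ h1 h2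

lemma Maj.zero_left {N N' : ℝ} {F G : (ℕ →* ℂ) → ℂ} (h : Maj N F G) : Maj N' (fun _ => 0) G := by
  induction h with
  | base b c m n hm hn hb h =>
    exact (Maj.base 0 c m n hm hn (by simpa using (norm_nonneg b).trans hb) (Or.inl rfl)).congr
      (fun f => by simp) (fun f => rfl)
  | add F G F' G' _ _ h1 h2 =>
    exact (Maj.add _ _ _ _ h1 h2).congr (fun f => by simp) (fun f => rfl)

lemma Maj.mul {N N' : ℝ} {F G F' G' : (ℕ →* ℂ) → ℂ} (h : Maj N F G) (h' : Maj N' F' G') :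
    Maj (N * N') (fun f => F f * F' f) (fun f => G f * G' f) := by
  induction h with
  | base b c m n hm hn hb h =>
    induction h' with
    | base b' c' m' n' hm' hn' hb' h' =>
      refine (Maj.base (b * b') (c * c') (m * m') (n * n') (Nat.mul_pos hm hm') (Nat.mul_pos hn hn') ?_ ?_).congr
        (fun f => ?_) (fun f => ?_)
      · rw [norm_mul]
        exact mul_le_mul hb hb' (norm_nonneg _) ((norm_nonneg _).trans hb)
      · rcases h with h | h
        · left; rw [h, zero_mul]
        · rcases h' with h' | h'
          · left; rw [h', mul_zero]
          · right
            push_cast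
            have hN : 0 ≤ N := (Nat.cast_nonneg m).trans h.1
            exact ⟨mul_le_mul h.1 h'.1 (Nat.cast_nonneg _) hN, mul_le_mul h.2 h'.2 (Nat.cast_nonneg _) hN⟩
      · simp only [map_mul]; ring
      · simp only [map_mul]; push_cast; ring
    | add F1 G1 F2 G2 _ _ h1 h2 =>
      exact (Maj.add _ _ _ _ h1 h2).congr (fun f => by ring) (fun f => by ring)
  | add F1 G1 F2 G2 _ _ h1 h2 =>
    exact (Maj.add _ _ _ _ h1 h2).congr (fun f => by ring) (fun f => by ring)

lemma Maj.pow {N : ℝ} {F G : (ℕ →* ℂ) → ℂ} (h : Maj N F G) (k : ℕ) :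
    Maj (N ^ k) (fun f => F f ^ k) (fun f => G f ^ k) := by
  induction k with
  | zero => exact (Maj.const (N := N^0) (by simp) 1 1 (by simp)).congr (fun f => by simp) (fun f => by simp)
  | succ k ih =>
    rw [pow_succ]
    exact (ih.mul h).congr (fun f => by rw [pow_succ]) (fun f => by rw [pow_succ])

lemma Maj.sum {ι : Type*} {N : ℝ} (s : Finset ι) (F G : ι → (ℕ →* ℂ) → ℂ) (h : ∀ i ∈ s, Maj N (F i) (G i)) :
    Maj N (fun f => ∑ i ∈ s, F i f) (fun f => ∑ i ∈ s, G i f) := by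
  classical
  induction s using Finset.induction_on with
  | empty => exact Maj.zero.congr (fun f => by simp) (fun f => by simp)
  | insert i s hi ih =>
    refine (Maj.add _ _ _ _ (h i (Finset.mem_insert_self i s)) (ih fun j hj => h j (Finset.mem_insert_of_mem hj))).congr
      (fun f => ?_) (fun f => ?_) <;> rw [Finset.sum_insert hi]

lemma Maj.prod {ι : Type*} (s : Finset ι) (N : ι → ℝ) (F G : ι → (ℕ →* ℂ) → ℂ) (h : ∀ i ∈ s, Maj (N i) (F i) (G i)) :
    Maj (∏ i ∈ s, N i) (fun f => ∏ i ∈ s, F i f) (fun f => ∏ i ∈ s, G i f) := by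
  classical
  induction s using Finset.induction_on with
  | empty => exact (Maj.const (by simp) 1 1 (by simp)).congr (fun f => by simp) (fun f => by simp)
  | insert i s hi ih =>
    rw [Finset.prod_insert hi]
    refine (Maj.mul (h i (Finset.mem_insert_self i s)) (ih fun j hj => h j (Finset.mem_insert_of_mem hj))).congr
      (fun f => ?_) (fun f => ?_) <;> rw [Finset.prod_insert hi]

lemma Maj.cmul {N : ℝ} {F G : (ℕ →* ℂ) → ℂ} (h : Maj N F G) (b : ℂ) (c : ℝ) (hb : ‖b‖ ≤ c) :
    Maj N (fun f => b * F f) (fun f => c * G f) := by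
  have := (Maj.const le_rfl b c hb).mul h
  rwa [one_mul] at this

/-- Taylor polynomial of exp -/
noncomputable def TE (N : ℕ) (y : ℝ) : ℝ := ∑ k ∈ Finset.range (N+1), y^k / k.factorial

lemma Maj.taylor {L : ℝ} (hL : 1 ≤ L) (X Y : (ℕ →* ℂ) → ℝ) (h : Maj L (fun f => (X f : ℂ)) (fun f => (Y f : ℂ)))
    (N K : ℕ) (hNK : N ≤ K) : Maj (L^N) (fun f => (TE N (X f) : ℂ)) (fun f => (TE K (Y f) : ℂ)) := by
  have h1 : Maj (L^N) (fun f => ∑ k ∈ Finset.range (K+1), if k ≤ N then ((k.factorial : ℂ))⁻¹ * (X f : ℂ)^k else 0)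
      (fun f => ∑ k ∈ Finset.range (K+1), (((k.factorial : ℝ)⁻¹ : ℝ) : ℂ) * (Y f : ℂ)^k) := by
    refine Maj.sum _ (fun k f => if k ≤ N then ((k.factorial : ℂ))⁻¹ * (X f : ℂ)^k else 0)
      (fun k f => (((k.factorial : ℝ)⁻¹ : ℝ) : ℂ) * (Y f : ℂ)^k) ?_
    intro k _
    have h2 : Maj (L^k) (fun f => ((k.factorial : ℂ))⁻¹ * (X f : ℂ)^k) (fun f => (((k.factorial : ℝ)⁻¹ : ℝ) : ℂ) * (Y f : ℂ)^k) :=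
      (h.pow k).cmul _ _ (by simp)
    by_cases hk : k ≤ N
    · simp only [if_pos hk]
      exact h2.mono (pow_le_pow_right₀ hL hk)
    · simp only [if_neg hk]
      exact h2.zero_left
  refine h1.congr (fun f => ?_) (fun f => ?_)
  · unfold TE
    rw [← Finset.sum_filter]
    push_cast
    apply Finset.sum_congr
    · ext k; simp only [Finset.mem_range, Finset.mem_filter]; omega
    · intro k _; rw [div_eq_mul_inv, mul_comm]
  · unfold TE
    push_cast
    exact Finset.sum_congr rfl fun k _ => by rw [div_eq_mul_inv, mul_comm]

/-- the character as a monoid hom on ℕ -/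
noncomputable def chom {q : ℕ} (χ : DirichletCharacter ℂ q) : ℕ →* ℂ :=
  χ.toMonoidHom.comp (Nat.castRingHom (ZMod q)).toMonoidHom

lemma chom_apply {q : ℕ} (χ : DirichletCharacter ℂ q) (n : ℕ) : chom χ n = χ n := rfl

lemma orth {q : ℕ} [NeZero q] (m n : ℕ) (hm : m < q) (hn : n < q) :
    ‖∑ χ : DirichletCharacter ℂ q, chom χ m * (starRingEnd ℂ) (chom χ n)‖ ≤ q.totient * if m = n then 1 else 0 := by
  simp only [chom_apply]
  by_cases hu : IsUnit (n : ZMod q)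
  · have h1 : ∀ χ : DirichletCharacter ℂ q, χ m * (starRingEnd ℂ) (χ n) = χ (n : ZMod q)⁻¹ * χ m := by
      intro χ
      have : (starRingEnd ℂ) (χ n) = χ (n : ZMod q)⁻¹ := by
        have h2 := MulChar.star_apply' χ (n : ZMod q)
        rw [show (starRingEnd ℂ) (χ n) = star (χ n) from rfl, h2]
        rw [MulChar.inv_apply]
        congr 1
        obtain ⟨u, hu⟩ := hu
        rw [← hu, Ring.inverse_unit, ZMod.inv_coe_unit]
      rw [this, mul_comm]
    rw [Finset.sum_congr rfl fun χ _ => h1 χ, DirichletCharacter.sum_char_inv_mul_char_eq ℂ hu]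
    by_cases hmn : m = n
    · simp [hmn]
    · have : (n : ZMod q) ≠ m := by
        intro h
        rw [ZMod.natCast_eq_natCast_iff', Nat.mod_eq_of_lt hm, Nat.mod_eq_of_lt hn] at h
        exact hmn h.symm
      simp [hmn, this]
  · have h1 : ∀ χ : DirichletCharacter ℂ q, χ m * (starRingEnd ℂ) (χ n) = 0 := by
      intro χ
      rw [χ.map_nonunit hu]; simp
    rw [Finset.sum_congr rfl fun χ _ => h1 χ]
    simp
    positivity

noncomputable def z5 (w : ZMod 5) : ℂ := ZMod.stdAddChar w

lemma z5_norm (w : ZMod 5) : ‖z5 w‖ = 1 := AddChar.norm_apply _ _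

lemma z5_conj (w : ZMod 5) : (starRingEnd ℂ) (z5 w) = z5 (-w) := by
  unfold z5
  rw [AddChar.map_neg_eq_conj]

lemma z5_pow (w : ZMod 5) (k : ℕ) : z5 w ^ k = z5 (k * w) := by
  unfold z5
  rw [← AddChar.map_nsmul_eq_pow, nsmul_eq_mul]

lemma z5_mul (v w : ZMod 5) : z5 v * z5 w = z5 (v + w) := by
  unfold z5
  rw [AddChar.map_add_eq_mul]

lemma z5_sum (b : ZMod 5) : ∑ w : ZMod 5, z5 (w * b) = if b = 0 then 5 else 0 := by
  have := AddChar.sum_mulShift b (ZMod.isPrimitive_stdAddChar 5)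
  unfold z5
  rw [this]
  split_ifs <;> simp

/-- random model -/
noncomputable def fmod (q : ℕ) (ω : Fin q → ZMod 5) : ℕ →* ℂ where
  toFun n := if n = 0 then 0 else ∏ p : Fin q, z5 (ω p) ^ (n.factorization p)
  map_one' := by simp
  map_mul' m n := by
    by_cases hm : m = 0
    · simp [hm]
    by_cases hn : n = 0
    · simp [hn]
    rw [if_neg (mul_ne_zero hm hn), if_neg hm, if_neg hn, Nat.factorization_mul hm hn, ← Finset.prod_mul_distrib]
    refine Finset.prod_congr rfl fun p _ => ?_
    rw [Finsupp.add_apply, pow_add]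

lemma fmod_apply (q : ℕ) (ω : Fin q → ZMod 5) (n : ℕ) (hn : 0 < n) :
    fmod q ω n = ∏ p : Fin q, z5 (ω p) ^ (n.factorization p) := if_neg hn.ne'

lemma fmod_prime (q : ℕ) (ω : Fin q → ZMod 5) (p : ℕ) (hp : p.Prime) (hq : p < q) :
    fmod q ω p = z5 (ω ⟨p, hq⟩) := by
  rw [fmod_apply _ _ _ hp.pos, Finset.prod_eq_single ⟨p, hq⟩]
  · simp [hp.factorization]
  · intro b _ hb
    rw [hp.factorization, Finsupp.single_apply, if_neg, pow_zero]
    intro h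
    exact hb (Fin.ext h.symm)
  · simp

/-- expectation in the model -/
noncomputable def Ex (q : ℕ) (G : (ℕ →* ℂ) → ℂ) : ℂ := (5^q : ℂ)⁻¹ * ∑ ω : Fin q → ZMod 5, G (fmod q ω)

lemma Ex_base (q m n : ℕ) (hm : 0 < m) (hn : 0 < n) :
    ∃ r : ℝ, 0 ≤ r ∧ Ex q (fun f => f m * (starRingEnd ℂ) (f n)) = r ∧ (m = n → r = 1) := by
  have h1 : ∑ ω : Fin q → ZMod 5, (fmod q ω m * (starRingEnd ℂ) (fmod q ω n)) =
      ∏ p : Fin q, (if ((m.factorization p : ZMod 5) - (n.factorization p : ZMod 5)) = 0 then (5:ℂ) else 0) := by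
    rw [Finset.prod_congr rfl fun p _ => (z5_sum _).symm, Fintype.prod_sum]
    refine Finset.sum_congr rfl fun ω _ => ?_
    rw [fmod_apply _ _ _ hm, fmod_apply _ _ _ hn, map_prod, ← Finset.prod_mul_distrib]
    refine Finset.prod_congr rfl fun p _ => ?_
    rw [map_pow, z5_conj, z5_pow, z5_pow, z5_mul]
    congr 1; ring
  refine ⟨((5:ℝ)^q)⁻¹ * ∏ p : Fin q, (if ((m.factorization p : ZMod 5) - (n.factorization p : ZMod 5)) = 0 then (5:ℝ) else 0), ?_, ?_, ?_⟩
  · apply mul_nonneg (by positivity)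
    refine Finset.prod_nonneg fun p _ => ?_
    split_ifs <;> norm_num
  · unfold Ex
    rw [h1]
    push_cast
    congr 1
    refine Finset.prod_congr rfl fun p _ => ?_
    split_ifs <;> norm_num
  · rintro rfl
    simp

theorem Maj.orth {q : ℕ} [NeZero q] {N : ℝ} (hN : N < q) {F G : (ℕ →* ℂ) → ℂ} (h : Maj N F G) :
    ‖∑ χ : DirichletCharacter ℂ q, F (chom χ)‖ ≤ q.totient * (Ex q G).re := by
  induction h with
  | base b c m n hm hn hb h =>
    obtain ⟨r, hr0, hr, hr1⟩ := Ex_base q m n hm hn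
    have hE : Ex q (fun f => (c : ℂ) * (f m * (starRingEnd ℂ) (f n))) = ((c * r : ℝ) : ℂ) := by
      push_cast
      rw [← hr]
      unfold Ex
      rw [← Finset.mul_sum]; ring
    rw [hE, Complex.ofReal_re, ← Finset.mul_sum, norm_mul]
    have hc : 0 ≤ c := (norm_nonneg b).trans hb
    rcases h with h | h
    · rw [h]; simp; positivity
    · have hm' : m < q := by exact_mod_cast h.1.trans_lt hN
      have hn' : n < q := by exact_mod_cast h.2.trans_lt hN
      have h2 := _root_.orth (q := q) m n hm' hn'
      have h3 : (if m = n then (1:ℝ) else 0) ≤ r := by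
        split_ifs with h
        · rw [hr1 h]
        · exact hr0
      calc _ ≤ c * (q.totient * if m = n then 1 else 0) := mul_le_mul hb h2 (norm_nonneg _) hc
        _ ≤ c * (q.totient * r) := by gcongr
        _ = _ := by ring
  | add F G F' G' _ _ h1 h2 =>
    have : Ex q (fun f => G f + G' f) = Ex q G + Ex q G' := by
      unfold Ex; rw [Finset.sum_add_distrib]; ring
    rw [this, Complex.add_re, Finset.sum_add_distrib, mul_add]
    exact (norm_add_le _ _).trans (add_le_add h1 h2)

theorem model_indep (q : ℕ) (P : Finset ℕ) (hP : ∀ p ∈ P, p.Prime ∧ p < q) (H : ℕ → ℂ → ℝ) :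
    ((5:ℝ)^q)⁻¹ * ∑ ω : Fin q → ZMod 5, ∏ p ∈ P, H p (fmod q ω p) = ∏ p ∈ P, (1/5 * ∑ w : ZMod 5, H p (z5 w)) := by
  have h0 : ∀ (K : ℕ → ℝ), ∏ p ∈ P, K p = ∏ i : Fin q, if (i : ℕ) ∈ P then K i else 1 := by
    intro K
    rw [Finset.prod_ite, Finset.prod_const_one, mul_one]
    symm
    refine Finset.prod_bij (fun i _ => (i : ℕ)) ?_ ?_ ?_ ?_
    · intro i hi; simpa using hi
    · intro i _ j _ hij; exact Fin.ext hij
    · intro p hp; exact ⟨⟨p, (hP p hp).2⟩, by simpa using hp, rfl⟩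
    · intro i _; rfl
  have h1 : ∀ ω : Fin q → ZMod 5, ∏ p ∈ P, H p (fmod q ω p) = ∏ i : Fin q, if (i : ℕ) ∈ P then H i (z5 (ω i)) else 1 := by
    intro ω
    rw [h0]
    refine Finset.prod_congr rfl fun i _ => ?_
    split_ifs with hi
    · rw [fmod_prime q ω i (hP _ hi).1 i.2]
    · rfl
  rw [Finset.sum_congr rfl fun ω _ => h1 ω, h0]
  have h2 := Fintype.prod_sum (fun (i : Fin q) (w : ZMod 5) => if (i : ℕ) ∈ P then H i (z5 w) else 1)
  rw [← h2]
  have h3 : ((5:ℝ)^q)⁻¹ = ∏ _i : Fin q, (1/5 : ℝ) := by simp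
  rw [h3, ← Finset.prod_mul_distrib]
  refine Finset.prod_congr rfl fun i _ => ?_
  split_ifs with hi
  · rfl
  · simp


lemma exp_three (y : ℝ) : Real.exp y ≤ 1 + y + y^2/2 + |y|^3 * Real.exp |y| := by
  have h := Complex.norm_exp_sub_sum_le_norm_mul_exp (y : ℂ) 3
  have e : Complex.exp y - ∑ m ∈ Finset.range 3, (y:ℂ)^m / (m.factorial : ℂ) = ((Real.exp y - (1 + y + y^2/2) : ℝ) : ℂ) := by
    simp [Finset.sum_range_succ, Nat.factorial]
  rw [e, Complex.norm_real, Complex.norm_real, Real.norm_eq_abs, Real.norm_eq_abs] at h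
  linarith [(abs_le.1 h).2]

lemma z5_re_sum (b : ZMod 5) (hb : b ≠ 0) : ∑ w : ZMod 5, (z5 (w * b)).re = 0 := by
  rw [← Complex.re_sum, z5_sum, if_neg hb]; simp

lemma yy_form (u v : ℝ) (w : ZMod 5) : ((u : ℂ) * z5 w + v * (z5 w)^2).re = u * (z5 (w * 1)).re + v * (z5 (w * 2)).re := by
  rw [z5_pow, Complex.add_re, Complex.re_ofReal_mul, Complex.re_ofReal_mul]
  congr 3
  · rw [mul_one]
  · rw [mul_comm]; norm_num

lemma yy_sum (u v : ℝ) : ∑ w : ZMod 5, ((u : ℂ) * z5 w + v * (z5 w)^2).re = 0 := by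
  simp only [yy_form]
  rw [Finset.sum_add_distrib, ← Finset.mul_sum, ← Finset.mul_sum, z5_re_sum 1 (by decide), z5_re_sum 2 (by decide)]
  ring

lemma re_mul_re (a b : ZMod 5) : (z5 a).re * (z5 b).re = ((z5 (a + b)).re + (z5 (a - b)).re) / 2 := by
  have h1 : (z5 (a+b)).re = (z5 a).re * (z5 b).re - (z5 a).im * (z5 b).im := by
    rw [← z5_mul, Complex.mul_re]
  have h2 : (z5 (a-b)).re = (z5 a).re * (z5 b).re + (z5 a).im * (z5 b).im := by
    rw [sub_eq_add_neg, ← z5_mul, ← z5_conj, Complex.mul_re, Complex.conj_re, Complex.conj_im]; ring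
  rw [h1, h2]; ring

lemma yy_sq_sum (u v : ℝ) : ∑ w : ZMod 5, (((u : ℂ) * z5 w + v * (z5 w)^2).re)^2 = 5 * (u^2 + v^2) / 2 := by
  have hz : z5 0 = 1 := by unfold z5; simp
  have h : ∀ w : ZMod 5, (((u : ℂ) * z5 w + v * (z5 w)^2).re)^2 =
      (u^2 + v^2)/2 + u^2/2 * (z5 (w * 2)).re + v^2/2 * (z5 (w*4)).re + u * v * (z5 (w * 3)).re + u * v * (z5 (w * (-1))).re := by
    intro w
    rw [yy_form]
    have e1 := re_mul_re (w*1) (w*1)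
    have e2 := re_mul_re (w*2) (w*2)
    have e3 := re_mul_re (w*1) (w*2)
    rw [show w*1+w*1 = w*2 by ring, sub_self, hz] at e1
    rw [show w*2+w*2 = w*4 by ring, sub_self, hz] at e2
    rw [show w*1+w*2 = w*3 by ring, show w*1-w*2 = w*(-1) by ring] at e3
    simp only [Complex.one_re] at e1 e2
    linear_combination u^2 * e1 + v^2 * e2 + 2 * u * v * e3
  rw [Finset.sum_congr rfl fun w _ => h w]
  simp only [Finset.sum_add_distrib, ← Finset.mul_sum]
  rw [z5_re_sum 2 (by decide), z5_re_sum 4 (by decide), z5_re_sum 3 (by decide), z5_re_sum (-1) (by decide)]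
  simp
  ring

lemma yy_abs (u v : ℝ) (hu : 0 ≤ u) (hv : 0 ≤ v) (w : ZMod 5) : |((u : ℂ) * z5 w + v * (z5 w)^2).re| ≤ u + v := by
  refine (Complex.abs_re_le_norm _).trans ((norm_add_le _ _).trans ?_)
  rw [norm_mul, norm_mul, norm_pow, z5_norm, Complex.norm_real, Complex.norm_real, Real.norm_eq_abs, Real.norm_eq_abs,
    abs_of_nonneg hu, abs_of_nonneg hv]
  simp

lemma e_small (u v : ℝ) (hu : 0 ≤ u) (hv : 0 ≤ v) :
    1/5 * ∑ w : ZMod 5, Real.exp (((u : ℂ) * z5 w + v * (z5 w)^2).re) ≤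
      Real.exp (u^2/4 + v^2/4 + (u+v)^3 * Real.exp (u+v)) := by
  have h : ∑ w : ZMod 5, Real.exp (((u : ℂ) * z5 w + v * (z5 w)^2).re) ≤
      ∑ w : ZMod 5, (1 + ((u : ℂ) * z5 w + v * (z5 w)^2).re + (((u : ℂ) * z5 w + v * (z5 w)^2).re)^2/2
        + (u+v)^3 * Real.exp (u+v)) := by
    refine Finset.sum_le_sum fun w _ => (exp_three _).trans ?_
    have := yy_abs u v hu hv w
    gcongr
  have h2 : ∑ w : ZMod 5, (1 + ((u : ℂ) * z5 w + v * (z5 w)^2).re + (((u : ℂ) * z5 w + v * (z5 w)^2).re)^2/2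
        + (u+v)^3 * Real.exp (u+v)) = 5 + 5 * (u^2+v^2)/4 + 5 * ((u+v)^3 * Real.exp (u+v)) := by
    simp only [Finset.sum_add_distrib, ← Finset.sum_div]
    rw [yy_sum, yy_sq_sum]
    simp
    ring
  have h3 := Real.add_one_le_exp (u^2/4 + v^2/4 + (u+v)^3 * Real.exp (u+v))
  rw [h2] at h
  linarith

lemma e_hoeff (u v : ℝ) (hu : 0 ≤ u) (hv : 0 ≤ v) (l : ℝ) (hl : 0 ≤ l) :
    1/5 * ∑ w : ZMod 5, Real.exp (l * ((u : ℂ) * z5 w + v * (z5 w)^2).re) ≤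
      Real.exp (l^2 * (u+v)^2/2) := by
  set B := l * (u + v) with hB
  have hB0 : 0 ≤ B := by positivity
  have hB2 : l^2 * (u+v)^2/2 = B^2/2 := by rw [hB]; ring
  rw [hB2]
  have hab : ∀ w : ZMod 5, |l * ((u : ℂ) * z5 w + v * (z5 w)^2).re| ≤ B := by
    intro w; rw [abs_mul, abs_of_nonneg hl]
    exact mul_le_mul_of_nonneg_left (yy_abs u v hu hv w) hl
  rcases hB0.eq_or_lt with h0 | h0
  · rw [← h0]
    have : ∀ w : ZMod 5, l * ((u : ℂ) * z5 w + v * (z5 w)^2).re = 0 := by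
      intro w
      have := hab w
      rw [← h0] at this
      exact abs_eq_zero.1 (le_antisymm this (abs_nonneg _))
    rw [Finset.sum_congr rfl fun w _ => by rw [this w]]
    simp
  · have key : ∀ y : ℝ, |y| ≤ B → Real.exp y ≤ Real.cosh B + y * (Real.sinh B / B) := by
      intro y hy
      have hy' := abs_le.1 hy
      have hc := convexOn_exp.2 (Set.mem_univ (-B)) (Set.mem_univ B)
        (show 0 ≤ (B-y)/(2*B) by apply div_nonneg <;> linarith)
        (show 0 ≤ (B+y)/(2*B) by apply div_nonneg <;> linarith) (by field_simp; ring)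
      simp only [smul_eq_mul] at hc
      have e1 : (B-y)/(2*B) * (-B) + (B+y)/(2*B) * B = y := by field_simp; ring
      rw [e1] at hc
      refine hc.trans (le_of_eq ?_)
      rw [Real.cosh_eq, Real.sinh_eq]
      field_simp
      ring
    have h1 : ∑ w : ZMod 5, Real.exp (l * ((u : ℂ) * z5 w + v * (z5 w)^2).re) ≤
        ∑ w : ZMod 5, (Real.cosh B + (l * ((u : ℂ) * z5 w + v * (z5 w)^2).re) * (Real.sinh B / B)) :=
      Finset.sum_le_sum fun w _ => key _ (hab w)
    rw [Finset.sum_add_distrib, ← Finset.sum_mul, ← Finset.mul_sum, yy_sum] at h1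
    simp at h1
    have := Real.cosh_le_exp_half_sq B
    simp
    linarith

/-- the polynomials -/
noncomputable def Xf (P : Finset ℕ) (c d : ℕ → ℂ) (f : ℕ →* ℂ) : ℝ := ∑ p ∈ P, (c p * f p + d p * (f p)^2).re

lemma Xf_maj (P : Finset ℕ) (c d : ℕ → ℂ) (u v : ℕ → ℝ) (y : ℝ) (hy : 1 ≤ y)
    (hP : ∀ p ∈ P, 0 < p ∧ (p : ℝ) ≤ y) (hc : ∀ p ∈ P, ‖c p‖ ≤ u p) (hd : ∀ p ∈ P, ‖d p‖ ≤ v p) :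
    Maj (y^2) (fun f => (Xf P c d f : ℂ)) (fun f => (Xf P (fun p => (u p : ℂ)) (fun p => (v p : ℂ)) f : ℂ)) := by
  have h1 : Maj (y^2) (fun f => ∑ p ∈ P, (((c p * f p + d p * (f p)^2).re : ℝ) : ℂ))
      (fun f => ∑ p ∈ P, ((((u p : ℂ) * f p + (v p : ℂ) * (f p)^2).re : ℝ) : ℂ)) := by
    refine Maj.sum P _ _ ?_
    intro p hp
    obtain ⟨hp0, hpy⟩ := hP p hp
    have hp1 : (1:ℝ) ≤ p := by exact_mod_cast hp0
    have hy2 : 1 ≤ y^2 := by nlinarith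
    have hpy1 : (p:ℝ) ≤ y^2 := by nlinarith
    have hpy2 : ((p^2 : ℕ):ℝ) ≤ y^2 := by push_cast; gcongr
    have hn : ‖(1/2 : ℂ)‖ = 1/2 := by norm_num
    have hb1 : ‖(1/2 : ℂ) * c p‖ ≤ 1/2 * u p := by
      rw [norm_mul, hn]; exact mul_le_mul_of_nonneg_left (hc p hp) (by norm_num)
    have hb2 : ‖(1/2 : ℂ) * (starRingEnd ℂ) (c p)‖ ≤ 1/2 * u p := by
      rw [norm_mul, hn, Complex.norm_conj]; exact mul_le_mul_of_nonneg_left (hc p hp) (by norm_num)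
    have hb3 : ‖(1/2 : ℂ) * d p‖ ≤ 1/2 * v p := by
      rw [norm_mul, hn]; exact mul_le_mul_of_nonneg_left (hd p hp) (by norm_num)
    have hb4 : ‖(1/2 : ℂ) * (starRingEnd ℂ) (d p)‖ ≤ 1/2 * v p := by
      rw [norm_mul, hn, Complex.norm_conj]; exact mul_le_mul_of_nonneg_left (hd p hp) (by norm_num)
    have hp2 : 0 < p^2 := by positivity
    have m1 := Maj.base (N := y^2) _ _ p 1 hp0 one_pos hb1 (Or.inr ⟨hpy1, by simpa using hy2⟩)
    have m2 := Maj.base (N := y^2) _ _ 1 p one_pos hp0 hb2 (Or.inr ⟨by simpa using hy2, hpy1⟩)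
    have m3 := Maj.base (N := y^2) _ _ (p^2) 1 hp2 one_pos hb3 (Or.inr ⟨hpy2, by simpa using hy2⟩)
    have m4 := Maj.base (N := y^2) _ _ 1 (p^2) one_pos hp2 hb4 (Or.inr ⟨by simpa using hy2, hpy2⟩)
    refine (((m1.add _ _ _ _ m2).add _ _ _ _ m3).add _ _ _ _ m4).congr (fun f => ?_) (fun f => ?_)
    · rw [Complex.re_eq_add_conj]
      simp only [map_add, map_mul, map_pow, map_one]
      ring
    · rw [Complex.re_eq_add_conj]
      simp only [map_add, map_mul, map_pow, map_one, Complex.conj_ofReal]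
      push_cast
      ring
  refine h1.congr (fun f => ?_) (fun f => ?_)
  · unfold Xf; push_cast; rfl
  · unfold Xf; push_cast; rfl

lemma E_joint (q : ℕ) (P Q : Finset ℕ) (hPQ : Disjoint P Q) (hP : ∀ p ∈ P, p.Prime ∧ p < q) (hQ : ∀ p ∈ Q, p.Prime ∧ p < q)
    (u v u' v' : ℕ → ℝ) (hu : ∀ p, 0 ≤ u p) (hv : ∀ p, 0 ≤ v p) (hu' : ∀ p, 0 ≤ u' p) (hv' : ∀ p, 0 ≤ v' p)
    (l : ℝ) (hl : 0 ≤ l) :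
    ((5:ℝ)^q)⁻¹ * ∑ ω : Fin q → ZMod 5, Real.exp (Xf P (fun p => (u p : ℂ)) (fun p => (v p : ℂ)) (fmod q ω)) *
      Real.exp (l * Xf Q (fun p => (u' p : ℂ)) (fun p => (v' p : ℂ)) (fmod q ω)) ≤
    Real.exp (∑ p ∈ P, (u p^2/4 + v p^2/4 + (u p+v p)^3 * Real.exp (u p+v p))) *
      Real.exp (∑ p ∈ Q, l^2 * (u' p+v' p)^2/2) := by
  classical
  set H : ℕ → ℂ → ℝ := fun p z => if p ∈ P then Real.exp (((u p : ℂ) * z + v p * z^2).re)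
    else Real.exp (l * ((u' p : ℂ) * z + v' p * z^2).re) with hH
  have hnP : ∀ p ∈ Q, p ∉ P := fun p hp hp' => Finset.disjoint_left.1 hPQ hp' hp
  have h1 : ∀ ω : Fin q → ZMod 5, Real.exp (Xf P (fun p => (u p : ℂ)) (fun p => (v p : ℂ)) (fmod q ω)) *
      Real.exp (l * Xf Q (fun p => (u' p : ℂ)) (fun p => (v' p : ℂ)) (fmod q ω)) = ∏ p ∈ P ∪ Q, H p (fmod q ω p) := by
    intro ω
    rw [Finset.prod_union hPQ]
    unfold Xf
    rw [Finset.mul_sum, Real.exp_sum, Real.exp_sum]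
    congr 1
    · refine Finset.prod_congr rfl fun p hp => ?_
      simp only [hH, if_pos hp]
    · refine Finset.prod_congr rfl fun p hp => ?_
      simp only [hH, if_neg (hnP p hp)]
  rw [Finset.sum_congr rfl fun ω _ => h1 ω, model_indep q (P ∪ Q) (by
    intro p hp
    rcases Finset.mem_union.1 hp with h | h
    · exact hP p h
    · exact hQ p h), Finset.prod_union hPQ, Real.exp_sum, Real.exp_sum]
  have hnn : ∀ p, 0 ≤ 1/5 * ∑ w : ZMod 5, H p (z5 w) := by
    intro p
    apply mul_nonneg (by norm_num)
    refine Finset.sum_nonneg fun w _ => ?_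
    simp only [hH]; split_ifs <;> positivity
  refine mul_le_mul ?_ ?_ (Finset.prod_nonneg fun p _ => hnn p) (Finset.prod_nonneg fun p _ => (Real.exp_pos _).le)
  · refine Finset.prod_le_prod (fun p _ => hnn p) fun p hp => ?_
    simp only [hH, if_pos hp]
    exact e_small _ _ (hu p) (hv p)
  · refine Finset.prod_le_prod (fun p _ => hnn p) fun p hp => ?_
    simp only [hH, if_neg (hnP p hp)]
    exact e_hoeff _ _ (hu' p) (hv' p) l hl


lemma TE_tendsto (y : ℝ) : Filter.Tendsto (fun K : ℕ => TE K y) Filter.atTop (nhds (Real.exp y)) := by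
  have h : HasSum (fun n : ℕ => y^n / n.factorial) (Real.exp y) := by
    rw [Real.exp_eq_exp_ℝ]
    exact NormedSpace.expSeries_div_hasSum_exp y
  exact (Filter.tendsto_add_atTop_iff_nat 1).2 h.tendsto_sum_nat

lemma Maj.powexp {L : ℝ} (X Y : (ℕ →* ℂ) → ℝ) (h : Maj L (fun f => (X f : ℂ)) (fun f => (Y f : ℂ)))
    (k K : ℕ) (hk : k ≤ K) : Maj (L^k) (fun f => ((X f ^ k : ℝ) : ℂ)) (fun f => ((k.factorial * TE K (Y f) : ℝ) : ℂ)) := by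
  have h1 : Maj (L^k) (fun f => ∑ j ∈ Finset.range (K+1), if j = k then (X f : ℂ)^j else 0)
      (fun f => ∑ j ∈ Finset.range (K+1), (((k.factorial : ℝ) / (j.factorial : ℝ) : ℝ) : ℂ) * (Y f : ℂ)^j) := by
    refine Maj.sum _ (fun j f => if j = k then (X f : ℂ)^j else 0)
      (fun j f => (((k.factorial : ℝ) / (j.factorial : ℝ) : ℝ) : ℂ) * (Y f : ℂ)^j) ?_
    intro j _
    by_cases hj : j = k
    · subst hj
      simp only [if_true]
      refine ((h.pow j).cmul 1 ((j.factorial : ℝ) / (j.factorial : ℝ)) ?_).congr (fun f => by simp) (fun f => rfl)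
      rw [div_self (by positivity)]; simp
    · simp only [if_neg hj]
      exact ((h.pow j).cmul (N := L^j) 0 ((k.factorial : ℝ) / (j.factorial : ℝ)) (by simp; positivity)).zero_left
  refine h1.congr (fun f => ?_) (fun f => ?_)
  · rw [Finset.sum_ite_eq' , if_pos (Finset.mem_range.2 (by omega))]; push_cast; rfl
  · unfold TE
    push_cast
    rw [Finset.mul_sum]
    exact Finset.sum_congr rfl fun j _ => by ring

lemma Xf_biUnion (I : Finset ℕ) (P : ℕ → Finset ℕ) (hd : (I : Set ℕ).PairwiseDisjoint P) (c d : ℕ → ℂ) (f : ℕ →* ℂ) :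
    Xf (I.biUnion P) c d f = ∑ i ∈ I, Xf (P i) c d f := by
  unfold Xf
  rw [Finset.sum_biUnion hd]

theorem moment (q : ℕ) [NeZero q] (I : Finset ℕ) (P : ℕ → Finset ℕ) (Q : Finset ℕ) (c d c' d' : ℕ → ℂ)
    (u v u' v' : ℕ → ℝ) (y : ℕ → ℝ) (yQ : ℝ) (N : ℕ → ℕ) (s : ℕ) (l : ℝ) (hl : 0 < l)
    (hy : ∀ i ∈ I, 1 ≤ y i) (hyQ : 1 ≤ yQ)
    (hP : ∀ i ∈ I, ∀ p ∈ P i, p.Prime ∧ p < q ∧ (p : ℝ) ≤ y i)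
    (hQ : ∀ p ∈ Q, p.Prime ∧ p < q ∧ (p : ℝ) ≤ yQ)
    (hPd : (I : Set ℕ).PairwiseDisjoint P) (hPQ : ∀ i ∈ I, Disjoint (P i) Q)
    (hu : ∀ p, 0 ≤ u p) (hv : ∀ p, 0 ≤ v p) (hu' : ∀ p, 0 ≤ u' p) (hv' : ∀ p, 0 ≤ v' p)
    (hcu : ∀ p, p.Prime → ‖c p‖ ≤ u p) (hdv : ∀ p, p.Prime → ‖d p‖ ≤ v p)
    (hcu' : ∀ p, p.Prime → ‖c' p‖ ≤ u' p) (hdv' : ∀ p, p.Prime → ‖d' p‖ ≤ v' p)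
    (hlen : (∏ i ∈ I, ((y i^2)^(N i))^2) * (yQ^2)^(2*s) < q) :
    ∑ χ : DirichletCharacter ℂ q, (∏ i ∈ I, TE (N i) (Xf (P i) c d (chom χ) / 2)^2) * Xf Q c' d' (chom χ)^(2*s) ≤
      q.totient * (((2*s).factorial / l^(2*s)) *
        (Real.exp (∑ i ∈ I, ∑ p ∈ P i, (u p^2/4 + v p^2/4 + (u p+v p)^3 * Real.exp (u p+v p))) *
          Real.exp (∑ p ∈ Q, l^2 * (u' p+v' p)^2/2))) := by
  classical
  set U : ℕ → ℂ := fun p => (u p : ℂ) with hU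
  set V : ℕ → ℂ := fun p => (v p : ℂ) with hV
  set U' : ℕ → ℂ := fun p => (u' p : ℂ) with hU'
  set V' : ℕ → ℂ := fun p => (v' p : ℂ) with hV'
  set GK : ℕ → (ℕ →* ℂ) → ℝ := fun K f => (∏ i ∈ I, TE K (Xf (P i) U V f / 2)^2) *
    ((1/l^(2*s)) * ((2*s).factorial * TE K (l * Xf Q U' V' f))) with hGK
  set K0 := (∑ i ∈ I, N i) + 2 * s with hK0
  have hstep : ∀ K, K0 ≤ K → ∑ χ : DirichletCharacter ℂ q, (∏ i ∈ I, TE (N i) (Xf (P i) c d (chom χ) / 2)^2) * Xf Q c' d' (chom χ)^(2*s)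
      ≤ q.totient * (((5:ℝ)^q)⁻¹ * ∑ ω : Fin q → ZMod 5, GK K (fmod q ω)) := by
    intro K hK
    have m1 : Maj (∏ i ∈ I, ((y i^2)^(N i))^2) (fun f => ∏ i ∈ I, ((TE (N i) (Xf (P i) c d f / 2) : ℂ))^2)
        (fun f => ∏ i ∈ I, ((TE K (Xf (P i) U V f / 2) : ℂ))^2) := by
      refine Maj.prod I (fun i => ((y i^2)^(N i))^2) _ _ ?_
      intro i hi
      have hy2 : 1 ≤ y i ^ 2 := by have := hy i hi; nlinarith
      have m0 := Xf_maj (P i) c d u v (y i) (hy i hi) (fun p hp => ⟨(hP i hi p hp).1.pos, (hP i hi p hp).2.2⟩)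
        (fun p hp => hcu p (hP i hi p hp).1) (fun p hp => hdv p (hP i hi p hp).1)
      have m0' : Maj (y i ^2) (fun f => ((Xf (P i) c d f / 2 : ℝ) : ℂ)) (fun f => ((Xf (P i) U V f / 2 : ℝ) : ℂ)) := by
        refine (m0.cmul (1/2) (1/2) (by norm_num)).congr (fun f => ?_) (fun f => ?_) <;> push_cast <;> ring
      have hNK : N i ≤ K := by
        have : N i ≤ ∑ i ∈ I, N i := Finset.single_le_sum (fun _ _ => Nat.zero_le _) hi
        omega
      exact (Maj.taylor hy2 _ _ m0' (N i) K hNK).pow 2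
    have m2 : Maj ((yQ^2)^(2*s)) (fun f => ((Xf Q c' d' f : ℂ))^(2*s))
        (fun f => (((1/l^(2*s)) * ((2*s).factorial * TE K (l * Xf Q U' V' f)) : ℝ) : ℂ)) := by
      have m0 := Xf_maj Q c' d' u' v' yQ hyQ (fun p hp => ⟨(hQ p hp).1.pos, (hQ p hp).2.2⟩)
        (fun p hp => hcu' p (hQ p hp).1) (fun p hp => hdv' p (hQ p hp).1)
      have m0' : Maj (yQ^2) (fun f => ((l * Xf Q c' d' f : ℝ) : ℂ)) (fun f => ((l * Xf Q U' V' f : ℝ) : ℂ)) := by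
        refine (m0.cmul l l (by rw [Complex.norm_real, Real.norm_eq_abs, abs_of_pos hl])).congr (fun f => ?_) (fun f => ?_) <;> push_cast <;> ring
      have m3 := Maj.powexp _ _ m0' (2*s) K (by omega)
      refine (m3.cmul ((1/l^(2*s) : ℝ) : ℂ) (1/l^(2*s)) (by rw [Complex.norm_real, Real.norm_eq_abs, abs_of_pos (by positivity)])).congr
        (fun f => ?_) (fun f => ?_)
      · push_cast
        have : (l : ℂ) ≠ 0 := by exact_mod_cast hl.ne'
        field_simp
        rw [mul_pow, mul_comm]
      · push_cast; ring
    have m := m1.mul m2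
    have ho := m.orth hlen
    have e1 : ∑ χ : DirichletCharacter ℂ q, (∏ i ∈ I, ((TE (N i) (Xf (P i) c d (chom χ) / 2) : ℂ))^2) * ((Xf Q c' d' (chom χ) : ℂ))^(2*s)
        = ((∑ χ : DirichletCharacter ℂ q, (∏ i ∈ I, TE (N i) (Xf (P i) c d (chom χ) / 2)^2) * Xf Q c' d' (chom χ)^(2*s) : ℝ) : ℂ) := by
      push_cast; rfl
    rw [e1, Complex.norm_real] at ho
    refine (le_abs_self _).trans (ho.trans (le_of_eq ?_))
    congr 1
    rw [← Complex.ofReal_re (((5:ℝ)^q)⁻¹ * ∑ ω : Fin q → ZMod 5, GK K (fmod q ω))]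
    congr 1
    unfold Ex
    simp only [hGK]
    push_cast
    rfl
  set GI : (ℕ →* ℂ) → ℝ := fun f => (∏ i ∈ I, Real.exp (Xf (P i) U V f / 2)^2) *
    ((1/l^(2*s)) * ((2*s).factorial * Real.exp (l * Xf Q U' V' f))) with hGI
  have hlim : Filter.Tendsto (fun K : ℕ => (q.totient : ℝ) * (((5:ℝ)^q)⁻¹ * ∑ ω : Fin q → ZMod 5, GK K (fmod q ω))) Filter.atTop
      (nhds ((q.totient : ℝ) * (((5:ℝ)^q)⁻¹ * ∑ ω : Fin q → ZMod 5, GI (fmod q ω)))) := by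
    refine Filter.Tendsto.const_mul _ (Filter.Tendsto.const_mul _ ?_)
    refine tendsto_finsetSum _ fun ω _ => ?_
    simp only [hGK, hGI]
    refine Filter.Tendsto.mul ?_ ?_
    · exact tendsto_finsetProd _ fun i _ => (TE_tendsto _).pow 2
    · exact Filter.Tendsto.const_mul _ (Filter.Tendsto.const_mul _ (TE_tendsto _))
  refine (ge_of_tendsto hlim (Filter.eventually_atTop.2 ⟨K0, hstep⟩)).trans ?_
  refine mul_le_mul_of_nonneg_left ?_ (Nat.cast_nonneg _)
  have hJ := E_joint q (I.biUnion P) Q (by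
      rw [Finset.disjoint_biUnion_left]; exact hPQ)
    (by
      intro p hp
      obtain ⟨i, hi, hpi⟩ := Finset.mem_biUnion.1 hp
      exact ⟨(hP i hi p hpi).1, (hP i hi p hpi).2.1⟩)
    (fun p hp => ⟨(hQ p hp).1, (hQ p hp).2.1⟩) u v u' v' hu hv hu' hv' l hl.le
  rw [Finset.sum_biUnion hPd] at hJ
  have e2 : ((5:ℝ)^q)⁻¹ * ∑ ω : Fin q → ZMod 5, GI (fmod q ω) = ((2*s).factorial / l^(2*s)) *
      (((5:ℝ)^q)⁻¹ * ∑ ω : Fin q → ZMod 5, Real.exp (Xf (I.biUnion P) U V (fmod q ω)) * Real.exp (l * Xf Q U' V' (fmod q ω))) := by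
    rw [mul_left_comm]
    congr 1
    rw [Finset.mul_sum]
    refine Finset.sum_congr rfl fun ω _ => ?_
    simp only [hGI]
    rw [Xf_biUnion I P hPd, Real.exp_sum]
    have : ∀ i ∈ I, Real.exp (Xf (P i) U V (fmod q ω) / 2)^2 = Real.exp (Xf (P i) U V (fmod q ω)) := by
      intro i _
      rw [← Real.exp_nat_mul]; congr 1; push_cast; ring
    rw [Finset.prod_congr rfl this]
    ring
  rw [e2]
  exact mul_le_mul_of_nonneg_left hJ (by positivity)

lemma exp_le_TE (z : ℝ) (N : ℕ) (hN : 20 * |z| ≤ N + 1) : Real.exp z ≤ Real.exp (2 * (1/2)^(N+1)) * TE N z := by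
  have h1 : ‖(z:ℂ)‖ / ((N+1).succ : ℝ) ≤ 1/2 := by
    rw [Complex.norm_real, Real.norm_eq_abs, div_le_iff₀ (by positivity)]
    push_cast
    have := abs_nonneg z
    linarith
  have h2 := Complex.exp_bound' h1
  have e : Complex.exp z - ∑ m ∈ Finset.range (N+1), (z:ℂ)^m / (m.factorial : ℂ) = ((Real.exp z - TE N z : ℝ) : ℂ) := by
    unfold TE; push_cast; rfl
  rw [e, Complex.norm_real, Complex.norm_real, Real.norm_eq_abs, Real.norm_eq_abs] at h2
  have h3 := (abs_le.1 h2).2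
  -- the error is tiny
  have hfac : ((N+1 : ℕ) : ℝ)^(N+1) / Real.exp (N+1 : ℕ) ≤ (N+1).factorial := by
    rw [div_le_iff₀ (Real.exp_pos _)]
    have := Real.pow_div_factorial_le_exp ((N+1 : ℕ) : ℝ) (by positivity) (N+1)
    rw [div_le_iff₀ (by positivity)] at this
    linarith
  have hbound : |z|^(N+1) / (N+1).factorial * 2 ≤ Real.exp z * (1/2)^(N+1) := by
    have hz : |z| ≤ ((N+1 : ℕ) : ℝ) / 20 := by push_cast; linarith
    have hz2 : |z|^(N+1) ≤ (((N+1 : ℕ) : ℝ) / 20)^(N+1) := pow_le_pow_left₀ (abs_nonneg z) hz _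
    have h4 : |z|^(N+1) / (N+1).factorial ≤ (Real.exp 1 / 20)^(N+1) := by
      rw [div_le_iff₀ (by positivity)]
      have h5 : (Real.exp 1 / 20)^(N+1) * (((N+1 : ℕ) : ℝ)^(N+1) / Real.exp (N+1 : ℕ)) = (((N+1 : ℕ) : ℝ) / 20)^(N+1) := by
        rw [div_pow, div_pow, ← Real.exp_one_pow (N+1)]
        field_simp
      calc |z|^(N+1) ≤ (Real.exp 1 / 20)^(N+1) * (((N+1 : ℕ) : ℝ)^(N+1) / Real.exp (N+1 : ℕ)) := by rw [h5]; exact hz2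
        _ ≤ _ := mul_le_mul_of_nonneg_left hfac (by positivity)
    have h6 : Real.exp (-(((N+1 : ℕ) : ℝ) / 20)) ≤ Real.exp z := by
      apply Real.exp_le_exp.2
      linarith [neg_abs_le z]
    have h7 : (7/8 : ℝ)^(N+1) ≤ Real.exp (-(((N+1 : ℕ) : ℝ) / 20)) := by
      have : Real.exp (-(((N+1 : ℕ) : ℝ) / 20)) = Real.exp (-(1/20)) ^ (N+1) := by
        rw [← Real.exp_nat_mul]; congr 1; ring
      rw [this]
      apply pow_le_pow_left₀ (by norm_num)
      have := Real.add_one_le_exp (-(1/20) : ℝ)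
      linarith
    have h8 : (Real.exp 1 / 20)^(N+1) * 2 ≤ (7/16 : ℝ)^(N+1) := by
      have h9 : Real.exp 1 / 20 ≤ 7/16 * (1/2) := by have := Real.exp_one_lt_d9; linarith
      calc (Real.exp 1 / 20)^(N+1) * 2 ≤ (7/16 * (1/2))^(N+1) * 2 := by
            gcongr
        _ = (7/16)^(N+1) * ((1/2)^(N+1) * 2) := by rw [mul_pow]; ring
        _ ≤ (7/16)^(N+1) * 1 := by
            apply mul_le_mul_of_nonneg_left _ (by positivity)
            rw [pow_succ]
            have : (1/2 : ℝ)^N ≤ 1 := pow_le_one₀ (by norm_num) (by norm_num)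
            linarith
        _ = _ := mul_one _
    calc |z|^(N+1) / (N+1).factorial * 2 ≤ (Real.exp 1 / 20)^(N+1) * 2 := by linarith
      _ ≤ (7/16 : ℝ)^(N+1) := h8
      _ = (7/8)^(N+1) * (1/2)^(N+1) := by rw [← mul_pow]; norm_num
      _ ≤ _ := mul_le_mul_of_nonneg_right (h7.trans h6) (by positivity)
  set e : ℝ := (1/2)^(N+1) with he
  have he0 : 0 < e := by positivity
  have he1 : e ≤ 1/2 := by
    rw [he, pow_succ]
    have : (1/2 : ℝ)^N ≤ 1 := pow_le_one₀ (by norm_num) (by norm_num)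
    linarith
  have h9 : Real.exp z * (1 - e) ≤ TE N z := by linarith
  have h10 : 1 ≤ Real.exp (2 * e) * (1 - e) := by
    have := Real.add_one_le_exp (2*e)
    nlinarith
  calc Real.exp z = Real.exp z * 1 := (mul_one _).symm
    _ ≤ Real.exp z * (Real.exp (2 * e) * (1 - e)) := mul_le_mul_of_nonneg_left h10 (Real.exp_pos z).le
    _ = Real.exp (2 * e) * (Real.exp z * (1 - e)) := by ring
    _ ≤ _ := mul_le_mul_of_nonneg_left h9 (Real.exp_pos _).le


lemma mertens_aux (n : ℕ) : ∑ p ∈ (Finset.range (n+1)).filter Nat.Prime, Real.log p / p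
    ≤ Chebyshev.theta n / (n+1) + Real.log 4 * Real.log (n+1) := by
  induction n with
  | zero => simp [Finset.sum_filter]
  | succ n ih =>
    have hth : Chebyshev.theta ((n+1 : ℕ) : ℝ) = Chebyshev.theta (n:ℝ) + (if (n+1).Prime then Real.log ((n+1 : ℕ) : ℝ) else 0) := by
      have h : ∀ m : ℕ, Chebyshev.theta (m : ℝ) = ∑ p ∈ (Finset.range (m+1)).filter Nat.Prime, Real.log p := by
        intro m
        rw [Chebyshev.theta_eq_sum_Icc, Nat.floor_natCast]
        congr 1
        ext p; simp
      rw [h, h, Finset.sum_filter, Finset.sum_filter, Finset.sum_range_succ]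
    have hs : ∑ p ∈ (Finset.range (n+1+1)).filter Nat.Prime, Real.log p / p
        = ∑ p ∈ (Finset.range (n+1)).filter Nat.Prime, Real.log p / p + (if (n+1).Prime then Real.log ((n+1 : ℕ) : ℝ) / ((n+1 : ℕ) : ℝ) else 0) := by
      rw [Finset.sum_filter, Finset.sum_filter, Finset.sum_range_succ]
    have h1 : Chebyshev.theta ((n+1 : ℕ) : ℝ) ≤ Real.log 4 * ((n+1 : ℕ) : ℝ) := Chebyshev.theta_le_log4_mul_x (by positivity)
    have h2 : 1 / ((n:ℝ)+2) ≤ Real.log (n+1+1) - Real.log (n+1) := by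
      rw [← Real.log_div (by positivity) (by positivity)]
      have := Real.one_sub_inv_le_log_of_pos (x := ((n:ℝ)+1+1)/(n+1)) (by positivity)
      refine le_trans (le_of_eq ?_) this
      field_simp
      ring
    have h4 : 0 < Real.log 4 := Real.log_pos (by norm_num)
    rw [hs]
    have hkey : (if (n+1).Prime then Real.log ((n+1 : ℕ) : ℝ) / ((n+1 : ℕ) : ℝ) else 0)
        = (Chebyshev.theta ((n+1 : ℕ) : ℝ) - Chebyshev.theta (n:ℝ)) / (n+1) := by
      rw [hth]; split_ifs <;> simp
    rw [hkey]
    push_cast at h1 ⊢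
    have h5 : Chebyshev.theta ((n:ℝ)+1) / (n+1) - Chebyshev.theta ((n:ℝ)+1) / (n+1+1) ≤ Real.log 4 * (1/((n:ℝ)+2)) := by
      have : Chebyshev.theta ((n:ℝ)+1) / (n+1) - Chebyshev.theta ((n:ℝ)+1) / (n+1+1) = Chebyshev.theta ((n:ℝ)+1) * (1/((n+1)*(n+2))) := by
        field_simp; ring
      rw [this]
      calc _ ≤ (Real.log 4 * ((n:ℝ)+1)) * (1/((n+1)*(n+2))) := by gcongr
        _ = _ := by field_simp
    have h6 := mul_le_mul_of_nonneg_left h2 h4.le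
    have h7 : (Chebyshev.theta ((n:ℝ)+1) - Chebyshev.theta (n:ℝ)) / (n+1) = Chebyshev.theta ((n:ℝ)+1)/(n+1) - Chebyshev.theta (n:ℝ)/(n+1) := sub_div _ _ _
    rw [h7]
    nlinarith

lemma block_sum (L : ℝ) (hL : 1 ≤ L) (P : Finset ℕ) (hP : ∀ p ∈ P, p.Prime ∧ L ≤ Real.log p ∧ Real.log p ≤ 16 * L) :
    ∑ p ∈ P, 1 / (p : ℝ) ≤ 25 := by
  set n := ⌊Real.exp (16*L)⌋₊ with hn
  have h1 := mertens_aux n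
  have hsub : P ⊆ (Finset.range (n+1)).filter Nat.Prime := by
    intro p hp
    obtain ⟨h, -, h3⟩ := hP p hp
    rw [Finset.mem_filter, Finset.mem_range, Nat.lt_succ_iff]
    refine ⟨Nat.le_floor ?_, h⟩
    rwa [← Real.log_le_iff_le_exp (by exact_mod_cast h.pos)]
  have h2 : L * ∑ p ∈ P, 1 / (p : ℝ) ≤ ∑ p ∈ P, Real.log p / p := by
    rw [Finset.mul_sum]
    refine Finset.sum_le_sum fun p hp => ?_
    rw [mul_one_div]
    exact div_le_div_of_nonneg_right (hP p hp).2.1 (by positivity)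
  have h3 : ∑ p ∈ P, Real.log p / p ≤ ∑ p ∈ (Finset.range (n+1)).filter Nat.Prime, Real.log p / p := by
    refine Finset.sum_le_sum_of_subset_of_nonneg hsub fun p _ _ => ?_
    exact div_nonneg (Real.log_natCast_nonneg p) (Nat.cast_nonneg p)
  have h4 : Chebyshev.theta n / (n+1) ≤ Real.log 4 := by
    rw [div_le_iff₀ (by positivity)]
    have := Chebyshev.theta_le_log4_mul_x (x := (n:ℝ)) (by positivity)
    have h4 : 0 < Real.log 4 := Real.log_pos (by norm_num)
    nlinarith
  have h5 : Real.log (n+1) ≤ Real.log 2 + 16 * L := by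
    have : (n:ℝ) + 1 ≤ 2 * Real.exp (16*L) := by
      have h6 : (n:ℝ) ≤ Real.exp (16*L) := Nat.floor_le (Real.exp_pos _).le
      have := Real.one_le_exp (x := 16*L) (by linarith)
      linarith
    calc Real.log (n+1) ≤ Real.log (2 * Real.exp (16*L)) := Real.log_le_log (by positivity) this
      _ = _ := by rw [Real.log_mul (by norm_num) (Real.exp_pos _).ne', Real.log_exp]
  have h6 : Real.log 4 = 2 * Real.log 2 := by
    rw [show (4:ℝ) = 2^2 by norm_num, Real.log_pow]; norm_num
  have h7 := Real.log_two_lt_d9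
  have h8 := Real.log_two_gt_d9
  have h9 : Real.log 4 * Real.log (n+1) ≤ Real.log 4 * (Real.log 2 + 16 * L) := mul_le_mul_of_nonneg_left h5 (by linarith)
  have h10 : L * ∑ p ∈ P, 1 / (p : ℝ) ≤ L * 25 := by
    have h11 : Real.log 4 ≤ 1.4 := by rw [h6]; linarith
    have h12 : Real.log 4 * (Real.log 2 + 16 * L) ≤ 1.4 * (0.7 + 16 * L) := by
      apply mul_le_mul h11 (by linarith) (by linarith) (by norm_num)
    linarith
  exact le_of_mul_le_mul_left h10 (by linarith)


/-- logarithm of the j-th scale -/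
noncomputable def lx (E q j : ℕ) : ℝ := Real.log q / (16 * (1600 * (E:ℝ)^2) * 16^j)

noncomputable def xx (E q j : ℕ) : ℝ := Real.exp (lx E q j)

noncomputable def pset (x : ℝ) : Finset ℕ := (Finset.range (⌊x⌋₊ + 1)).filter Nat.Prime

open Classical in
noncomputable def blk (E q R j : ℕ) : Finset ℕ := (pset (xx E q j)).filter (fun p => j < R → xx E q (j+1) < p)

lemma mem_pset (x : ℝ) (hx : 0 ≤ x) (p : ℕ) : p ∈ pset x ↔ p.Prime ∧ (p:ℝ) ≤ x := by
  unfold pset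
  rw [Finset.mem_filter, Finset.mem_range, Nat.lt_succ_iff, Nat.le_floor_iff hx, and_comm]

lemma xx_pos (E q j : ℕ) : 0 < xx E q j := Real.exp_pos _

lemma log_xx (E q j : ℕ) : Real.log (xx E q j) = lx E q j := Real.log_exp _

lemma mem_blk (E q R j p : ℕ) : p ∈ blk E q R j ↔ p.Prime ∧ (p:ℝ) ≤ xx E q j ∧ (j < R → xx E q (j+1) < p) := by
  unfold blk
  rw [Finset.mem_filter, mem_pset _ (xx_pos E q j).le, and_assoc]

lemma lx_nonneg (E q j : ℕ) : 0 ≤ lx E q j := div_nonneg (Real.log_natCast_nonneg q) (by positivity)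

lemma lx_succ (E q j : ℕ) : lx E q j = 16 * lx E q (j+1) := by
  unfold lx
  rw [pow_succ (16:ℝ) j, show 16 * (1600 * (E:ℝ)^2) * (16^j*16) = (16 * (1600 * (E:ℝ)^2) * 16^j) * 16 by ring, ← div_div]
  ring

lemma lx_anti (E q : ℕ) {i j : ℕ} (h : i ≤ j) : lx E q j ≤ lx E q i := by
  induction j, h using Nat.le_induction with
  | base => exact le_rfl
  | succ j _ ih =>
    have := lx_succ E q j
    have := lx_nonneg E q (j+1)
    linarith

lemma xx_anti (E q : ℕ) {i j : ℕ} (h : i ≤ j) : xx E q j ≤ xx E q i := Real.exp_le_exp.2 (lx_anti E q h)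

lemma blk_biUnion (E q R r : ℕ) (hr : r ≤ R) : (Finset.Icc r R).biUnion (blk E q R) = pset (xx E q r) := by
  ext p
  rw [Finset.mem_biUnion, mem_pset _ (xx_pos E q r).le]
  constructor
  · rintro ⟨i, hi, hp⟩
    rw [mem_blk] at hp
    rw [Finset.mem_Icc] at hi
    exact ⟨hp.1, hp.2.1.trans (xx_anti E q hi.1)⟩
  · rintro ⟨hp, hpx⟩
    classical
    set i := Nat.findGreatest (fun i => (p:ℝ) ≤ xx E q i) R with hi
    have h1 : r ≤ i := Nat.le_findGreatest hr hpx
    have h2 : i ≤ R := Nat.findGreatest_le R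
    have h3 : (p:ℝ) ≤ xx E q i := Nat.findGreatest_spec (P := fun i => (p:ℝ) ≤ xx E q i) hr hpx
    refine ⟨i, Finset.mem_Icc.2 ⟨h1, h2⟩, (mem_blk E q R i p).2 ⟨hp, h3, fun hlt => ?_⟩⟩
    by_contra hcon
    push Not at hcon
    have := Nat.le_findGreatest (P := fun i => (p:ℝ) ≤ xx E q i) (show i+1 ≤ R by omega) hcon
    omega

lemma blk_disj (E q R : ℕ) {i j : ℕ} (hij : i < j) (hj : j ≤ R) : Disjoint (blk E q R j) (blk E q R i) := by
  rw [Finset.disjoint_left]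
  intro p hp hp'
  rw [mem_blk] at hp hp'
  have h1 := hp'.2.2 (by omega)
  have h2 := xx_anti E q (show i+1 ≤ j by omega)
  linarith [hp.2.1]

lemma blk_pd (E q R r : ℕ) : ((Finset.Icc r R : Finset ℕ) : Set ℕ).PairwiseDisjoint (blk E q R) := by
  intro i hi j hj hij
  rw [Finset.mem_coe, Finset.mem_Icc] at hi hj
  rcases lt_or_gt_of_ne hij with h | h
  · exact (blk_disj E q R h hj.2).symm
  · exact blk_disj E q R h hi.2

lemma geom_half (r R : ℕ) : ∑ i ∈ Finset.Icc r R, (1/2 : ℝ)^i ≤ 2 := by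
  calc ∑ i ∈ Finset.Icc r R, (1/2 : ℝ)^i ≤ ∑ i ∈ Finset.range (R+1), (1/2 : ℝ)^i := by
        refine Finset.sum_le_sum_of_subset_of_nonneg (fun i hi => ?_) fun _ _ _ => by positivity
        rw [Finset.mem_Icc] at hi; rw [Finset.mem_range]; omega
    _ ≤ 2 := by
        rw [geom_sum_eq (by norm_num)]
        have : (0:ℝ) ≤ (1/2)^(R+1) := by positivity
        rw [div_le_iff_of_neg (by norm_num)]
        linarith

def NN (E i : ℕ) : ℕ := 10 * (40 * E^2) * 8^i

def ss (E j : ℕ) : ℕ := 1600 * E^2 * 16^j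

noncomputable def MM (E i : ℕ) : ℝ := 40 * (E:ℝ)^2 * 8^i

lemma len_bound (E q R r : ℕ) (hE : 0 < E) (hq : 1 < q) (yQ : ℝ) (s : ℕ) (hyQ : (yQ^2)^(2*s) ≤ Real.exp (Real.log q / 4)) :
    (∏ i ∈ Finset.Icc r R, ((xx E q i^2)^(NN E i))^2) * (yQ^2)^(2*s) < q := by
  have hE' : (0:ℝ) < E := by exact_mod_cast hE
  have hq' : (1:ℝ) < q := by exact_mod_cast hq
  have hlq := Real.log_pos hq'
  have h1 : ∀ i, ((xx E q i^2)^(NN E i))^2 = Real.exp (Real.log q * (1/16) * (1/2)^i) := by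
    intro i
    unfold xx
    rw [← pow_mul, ← pow_mul, ← Real.exp_nat_mul]
    congr 1
    unfold NN lx
    push_cast
    rw [show (16:ℝ)^i = 8^i * 2^i by rw [← mul_pow]; norm_num, one_div_pow]
    field_simp
    norm_num
  rw [Finset.prod_congr rfl (fun i _ => h1 i), ← Real.exp_sum, ← Finset.mul_sum]
  have h2 := geom_half r R
  calc _ ≤ Real.exp (Real.log q * (1/16) * 2) * Real.exp (Real.log q / 4) := by
        gcongr
    _ = Real.exp (Real.log q * (3/8)) := by rw [← Real.exp_add]; congr 1; ring
    _ < Real.exp (Real.log q) := by apply Real.exp_lt_exp.2; linarith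
    _ = q := Real.exp_log (by linarith)

lemma len_Q (E q j : ℕ) (hE : 0 < E) : (xx E q j^2)^(2*ss E j) = Real.exp (Real.log q / 4) := by
  have hE' : (0:ℝ) < E := by exact_mod_cast hE
  unfold xx
  rw [← pow_mul, ← Real.exp_nat_mul]
  congr 1
  unfold ss lx
  push_cast
  field_simp
  ring

lemma xx_lt (E q j : ℕ) (hE : 0 < E) (hq : 1 < q) : xx E q j < q := by
  have hE' : (1:ℝ) ≤ E := by exact_mod_cast hE
  have hq' : (1:ℝ) < q := by exact_mod_cast hq
  have hlq := Real.log_pos hq'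
  refine lt_of_le_of_lt (xx_anti E q (Nat.zero_le j)) ?_
  calc xx E q 0 < Real.exp (Real.log q) := by
        apply Real.exp_lt_exp.2
        unfold lx
        rw [div_lt_iff₀ (by positivity)]
        have : (1:ℝ) < 16 * (1600 * (E:ℝ)^2) * 16^0 := by nlinarith
        nlinarith
    _ = q := Real.exp_log (by linarith)

/-- constant for the convergent prime sums -/
noncomputable def Z32 : ℝ := ∑' n : ℕ, (n:ℝ)^(-(3/2) : ℝ)

lemma Z32_bound (P : Finset ℕ) : ∑ p ∈ P, (p:ℝ)^(-(3/2) : ℝ) ≤ Z32 :=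
  (Real.summable_nat_rpow.2 (by norm_num)).sum_le_tsum _ (fun n _ => by positivity)

lemma term_bound (U S η : ℝ) (p : ℕ) (hp : 0 < p) (hU : 0 ≤ U) (hUS : U ≤ S) (hη : 0 ≤ η) :
    (U * (p:ℝ)^(-(1/2 + η)))^2/4 + (S/p)^2/4 + (U * (p:ℝ)^(-(1/2 + η)) + S/p)^3 * Real.exp (U * (p:ℝ)^(-(1/2 + η)) + S/p)
      ≤ 1/4 * (U^2 * (p:ℝ)^(-(1+2*η))) + (S^2 + 8 * S^3 * Real.exp (2*S)) * (p:ℝ)^(-(3/2) : ℝ) := by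
  have hp1 : (1:ℝ) ≤ p := by exact_mod_cast hp
  have hp0 : (0:ℝ) < p := by linarith
  have hS : 0 ≤ S := hU.trans hUS
  set w : ℝ := (p:ℝ)^(-(1/2) : ℝ) with hw
  have hw0 : 0 < w := by positivity
  have hw1 : w ≤ 1 := Real.rpow_le_one_of_one_le_of_nonpos hp1 (by norm_num)
  have e1 : (U * (p:ℝ)^(-(1/2 + η)))^2/4 = 1/4 * (U^2 * (p:ℝ)^(-(1+2*η))) := by
    rw [mul_pow, ← Real.rpow_natCast ((p:ℝ)^(-(1/2 + η))) 2, ← Real.rpow_mul hp0.le]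
    rw [show (-(1/2+η)) * ((2:ℕ):ℝ) = -(1+2*η) by push_cast; ring]
    ring
  have e2 : (p:ℝ)^(-(3/2) : ℝ) = w^3 := by
    rw [hw, ← Real.rpow_natCast, ← Real.rpow_mul hp0.le]; norm_num
  have e3 : 1/(p:ℝ) = w^2 := by
    rw [hw, ← Real.rpow_natCast, ← Real.rpow_mul hp0.le, one_div, ← Real.rpow_neg_one]; norm_num
  have h1 : U * (p:ℝ)^(-(1/2 + η)) ≤ S * w := by
    apply mul_le_mul hUS _ (by positivity) hS
    exact Real.rpow_le_rpow_of_exponent_le hp1 (by linarith)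
  have h2 : S / p = S * w^2 := by rw [← e3]; ring
  have hww : w^2 ≤ w := by nlinarith
  have h3 : U * (p:ℝ)^(-(1/2 + η)) + S/p ≤ 2 * S * w := by
    rw [h2]; nlinarith
  have h30 : 0 ≤ U * (p:ℝ)^(-(1/2 + η)) + S/p := by positivity
  have h4 : (S/p)^2/4 ≤ S^2 * w^3 := by
    rw [h2]
    have : (S*w^2)^2/4 = S^2 * w^3 * (w/4) := by ring
    rw [this]
    apply mul_le_of_le_one_right (by positivity); linarith
  have h5 : (U * (p:ℝ)^(-(1/2 + η)) + S/p)^3 * Real.exp (U * (p:ℝ)^(-(1/2 + η)) + S/p) ≤ (2*S*w)^3 * Real.exp (2*S) := by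
    apply mul_le_mul (pow_le_pow_left₀ h30 h3 3) _ (Real.exp_pos _).le (by positivity)
    apply Real.exp_le_exp.2
    refine h3.trans ?_
    nlinarith
  rw [e1, e2]
  have : (2*S*w)^3 * Real.exp (2*S) = 8 * S^3 * Real.exp (2*S) * w^3 := by ring
  nlinarith


/-- truncated product for the scale `r` -/
noncomputable def DD {n : ℕ} (a t : Fin n → ℝ) (E q R r : ℕ) (f : ℕ →* ℂ) : ℝ :=
  ∏ i ∈ Finset.Icc r R, TE (NN E i) (Xf (blk E q R i) (cc a t (xx E q r)) (dd a t (xx E q r)) f / 2)^2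

theorem moment_app {n : ℕ} (a : Fin n → ℝ) (ha : ∀ j, 0 < a j) : ∃ C1 : ℝ, 0 < C1 ∧ ∀ (q : ℕ) [NeZero q], 1 < q →
    dirichletRH (1 : DirichletCharacter ℂ q) → ∀ (E : ℕ), 0 < E → ∀ R r : ℕ, r ≤ R → 320 * kapm ≤ lx E q r →
    ∀ (t : Fin n → ℝ) (Q : Finset ℕ) (c' d' : ℕ → ℂ) (u' v' : ℕ → ℝ) (yQ : ℝ) (s : ℕ) (l : ℝ), 0 < l → 1 ≤ yQ →
    (∀ p ∈ Q, p.Prime ∧ p < q ∧ (p : ℝ) ≤ yQ) → (∀ i ∈ Finset.Icc r R, Disjoint (blk E q R i) Q) →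
    (∀ p, 0 ≤ u' p) → (∀ p, 0 ≤ v' p) →
    (∀ p, p.Prime → ‖c' p‖ ≤ u' p) → (∀ p, p.Prime → ‖d' p‖ ≤ v' p) →
    ((yQ^2)^(2*s) ≤ Real.exp (Real.log q / 4)) →
    ∑ χ : DirichletCharacter ℂ q, DD a t E q R r (chom χ) * Xf Q c' d' (chom χ)^(2*s) ≤
      q.totient * (((2*s).factorial / l^(2*s)) * ((C1 * Wq a t q) * Real.exp (∑ p ∈ Q, l^2 * (u' p+v' p)^2/2))) := by
  obtain ⟨C, hC, hvar⟩ := var_bound a ha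
  set S := ∑ j, a j with hSd
  have hS : 0 ≤ S := Finset.sum_nonneg fun j _ => (ha j).le
  refine ⟨C * Real.exp ((S^2 + 8 * S^3 * Real.exp (2*S)) * Z32), by positivity, ?_⟩
  intro q _ hq hRH E hE R r hr hlx t Q c' d' u' v' yQ s l hl hyQ hQ hdis hu' hv' hcu' hdv' hlen
  have hq' : (1:ℝ) < q := by exact_mod_cast hq
  have hlq := Real.log_pos hq'
  have hk := kapm_ge
  set x := xx E q r with hx
  have hlogx : Real.log x = lx E q r := log_xx E q r
  have hlx0 : 0 < lx E q r := by linarith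
  have hx1 : 1 < x := by
    rw [hx, xx]; exact Real.one_lt_exp_iff.2 hlx0
  set η := 8 * kapm / Real.log x with hη
  have hη0 : 0 ≤ η := by rw [hη, hlogx]; positivity
  set U : ℕ → ℝ := fun p => ‖∑ j, (a j : ℂ) * (p : ℂ) ^ (-(t j : ℂ) * I)‖ with hU
  set u : ℕ → ℝ := fun p => U p * (p:ℝ)^(-(1/2 + η)) with hu
  set v : ℕ → ℝ := fun p => S / p with hv
  have hxl : lx E q r ≤ Real.log q := by
    rw [← hlogx]
    exact Real.log_le_log (by linarith) (xx_lt E q r hE hq).le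
  have hblk : ∀ i, ∀ p ∈ blk E q R i, p.Prime ∧ p < q ∧ (p : ℝ) ≤ xx E q i := by
    intro i p hp
    rw [mem_blk] at hp
    refine ⟨hp.1, ?_, hp.2.1⟩
    have := hp.2.1.trans_lt (xx_lt E q i hE hq)
    exact_mod_cast this
  have hm := moment q (Finset.Icc r R) (blk E q R) Q (cc a t x) (dd a t x) c' d' u v u' v' (fun i => xx E q i) yQ
    (NN E) s l hl (fun i _ => Real.one_le_exp (lx_nonneg E q i)) hyQ (fun i _ => hblk i) hQ (blk_pd E q R r) hdis
    (fun p => by positivity) (fun p => by positivity) hu' hv'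
    (fun p hp => cc_norm a t x p hp.pos) (fun p hp => dd_norm a t ha x hx1 p hp.pos) hcu' hdv'
    (len_bound E q R r hE hq yQ s hlen)
  refine hm.trans ?_
  refine mul_le_mul_of_nonneg_left (mul_le_mul_of_nonneg_left (mul_le_mul_of_nonneg_right ?_ (Real.exp_pos _).le) (by positivity)) (by positivity)
  rw [← Finset.sum_biUnion (blk_pd E q R r), blk_biUnion E q R r hr, ← hx]
  have hpr : ∀ p ∈ pset x, p.Prime := fun p hp => ((mem_pset x (by linarith) p).1 hp).1
  have hv2 := hvar q hq hRH t (2*η) (by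
      rw [hη, hlogx, ← mul_div_assoc]
      apply div_le_div₀ (by linarith) (by linarith) hlx0 hxl)
    (by rw [hη, hlogx, ← mul_div_assoc, div_le_one hlx0]; linarith) (pset x) hpr
  calc _ ≤ Real.exp (1/4 * ∑ p ∈ pset x, U p^2 * (p:ℝ)^(-(1+2*η)) + (S^2 + 8 * S^3 * Real.exp (2*S)) * ∑ p ∈ pset x, (p:ℝ)^(-(3/2) : ℝ)) := by
        apply Real.exp_le_exp.2
        rw [Finset.mul_sum, Finset.mul_sum, ← Finset.sum_add_distrib]
        refine Finset.sum_le_sum fun p hp => ?_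
        exact term_bound (U p) S η p (hpr p hp).pos (norm_nonneg _) (asum_norm a t ha p (hpr p hp).pos) hη0
    _ ≤ (C * Wq a t q) * Real.exp ((S^2 + 8 * S^3 * Real.exp (2*S)) * Z32) := by
        rw [Real.exp_add]
        refine mul_le_mul hv2 ?_ (Real.exp_pos _).le ((Real.exp_pos _).le.trans hv2)
        apply Real.exp_le_exp.2
        exact mul_le_mul_of_nonneg_left (Z32_bound _) (by positivity)
    _ = _ := by ring

theorem moment_main {n : ℕ} (a : Fin n → ℝ) (ha : ∀ j, 0 < a j) : ∃ C1 : ℝ, 0 < C1 ∧ ∀ (q : ℕ) [NeZero q], 1 < q →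
    dirichletRH (1 : DirichletCharacter ℂ q) → ∀ (E : ℕ), 0 < E → ∀ R : ℕ, 320 * kapm ≤ lx E q R → ∀ (t : Fin n → ℝ),
    (∑ χ : DirichletCharacter ℂ q, DD a t E q R 0 (chom χ) ≤ q.totient * (C1 * Wq a t q)) ∧
    ∀ j < R, ∀ m ≤ j, ∑ χ : DirichletCharacter ℂ q, DD a t E q R (j+1) (chom χ) *
      Xf (blk E q R j) (cc a t (xx E q m)) (dd a t (xx E q m)) (chom χ)^(2*ss E j) ≤
      q.totient * (C1 * Wq a t q) * ((4 * ss E j) * Real.exp (50 * (∑ j, a j)^2)) ^ (ss E j) := by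
  obtain ⟨C1, hC1, h⟩ := moment_app a ha
  refine ⟨C1, hC1, ?_⟩
  intro q _ hq hRH E hE R hlx t
  have hk := kapm_ge
  have hq' : (1:ℝ) < q := by exact_mod_cast hq
  have hlq := Real.log_pos hq'
  set S := ∑ j, a j with hSd
  have hS : 0 ≤ S := Finset.sum_nonneg fun j _ => (ha j).le
  constructor
  · have := h q hq hRH E hE R 0 (Nat.zero_le R) (hlx.trans (lx_anti E q (Nat.zero_le R))) t ∅ 0 0 0 0 1 0 1 one_pos le_rfl
      (by simp) (by simp) (fun _ => le_rfl) (fun _ => le_rfl) (by simp) (by simp) (by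
        simpa using by positivity)
    simpa using this
  · intro j hj m hm
    set s := ss E j with hs
    have hs0 : 0 < s := by rw [hs, ss]; positivity
    have hs0' : (0:ℝ) < s := by exact_mod_cast hs0
    have hxm : 1 < xx E q m := by
      rw [xx]; apply Real.one_lt_exp_iff.2
      have := lx_anti E q (show m ≤ R by omega)
      linarith
    have h1 := h q hq hRH E hE R (j+1) hj (hlx.trans (lx_anti E q hj)) t (blk E q R j) (cc a t (xx E q m)) (dd a t (xx E q m))
      (fun p => S * (p:ℝ)^(-(1/2) : ℝ)) (fun p => S / p) (xx E q j) s (Real.sqrt s) (Real.sqrt_pos.2 hs0') (Real.one_le_exp (lx_nonneg E q j))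
      (by
        intro p hp
        rw [mem_blk] at hp
        refine ⟨hp.1, ?_, hp.2.1⟩
        have := hp.2.1.trans_lt (xx_lt E q j hE hq)
        exact_mod_cast this)
      (by
        intro i hi
        rw [Finset.mem_Icc] at hi
        exact blk_disj E q R (by omega) hi.2)
      (fun p => by positivity) (fun p => by positivity)
      (by
        intro p hp
        refine (cc_norm a t _ p hp.pos).trans ?_
        apply mul_le_mul (asum_norm a t ha p hp.pos) _ (by positivity) hS
        apply Real.rpow_le_rpow_of_exponent_le (by exact_mod_cast hp.one_lt.le)
        have : 0 ≤ 8 * kapm / Real.log (xx E q m) := by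
          apply div_nonneg (by linarith) (Real.log_pos hxm).le
        linarith)
      (fun p hp => dd_norm a t ha _ hxm p hp.pos) (len_Q E q j hE).le
    refine h1.trans ?_
    rw [mul_assoc (q.totient : ℝ)]
    refine mul_le_mul_of_nonneg_left ?_ (by positivity)
    have hW : 0 ≤ C1 * Wq a t q := by
      have := h q hq hRH E hE R R le_rfl hlx t ∅ 0 0 0 0 1 0 1 one_pos le_rfl
        (by simp) (by simp) (fun _ => le_rfl) (fun _ => le_rfl) (by simp) (by simp) (by
          simpa using by positivity)
      simp at this
      have h0 : 0 ≤ ∑ χ : DirichletCharacter ℂ q, DD a t E q R R (chom χ) :=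
        Finset.sum_nonneg fun χ _ => Finset.prod_nonneg fun i _ => sq_nonneg _
      have h2 : (0:ℝ) < q.totient := by exact_mod_cast Nat.totient_pos.2 (by omega)
      have h3 := h0.trans this
      exact nonneg_of_mul_nonneg_right h3 h2
    have h2 : Real.exp (∑ p ∈ blk E q R j, Real.sqrt s^2 * (S * (p:ℝ)^(-(1/2) : ℝ) + S / p)^2/2) ≤ Real.exp (50 * S^2)^s := by
      rw [← Real.exp_nat_mul]
      apply Real.exp_le_exp.2
      have hb := block_sum (lx E q (j+1)) (by have := lx_anti E q (show j+1 ≤ R by omega); linarith) (blk E q R j) (by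
        intro p hp
        rw [mem_blk] at hp
        have hp0 : (0:ℝ) < p := by exact_mod_cast hp.1.pos
        refine ⟨hp.1, ?_, ?_⟩
        · rw [← log_xx]; exact Real.log_le_log (xx_pos _ _ _) (hp.2.2 hj).le
        · rw [← lx_succ, ← log_xx]; exact Real.log_le_log hp0 hp.2.1)
      calc _ ≤ ∑ p ∈ blk E q R j, (s * (2 * S^2)) * (1 / (p:ℝ)) := by
            refine Finset.sum_le_sum fun p hp => ?_
            rw [mem_blk] at hp
            rw [Real.sq_sqrt hs0'.le]
            have hp1 : (1:ℝ) ≤ p := by exact_mod_cast hp.1.one_lt.le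
            have hp0 : (0:ℝ) < p := by linarith
            set w : ℝ := (p:ℝ)^(-(1/2) : ℝ) with hw
            have hw0 : 0 < w := by positivity
            have hw1 : w ≤ 1 := Real.rpow_le_one_of_one_le_of_nonpos hp1 (by norm_num)
            have e3 : 1/(p:ℝ) = w^2 := by
              rw [hw, ← Real.rpow_natCast, ← Real.rpow_mul hp0.le, one_div, ← Real.rpow_neg_one]; norm_num
            rw [div_eq_mul_one_div S, e3]
            have h3 : S * w + S * w^2 ≤ 2 * S * w := by nlinarith [mul_nonneg hS hw0.le]
            have h4 : (S * w + S * w^2)^2 ≤ (2*S*w)^2 := pow_le_pow_left₀ (by positivity) h3 2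
            calc _ ≤ (s:ℝ) * (2*S*w)^2/2 := by gcongr
              _ = _ := by ring
        _ = (s * (2 * S^2)) * ∑ p ∈ blk E q R j, (1 / (p:ℝ)) := by rw [Finset.mul_sum]
        _ ≤ (s * (2 * S^2)) * 25 := mul_le_mul_of_nonneg_left hb (by positivity)
        _ = _ := by ring
    have h3 : ((2*s).factorial : ℝ) / (Real.sqrt s)^(2*s) ≤ (4*s)^s := by
      rw [pow_mul, Real.sq_sqrt hs0'.le, div_le_iff₀ (by positivity)]
      have : ((2*s).factorial : ℝ) ≤ ((2*s : ℕ) : ℝ)^(2*s) := by exact_mod_cast Nat.factorial_le_pow (2*s)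
      refine this.trans (le_of_eq ?_)
      rw [pow_mul, ← mul_pow]; push_cast; congr 1; ring
    calc _ ≤ ((4*s:ℝ)^s) * ((C1 * Wq a t q) * Real.exp (50 * S^2)^s) := by
          refine mul_le_mul h3 (mul_le_mul_of_nonneg_left h2 hW) (by positivity) (by positivity)
      _ = _ := by rw [mul_pow]; ring


lemma NN_ge (E i : ℕ) (hE : 0 < E) : i ≤ NN E i := by
  unfold NN
  have h1 : i < 8^i := Nat.lt_pow_self (by norm_num)
  have h2 : 1 ≤ 10 * (40 * E^2) := by have := pow_pos hE 2; omega
  nlinarith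

lemma good_bound {n : ℕ} (a t : Fin n → ℝ) (E q R r : ℕ) (hE : 0 < E) (hr : r ≤ R) (f : ℕ →* ℂ)
    (h : ∀ i ∈ Finset.Icc r R, |Xf (blk E q R i) (cc a t (xx E q r)) (dd a t (xx E q r)) f| ≤ MM E i) :
    Real.exp (Xf (pset (xx E q r)) (cc a t (xx E q r)) (dd a t (xx E q r)) f) ≤ Real.exp 4 * DD a t E q R r f := by
  rw [← blk_biUnion E q R r hr, Xf_biUnion _ _ (blk_pd E q R r), Real.exp_sum]
  set X : ℕ → ℝ := fun i => Xf (blk E q R i) (cc a t (xx E q r)) (dd a t (xx E q r)) f with hX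
  have h1 : ∀ i ∈ Finset.Icc r R, Real.exp (X i) ≤ Real.exp (2 * (1/2)^i) * TE (NN E i) (X i / 2)^2 := by
    intro i hi
    have h2 := exp_le_TE (X i / 2) (NN E i) (by
      have h3 := h i hi
      have h4 : ((NN E i : ℕ) : ℝ) = 10 * MM E i := by
        unfold NN MM; push_cast; ring
      rw [abs_div, h4, abs_two]
      simp only [hX]
      linarith)
    have h3 : Real.exp (X i) = Real.exp (X i / 2)^2 := by
      rw [← Real.exp_nat_mul]; congr 1; push_cast; ring
    rw [h3]
    refine (pow_le_pow_left₀ (Real.exp_pos _).le h2 2).trans ?_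
    rw [mul_pow]
    refine mul_le_mul_of_nonneg_right ?_ (sq_nonneg _)
    rw [← Real.exp_nat_mul]
    apply Real.exp_le_exp.2
    have h5 : (1/2 : ℝ)^(NN E i + 1) ≤ (1/2)^(i+1) :=
      pow_le_pow_of_le_one (by norm_num) (by norm_num) (by have := NN_ge E i hE; omega)
    rw [pow_succ (1/2 : ℝ) i] at h5
    push_cast
    linarith
  calc _ ≤ ∏ i ∈ Finset.Icc r R, (Real.exp (2 * (1/2)^i) * TE (NN E i) (X i / 2)^2) :=
        Finset.prod_le_prod (fun i _ => (Real.exp_pos _).le) h1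
    _ = Real.exp (2 * ∑ i ∈ Finset.Icc r R, (1/2)^i) * DD a t E q R r f := by
        rw [Finset.prod_mul_distrib, ← Real.exp_sum, ← Finset.mul_sum]; rfl
    _ ≤ _ := by
        refine mul_le_mul_of_nonneg_right ?_ (Finset.prod_nonneg fun i _ => sq_nonneg _)
        apply Real.exp_le_exp.2
        have := geom_half r R
        linarith

lemma DD_nonneg {n : ℕ} (a t : Fin n → ℝ) (E q R r : ℕ) (f : ℕ →* ℂ) : 0 ≤ DD a t E q R r f :=
  Finset.prod_nonneg fun i _ => sq_nonneg _

lemma harper_pt {n : ℕ} (a t : Fin n → ℝ) (E q R : ℕ) (hE : 0 < E) (f : ℕ →* ℂ) (Φ C0 : ℝ) (G : ℕ → ℝ)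
    (hΦ : ∀ r ≤ R, Φ ≤ Real.exp (Xf (pset (xx E q r)) (cc a t (xx E q r)) (dd a t (xx E q r)) f + C0 + G r))
    (hR : ∀ m ≤ R, |Xf (blk E q R R) (cc a t (xx E q m)) (dd a t (xx E q m)) f| ≤ MM E R) :
    Φ ≤ Real.exp (C0 + 4) * (Real.exp (G 0) * DD a t E q R 0 f + ∑ j ∈ Finset.range R, ∑ m ∈ Finset.range (j+1),
      Real.exp (G (j+1)) * ((DD a t E q R (j+1) f * Xf (blk E q R j) (cc a t (xx E q m)) (dd a t (xx E q m)) f^(2*ss E j))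
        / (MM E j)^(2 * ss E j))) := by
  classical
  have hMM : ∀ j, 0 < MM E j := by
    intro j; unfold MM
    have : (0:ℝ) < E := by exact_mod_cast hE
    positivity
  have hterm : ∀ j m, 0 ≤ Real.exp (G (j+1)) * ((DD a t E q R (j+1) f * Xf (blk E q R j) (cc a t (xx E q m)) (dd a t (xx E q m)) f^(2*ss E j))
        / (MM E j)^(2 * ss E j)) := by
    intro j m
    refine mul_nonneg (Real.exp_pos _).le (div_nonneg (mul_nonneg (DD_nonneg a t E q R (j+1) f) ?_) (pow_pos (hMM j) _).le)
    rw [pow_mul]; positivity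
  have hgood : ∀ r ≤ R, (∀ i ∈ Finset.Icc r R, |Xf (blk E q R i) (cc a t (xx E q r)) (dd a t (xx E q r)) f| ≤ MM E i) →
      Φ ≤ Real.exp (C0 + 4) * (Real.exp (G r) * DD a t E q R r f) := by
    intro r hr h
    refine (hΦ r hr).trans ?_
    rw [Real.exp_add, Real.exp_add]
    have := good_bound a t E q R r hE hr f h
    calc _ ≤ (Real.exp 4 * DD a t E q R r f) * Real.exp C0 * Real.exp (G r) := by gcongr
      _ = _ := by rw [Real.exp_add]; ring
  set bad : ℕ → Prop := fun j => ∃ m ≤ j, MM E j < |Xf (blk E q R j) (cc a t (xx E q m)) (dd a t (xx E q m)) f| with hbad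
  by_cases hex : ∃ j ≤ R, bad j
  · obtain ⟨j0, hj0, hb0⟩ := hex
    set j := Nat.findGreatest bad R with hj
    have hbj : bad j := Nat.findGreatest_spec hj0 hb0
    have hjR : j ≤ R := Nat.findGreatest_le R
    obtain ⟨m, hm, hbm⟩ := hbj
    have hjR' : j < R := by
      rcases lt_or_eq_of_le hjR with h | h
      · exact h
      · exfalso
        rw [h] at hbm hm
        exact absurd (hR m hm) (not_le.2 hbm)
    have h1 := hgood (j+1) hjR' (by
      intro i hi
      rw [Finset.mem_Icc] at hi
      by_contra hcon
      have : i ≤ j := Nat.le_findGreatest hi.2 ⟨j+1, hi.1, not_le.1 hcon⟩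
      omega)
    refine h1.trans (mul_le_mul_of_nonneg_left ?_ (Real.exp_pos _).le)
    have h2 : Real.exp (G (j+1)) * DD a t E q R (j+1) f ≤ Real.exp (G (j+1)) * ((DD a t E q R (j+1) f * Xf (blk E q R j) (cc a t (xx E q m)) (dd a t (xx E q m)) f^(2*ss E j))
        / (MM E j)^(2 * ss E j)) := by
      refine mul_le_mul_of_nonneg_left ?_ (Real.exp_pos _).le
      rw [mul_div_assoc, ← div_pow]
      refine le_mul_of_one_le_right (DD_nonneg a t E q R (j+1) f) ?_
      rw [pow_mul]
      apply one_le_pow₀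
      rw [div_pow, one_le_div (pow_pos (hMM j) 2), ← sq_abs (Xf _ _ _ _)]
      exact pow_le_pow_left₀ (hMM j).le hbm.le 2
    refine h2.trans ?_
    have h3 : ∀ j ∈ Finset.range R, 0 ≤ ∑ m ∈ Finset.range (j+1), Real.exp (G (j+1)) * ((DD a t E q R (j+1) f * Xf (blk E q R j) (cc a t (xx E q m)) (dd a t (xx E q m)) f^(2*ss E j))
        / (MM E j)^(2 * ss E j)) := fun j _ => Finset.sum_nonneg fun m _ => hterm j m
    have h4 := Finset.single_le_sum (fun m _ => hterm j m) (Finset.mem_range.2 (show m < j+1 by omega))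
    have h5 := Finset.single_le_sum h3 (Finset.mem_range.2 hjR')
    have h6 : 0 ≤ Real.exp (G 0) * DD a t E q R 0 f := mul_nonneg (Real.exp_pos _).le (DD_nonneg a t E q R 0 f)
    linarith
  · push Not at hex
    refine (hgood 0 (Nat.zero_le R) ?_).trans ?_
    · intro i hi
      rw [Finset.mem_Icc] at hi
      by_contra hcon
      exact hex i hi.2 ⟨0, Nat.zero_le i, not_le.1 hcon⟩
    · refine mul_le_mul_of_nonneg_left ?_ (Real.exp_pos _).le
      have : 0 ≤ ∑ j ∈ Finset.range R, ∑ m ∈ Finset.range (j+1), Real.exp (G (j+1)) * ((DD a t E q R (j+1) f * Xf (blk E q R j) (cc a t (xx E q m)) (dd a t (xx E q m)) f^(2*ss E j))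
        / (MM E j)^(2 * ss E j)) := Finset.sum_nonneg fun j _ => Finset.sum_nonneg fun m _ => hterm j m
      linarith

lemma exR (E q R0 : ℕ) (hE : 0 < E) (hq : 1 < q) (h : R0 * (16 * (1600 * (E:ℝ)^2) * 16^R0) < Real.log q) :
    ∃ R, R0 < R ∧ lx E q R ≤ R ∧ ((R0:ℝ)) / 16 ≤ lx E q R := by
  classical
  have hE' : (1:ℝ) ≤ E := by exact_mod_cast hE
  have hq' : (1:ℝ) < q := by exact_mod_cast hq
  have hlq := Real.log_pos hq'
  have hex : ∃ R : ℕ, lx E q R ≤ R := by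
    obtain ⟨R, hR⟩ := exists_nat_ge (Real.log q)
    refine ⟨R, le_trans ?_ hR⟩
    unfold lx
    apply div_le_self hlq.le
    have h1 : (1:ℝ) ≤ 16^R := one_le_pow₀ (by norm_num)
    have h2 : (1:ℝ) ≤ 16 * (1600 * (E:ℝ)^2) := by nlinarith
    nlinarith
  have hR0 : (R0 : ℝ) < lx E q R0 := by
    unfold lx
    rwa [lt_div_iff₀ (by positivity)]
  have h1 : R0 < Nat.find hex := by
    rw [Nat.lt_find_iff]
    intro m hm hcon
    have h2 := lx_anti E q hm
    have h3 : (m:ℝ) ≤ R0 := by exact_mod_cast hm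
    linarith
  refine ⟨Nat.find hex, h1, Nat.find_spec hex, ?_⟩
  obtain ⟨k, hk⟩ : ∃ k, Nat.find hex = k + 1 := ⟨Nat.find hex - 1, by omega⟩
  have h2 := Nat.find_min hex (m := k) (by omega)
  rw [hk] at h1 ⊢
  have h3 := lx_succ E q k
  have h4 : (R0:ℝ) ≤ k := by exact_mod_cast (show R0 ≤ k by omega)
  push Not at h2
  linarith

lemma blkR_bound {n : ℕ} (a t : Fin n → ℝ) (ha : ∀ j, 0 < a j) (E q R m : ℕ) [NeZero q] (χ : DirichletCharacter ℂ q)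
    (hS : ∑ j, a j ≤ (E:ℝ)^2) (h1 : lx E q R ≤ R) (h0 : 0 < lx E q m) :
    |Xf (blk E q R R) (cc a t (xx E q m)) (dd a t (xx E q m)) (chom χ)| ≤ MM E R := by
  set S := ∑ j, a j with hSd
  have hS0 : 0 ≤ S := Finset.sum_nonneg fun j _ => (ha j).le
  have hxm : 1 < xx E q m := Real.one_lt_exp_iff.2 h0
  unfold Xf
  have hb : ∀ p ∈ blk E q R R, |(cc a t (xx E q m) p * chom χ p + dd a t (xx E q m) p * (chom χ p)^2).re| ≤ 2 * S := by
    intro p hp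
    rw [mem_blk] at hp
    have hp1 : (1:ℝ) ≤ p := by exact_mod_cast hp.1.one_lt.le
    have hc := cc_norm a t (xx E q m) p hp.1.pos
    have hd := dd_norm a t ha (xx E q m) hxm p hp.1.pos
    have hχ : ‖chom χ p‖ ≤ 1 := by rw [chom_apply]; exact DirichletCharacter.norm_le_one χ p
    have hk := kapm_ge
    have hc2 : ‖cc a t (xx E q m) p‖ ≤ S := by
      refine hc.trans ?_
      refine (mul_le_of_le_one_right (norm_nonneg _) ?_).trans (asum_norm a t ha p hp.1.pos)
      apply Real.rpow_le_one_of_one_le_of_nonpos hp1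
      have : 0 ≤ 8 * kapm / Real.log (xx E q m) := div_nonneg (by linarith) (Real.log_pos hxm).le
      linarith
    have hd2 : ‖dd a t (xx E q m) p‖ ≤ S := hd.trans (div_le_self hS0 hp1)
    refine (Complex.abs_re_le_norm _).trans ((norm_add_le _ _).trans ?_)
    rw [norm_mul, norm_mul, norm_pow]
    have h2 : ‖chom χ p‖^2 ≤ 1 := pow_le_one₀ (norm_nonneg _) hχ
    have h3 : ‖cc a t (xx E q m) p‖ * ‖chom χ p‖ ≤ S * 1 := mul_le_mul hc2 hχ (norm_nonneg _) hS0
    have h4 : ‖dd a t (xx E q m) p‖ * ‖chom χ p‖^2 ≤ S * 1 := mul_le_mul hd2 h2 (by positivity) hS0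
    linarith
  have hcard : ((blk E q R R).card : ℝ) ≤ 8^R := by
    have h2 : (blk E q R R).card ≤ ⌊xx E q R⌋₊ := by
      have : blk E q R R ⊆ Finset.Icc 1 ⌊xx E q R⌋₊ := by
        intro p hp
        rw [mem_blk] at hp
        rw [Finset.mem_Icc]
        exact ⟨hp.1.one_lt.le, Nat.le_floor hp.2.1⟩
      simpa using Finset.card_le_card this
    calc ((blk E q R R).card : ℝ) ≤ ⌊xx E q R⌋₊ := by exact_mod_cast h2
      _ ≤ xx E q R := Nat.floor_le (xx_pos E q R).le
      _ ≤ Real.exp R := Real.exp_le_exp.2 h1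
      _ = Real.exp 1 ^ R := (Real.exp_one_pow R).symm
      _ ≤ 8^R := by
        apply pow_le_pow_left₀ (Real.exp_pos 1).le
        have := Real.exp_one_lt_d9
        linarith
  refine (Finset.abs_sum_le_sum_abs _ _).trans ((Finset.sum_le_sum hb).trans ?_)
  rw [Finset.sum_const, nsmul_eq_mul]
  unfold MM
  calc ((blk E q R R).card : ℝ) * (2 * S) ≤ 8^R * (40 * (E:ℝ)^2) := by
        apply mul_le_mul hcard (by linarith [sq_nonneg (E:ℝ)]) (by positivity) (by positivity)
    _ = _ := by ring


lemma tail_sum (R : ℕ) : ∑ j ∈ Finset.range R, ((j:ℝ)+1) * (1/4)^(j+1) ≤ 1 := by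
  calc ∑ j ∈ Finset.range R, ((j:ℝ)+1) * (1/4)^(j+1) ≤ ∑ j ∈ Finset.range R, (1/2) * (1/2 : ℝ)^j := by
        refine Finset.sum_le_sum fun j _ => ?_
        have h1 : ((j:ℝ)+1) ≤ 2^(j+1) := by
          have : j + 1 ≤ 2^(j+1) := (Nat.lt_pow_self (by norm_num)).le
          exact_mod_cast this
        calc ((j:ℝ)+1) * (1/4)^(j+1) ≤ 2^(j+1) * (1/4)^(j+1) := by gcongr
          _ = (1/2)^(j+1) := by rw [← mul_pow]; norm_num
          _ = _ := by rw [pow_succ]; ring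
    _ ≤ 1 := by
        rw [← Finset.mul_sum, geom_sum_eq (by norm_num)]
        have : (0:ℝ) ≤ (1/2)^R := by positivity
        have h2 : ((1/2 : ℝ)^R - 1) / (1/2 - 1) ≤ 2 := by
          rw [div_le_iff_of_neg (by norm_num)]
          linarith
        linarith

lemma tail_term (E j : ℕ) (hE : 0 < E) (S C' : ℝ) (h : 16 * (Real.exp (50 * S^2) * Real.exp (256 * C')) ≤ (E:ℝ)^2) :
    Real.exp (256 * C')^(ss E j) * (((4 * ss E j) * Real.exp (50 * S^2)) ^ (ss E j) / (MM E j)^(2 * ss E j)) ≤ (1/4)^(j+1) := by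
  have hE' : (0:ℝ) < E := by exact_mod_cast hE
  rw [pow_mul (MM E j) 2, ← div_pow, ← mul_pow]
  have hs : 1 ≤ ss E j := by
    have : 0 < ss E j := by unfold ss; positivity
    exact this
  have h1 : Real.exp (256 * C') * (4 * (ss E j : ℝ) * Real.exp (50 * S^2) / MM E j ^ 2) ≤ (1/4)^(j+1) := by
    unfold ss MM
    push_cast
    have e : Real.exp (256 * C') * (4 * (1600 * (E:ℝ)^2 * 16^j) * Real.exp (50 * S^2) / (40 * (E:ℝ)^2 * 8^j)^2)
        = (16 * (Real.exp (50 * S^2) * Real.exp (256 * C'))) / (E:ℝ)^2 * (1/4)^(j+1) := by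
      have h8 : ((8:ℝ)^j)^2 = 16^j * 4^j := by rw [← pow_mul, mul_comm, pow_mul, ← mul_pow]; norm_num
      rw [mul_pow, mul_pow, h8, one_div_pow, pow_succ (4:ℝ) j]
      field_simp
      norm_num
    rw [e]
    apply mul_le_of_le_one_left (by positivity)
    rw [div_le_one (by positivity)]
    exact h
  have h0 : 0 ≤ Real.exp (256 * C') * (4 * (ss E j : ℝ) * Real.exp (50 * S^2) / MM E j ^ 2) := by positivity
  calc _ ≤ Real.exp (256 * C') * (4 * (ss E j : ℝ) * Real.exp (50 * S^2) / MM E j ^ 2) := by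
        apply pow_le_of_le_one h0 (h1.trans (pow_le_one₀ (by norm_num) (by norm_num))) (by omega)
    _ ≤ _ := h1

theorem large_q {n : ℕ} (a : Fin n → ℝ) (ha : ∀ j, 0 < a j) (A : ℝ) (hA : 0 < A) : ∃ (C : ℝ) (q0 : ℕ), 0 < C ∧
    ∀ (q : ℕ) [NeZero q], 1 < q → q0 ≤ q → (∀ χ : DirichletCharacter ℂ q, dirichletRH χ) →
    ∀ t : Fin n → ℝ, (∀ j, |t j| ≤ (q : ℝ) ^ A) → ∀ F : Finset (DirichletCharacter ℂ q), (∀ χ ∈ F, χ ≠ 1) →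
    ∑ χ ∈ F, ∏ j, ‖DirichletCharacter.LFunction χ (1 / 2 + (t j) * Complex.I)‖ ^ (a j) ≤ C * (q.totient * Wq a t q) := by
  obtain ⟨C0, C', hC0, hC', hlog⟩ := log_prod_bound a ha A hA
  obtain ⟨C1, hC1, hmom⟩ := moment_main a ha
  set S := ∑ j, a j with hSd
  have hS0 : 0 ≤ S := Finset.sum_nonneg fun j _ => (ha j).le
  obtain ⟨E, hEge⟩ := exists_nat_ge (1 + S + 16 * (Real.exp (50 * S^2) * Real.exp (256 * C')))
  have hpos : 0 < 16 * (Real.exp (50 * S^2) * Real.exp (256 * C')) := by positivity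
  have hE1 : (1:ℝ) ≤ E := by linarith
  have hE : 0 < E := by exact_mod_cast (lt_of_lt_of_le one_pos hE1)
  have hEE : (E:ℝ) ≤ (E:ℝ)^2 := by nlinarith
  obtain ⟨R0, hR0⟩ := exists_nat_ge (16 * (320 * kapm))
  obtain ⟨q0, hq0⟩ := exists_nat_gt (Real.exp (R0 * (16 * (1600 * (E:ℝ)^2) * 16^R0)))
  refine ⟨Real.exp (C0 + 4) * (Real.exp (16 * C' * ss E 0) * C1 + C1), q0, by positivity, ?_⟩
  intro q _ hq hqq hRH t ht F hF
  have hk := kapm_ge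
  have hq' : (1:ℝ) < q := by exact_mod_cast hq
  have hlq := Real.log_pos hq'
  obtain ⟨R, hRR, hR1, hR2⟩ := exR E q R0 hE hq (by
    rw [Real.lt_log_iff_exp_lt (by linarith)]
    exact hq0.trans_le (by exact_mod_cast hqq))
  have hlxR : 320 * kapm ≤ lx E q R := by linarith
  have hlx : ∀ r ≤ R, 320 * kapm ≤ lx E q r := fun r hr => hlxR.trans (lx_anti E q hr)
  obtain ⟨hm0, hmj⟩ := hmom q hq (hRH 1) E hE R hlxR t
  set X : ℕ → ℕ → DirichletCharacter ℂ q → ℝ := fun j m χ => Xf (blk E q R j) (cc a t (xx E q m)) (dd a t (xx E q m)) (chom χ) with hX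
  set G : ℕ → ℝ := fun r => 16 * C' * ss E r with hG
  set H : DirichletCharacter ℂ q → ℝ := fun χ => Real.exp (C0 + 4) * (Real.exp (G 0) * DD a t E q R 0 (chom χ) + ∑ j ∈ Finset.range R, ∑ m ∈ Finset.range (j+1),
      Real.exp (G (j+1)) * ((DD a t E q R (j+1) (chom χ) * X j m χ^(2*ss E j)) / (MM E j)^(2 * ss E j))) with hH
  have hH0 : ∀ χ, 0 ≤ H χ := by
    intro χ
    refine mul_nonneg (Real.exp_pos _).le (add_nonneg (mul_nonneg (Real.exp_pos _).le (DD_nonneg _ _ _ _ _ _ _)) ?_)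
    refine Finset.sum_nonneg fun j _ => Finset.sum_nonneg fun m _ => mul_nonneg (Real.exp_pos _).le (div_nonneg (mul_nonneg (DD_nonneg _ _ _ _ _ _ _) ?_) ?_)
    · rw [pow_mul]; positivity
    · rw [pow_mul]; positivity
  have hpt : ∀ χ ∈ F, ∏ j, ‖DirichletCharacter.LFunction χ (1 / 2 + (t j) * Complex.I)‖ ^ (a j) ≤ H χ := by
    intro χ hχ
    refine harper_pt a t E q R hE (chom χ) _ C0 G ?_ ?_
    · intro r hr
      have h0 : 0 < lx E q r := by have := hlx r hr; linarith
      have h1 := hlog q hq χ (hF χ hχ) (hRH χ) t ht (xx E q r) (Real.one_lt_exp_iff.2 h0) (by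
        rw [log_xx]; have := hlx r hr; linarith)
      refine h1.trans (le_of_eq ?_)
      have h2 : C' * Real.log q / Real.log (xx E q r) = G r := by
        rw [log_xx]
        simp only [hG, lx, ss]
        push_cast
        field_simp
      rw [h2]
      rfl
    · intro m hm
      have h0 : 0 < lx E q m := by have := hlx m hm; linarith
      exact blkR_bound a t ha E q R m χ (by linarith) hR1 h0
  have hW : 0 ≤ q.totient * (C1 * Wq a t q) :=
    (Finset.sum_nonneg fun χ _ => DD_nonneg a t E q R 0 (chom χ)).trans hm0
  calc _ ≤ ∑ χ ∈ F, H χ := Finset.sum_le_sum hpt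
    _ ≤ ∑ χ, H χ := Finset.sum_le_sum_of_subset_of_nonneg (Finset.subset_univ _) fun χ _ _ => hH0 χ
    _ = Real.exp (C0+4) * (Real.exp (G 0) * ∑ χ : DirichletCharacter ℂ q, DD a t E q R 0 (chom χ) + ∑ j ∈ Finset.range R, ∑ m ∈ Finset.range (j+1),
          Real.exp (G (j+1)) * ((∑ χ : DirichletCharacter ℂ q, DD a t E q R (j+1) (chom χ) * X j m χ^(2*ss E j)) / (MM E j)^(2 * ss E j))) := by
        simp only [hH]
        rw [← Finset.mul_sum, Finset.sum_add_distrib, ← Finset.mul_sum]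
        congr 2
        rw [Finset.sum_comm]
        refine Finset.sum_congr rfl fun j _ => ?_
        rw [Finset.sum_comm]
        refine Finset.sum_congr rfl fun m _ => ?_
        rw [← Finset.mul_sum, Finset.sum_div]
    _ ≤ Real.exp (C0+4) * (Real.exp (G 0) * (q.totient * (C1 * Wq a t q)) + ∑ j ∈ Finset.range R, ∑ m ∈ Finset.range (j+1),
          (q.totient * (C1 * Wq a t q)) * (1/4)^(j+1)) := by
        refine mul_le_mul_of_nonneg_left (add_le_add (mul_le_mul_of_nonneg_left hm0 (Real.exp_pos _).le) ?_) (Real.exp_pos _).le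
        refine Finset.sum_le_sum fun j hj => Finset.sum_le_sum fun m hm => ?_
        rw [Finset.mem_range] at hj hm
        have h1 := hmj j hj m (by omega)
        have h2 := tail_term E j hE S C' (by linarith)
        have h3 : Real.exp (G (j+1)) = Real.exp (256 * C')^(ss E j) := by
          rw [← Real.exp_nat_mul]; congr 1
          simp only [hG, ss]; push_cast; ring
        rw [h3]
        have h4 : 0 < MM E j ^ (2 * ss E j) := by
          have : (0:ℝ) < E := by linarith
          unfold MM; positivity
        calc _ ≤ Real.exp (256 * C')^(ss E j) * ((q.totient * (C1 * Wq a t q) * ((4 * ss E j) * Real.exp (50 * S^2)) ^ (ss E j)) / (MM E j)^(2 * ss E j)) := by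
              refine mul_le_mul_of_nonneg_left (div_le_div_of_nonneg_right h1 h4.le) (by positivity)
          _ = (q.totient * (C1 * Wq a t q)) * (Real.exp (256 * C')^(ss E j) * (((4 * ss E j) * Real.exp (50 * S^2)) ^ (ss E j) / (MM E j)^(2 * ss E j))) := by ring
          _ ≤ _ := mul_le_mul_of_nonneg_left h2 hW
    _ = Real.exp (C0+4) * (Real.exp (G 0) * (q.totient * (C1 * Wq a t q)) + (q.totient * (C1 * Wq a t q)) * ∑ j ∈ Finset.range R, ((j:ℝ)+1) * (1/4)^(j+1)) := by
        congr 2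
        rw [Finset.mul_sum]
        refine Finset.sum_congr rfl fun j _ => ?_
        rw [Finset.sum_const, Finset.card_range, nsmul_eq_mul]; push_cast; ring
    _ ≤ Real.exp (C0+4) * (Real.exp (G 0) * (q.totient * (C1 * Wq a t q)) + (q.totient * (C1 * Wq a t q)) * 1) := by
        refine mul_le_mul_of_nonneg_left ?_ (Real.exp_pos _).le
        have := mul_le_mul_of_nonneg_left (tail_sum R) hW
        linarith
    _ = _ := by simp only [hG]; ring

lemma Wq_lower {n : ℕ} (a : Fin n → ℝ) (ha : ∀ j, 0 < a j) : ∃ c : ℝ, 0 < c ∧ ∀ (q : ℕ), 1 < q → ∀ t : Fin n → ℝ, c ≤ Wq a t q := by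
  refine ⟨Real.log 2 ^ ((∑ j, (a j)^2)/4) * ∏ i, ∏ j, (if i < j then (1/10 : ℝ) ^ (a i * a j/2) else 1), ?_, ?_⟩
  · refine mul_pos (Real.rpow_pos_of_pos (Real.log_pos (by norm_num)) _) (Finset.prod_pos fun i _ => Finset.prod_pos fun j _ => ?_)
    split_ifs <;> positivity
  · intro q hq t
    unfold Wq
    have h2 : (2:ℝ) ≤ q := by exact_mod_cast hq
    have hl2 : 0 < Real.log 2 := Real.log_pos (by norm_num)
    refine mul_le_mul ?_ ?_ ?_ ?_
    · exact Real.rpow_le_rpow hl2.le (Real.log_le_log (by norm_num) h2) (by positivity)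
    · refine Finset.prod_le_prod (fun i _ => Finset.prod_nonneg fun j _ => by split_ifs <;> positivity) fun i _ => ?_
      refine Finset.prod_le_prod (fun j _ => by split_ifs <;> positivity) fun j _ => ?_
      split_ifs
      · exact Real.rpow_le_rpow (by norm_num) (gfun_pos q hq _ (abs_nonneg _)) (by have := ha i; have := ha j; positivity)
      · exact le_rfl
    · exact Finset.prod_nonneg fun i _ => Finset.prod_nonneg fun j _ => by split_ifs <;> positivity
    · exact Real.rpow_nonneg (Real.log_natCast_nonneg q) _

theorem small_q {n : ℕ} (a : Fin n → ℝ) (ha : ∀ j, 0 < a j) (A : ℝ) (hA : 0 < A) (q0 : ℕ) : ∃ C : ℝ, 0 < C ∧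
    ∀ (q : ℕ) [NeZero q], 1 < q → q ≤ q0 →
    ∀ t : Fin n → ℝ, (∀ j, |t j| ≤ (q : ℝ) ^ A) → ∀ F : Finset (DirichletCharacter ℂ q), (∀ χ ∈ F, χ ≠ 1) →
    ∑ χ ∈ F, ∏ j, ‖DirichletCharacter.LFunction χ (1 / 2 + (t j) * Complex.I)‖ ^ (a j) ≤ C * (q.totient * Wq a t q) := by
  obtain ⟨c, hc, hW⟩ := Wq_lower a ha
  set D : ℝ := 1 + q0 * (1/2 + (q0:ℝ)^A) / (1/2) with hD
  have hD0 : 0 < D := by positivity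
  refine ⟨(∏ j, D ^ (a j)) / c, by positivity, ?_⟩
  intro q _ hq hqq t ht F hF
  have h1 : ∀ χ ∈ F, ∏ j, ‖DirichletCharacter.LFunction χ (1 / 2 + (t j) * Complex.I)‖ ^ (a j) ≤ ∏ j, D ^ (a j) := by
    intro χ hχ
    refine Finset.prod_le_prod (fun j _ => by positivity) fun j _ => ?_
    refine Real.rpow_le_rpow (norm_nonneg _) ?_ (ha j).le
    have hre : ((1:ℂ) / 2 + (t j) * Complex.I).re = 1/2 := by simp
    have h2 := LFun_bound χ (hF χ hχ) (1 / 2 + (t j) * Complex.I) (by rw [hre]; norm_num)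
    rw [hre] at h2
    refine h2.trans ?_
    have h3 : ‖((1:ℂ) / 2 + (t j) * Complex.I)‖ ≤ 1/2 + (q0:ℝ)^A := by
      refine (norm_add_le _ _).trans ?_
      have h4 : (q:ℝ)^A ≤ (q0:ℝ)^A := Real.rpow_le_rpow (by positivity) (by exact_mod_cast hqq) hA.le
      have h5 : ‖(t j : ℂ) * Complex.I‖ = |t j| := by simp
      rw [h5]
      have h6 : ‖(1:ℂ)/2‖ = 1/2 := by norm_num
      rw [h6]
      linarith [ht j]
    have h4 : (q:ℝ) ≤ q0 := by exact_mod_cast hqq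
    have : (q:ℝ) * ‖((1:ℂ) / 2 + (t j) * Complex.I)‖ / (1/2) ≤ q0 * (1/2 + (q0:ℝ)^A) / (1/2) := by gcongr
    rw [hD]; linarith
  have hP : 0 ≤ ∏ j, D ^ (a j) := by positivity
  have hcard : (F.card : ℝ) ≤ q.totient := by
    have h2 : F.card ≤ Nat.card (DirichletCharacter ℂ q) := by
      rw [Nat.card_eq_fintype_card]; exact Finset.card_le_univ F
    rw [DirichletCharacter.card_eq_totient_of_hasEnoughRootsOfUnity] at h2
    exact_mod_cast h2
  calc _ ≤ ∑ χ ∈ F, ∏ j, D ^ (a j) := Finset.sum_le_sum h1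
    _ = F.card * ∏ j, D ^ (a j) := by rw [Finset.sum_const, nsmul_eq_mul]
    _ ≤ q.totient * ∏ j, D ^ (a j) := mul_le_mul_of_nonneg_right hcard hP
    _ = (∏ j, D ^ (a j)) / c * (q.totient * c) := by field_simp
    _ ≤ _ := by
        have := hW q hq t
        gcongr

open Classical in
theorem stmt0 (k : ℕ) (hk : 0 < k) (a : Fin (2 * k) → ℝ) (A : ℝ)
    (ha : ∀ j, 0 < a j) (hA : 0 < A) :
    ∃ C : ℝ, 0 < C ∧ ∀ (q : ℕ) [NeZero q], 1 < q →
      (∀ χ : DirichletCharacter ℂ q, dirichletRH χ) →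
      ∀ t : Fin (2 * k) → ℝ, (∀ j, |t j| ≤ (q : ℝ) ^ A) →
      ∑ χ ∈ Finset.univ.filter (fun χ : DirichletCharacter ℂ q => χ.IsPrimitive),
        ∏ j, ‖DirichletCharacter.LFunction χ (1 / 2 + (t j) * Complex.I)‖ ^ (a j)
      ≤ C * (Nat.totient q) * Real.log q ^ ((∑ j, (a j) ^ 2) / 4) *
        ∏ i, ∏ j, if i < j then gfun q |t i - t j| ^ (a i * a j / 2) else 1 := by
  obtain ⟨C1, q0, hC1, h1⟩ := large_q a ha A hA
  obtain ⟨C2, hC2, h2⟩ := small_q a ha A hA q0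
  obtain ⟨c, hc, hW⟩ := Wq_lower a ha
  refine ⟨C1 + C2, by positivity, ?_⟩
  intro q _ hq hRH t ht
  have hF : ∀ χ ∈ Finset.univ.filter (fun χ : DirichletCharacter ℂ q => χ.IsPrimitive), χ ≠ 1 := by
    intro χ hχ h
    rw [Finset.mem_filter] at hχ
    have h3 := hχ.2
    rw [DirichletCharacter.isPrimitive_def, h, DirichletCharacter.conductor_one] at h3
    omega
  have hW0 : 0 ≤ (q.totient : ℝ) * Wq a t q := mul_nonneg (Nat.cast_nonneg _) (hc.le.trans (hW q hq t))
  have key : ∑ χ ∈ Finset.univ.filter (fun χ : DirichletCharacter ℂ q => χ.IsPrimitive),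
        ∏ j, ‖DirichletCharacter.LFunction χ (1 / 2 + (t j) * Complex.I)‖ ^ (a j) ≤ (C1 + C2) * (q.totient * Wq a t q) := by
    rcases le_total q0 q with h | h
    · refine (h1 q hq h hRH t ht _ hF).trans ?_
      exact mul_le_mul_of_nonneg_right (by linarith) hW0
    · refine (h2 q hq h t ht _ hF).trans ?_
      exact mul_le_mul_of_nonneg_right (by linarith) hW0
  refine key.trans (le_of_eq ?_)
  unfold Wq
  ring
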